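/- Any two finite groups G and H, each of order 2^5 · 3^4 · 5^2 · 7 · 11 · 89^3 · 373 and each having prime graph degrees deg(2) = 4, deg(3) = 4, deg(5) = 4, deg(7) = 1, deg(11) = 3, deg(89) = 3, deg(373) = 1, are isomorphic. -/

import Mathlib

/-- The degree of the prime `p` in the prime graph (Gruenberg–Kegel graph) `GK(G)` of the
group `G`: the number of primes `q ≠ p` such that `G` contains an element of order `p * q`
(two distinct primes being adjacent in `GK(G)` iff `G` has an element of order their
product). -/
noncomputable def gkDegree (G : Type*) [Group G] (p : ℕ) : ℕ :=
  Nat.card {q : ℕ // p ≠ q ∧ p.Prime ∧ q.Prime ∧ ∃ g : G, orderOf g = p * q}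

/-! Outline. The degrees of `7` and `373` determine the centralizers of elements of these orders and
give a self-centralizing cyclic subgroup of order `2611 = 7 * 373`. Character theory relative to
this subgroup produces a doubly transitive action of degree `89 ^ 3 + 1` in which a Sylow
`89`-subgroup is regular away from its fixed point. Coordinates on that subgroup, over the field
with `89 ^ 2` elements, then determine the action completely. -/

namespace U389

set_option linter.unusedSectionVars false
set_option linter.style.haveILetI false

section LocalStructure

variable {G : Type*} [Group G] [Finite G]

lemma exists_unique_neighbour {p : ℕ} (hp : p.Prime) (h : gkDegree G p = 1) :
    ∃ r, r.Prime ∧ p ≠ r ∧ (∃ g : G, orderOf g = p * r) ∧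
      ∀ q, q.Prime → p ≠ q → (∃ g : G, orderOf g = p * q) → q = r := by
  obtain ⟨h1, ⟨⟨r, hr⟩⟩⟩ := Nat.card_eq_one_iff_unique.1 h
  refine ⟨r, hr.2.2.1, hr.1, hr.2.2.2, fun q hq hpq hg => ?_⟩
  have := h1.elim ⟨q, hpq, hp, hq, hg⟩ ⟨r, hr⟩
  simpa using this

/-- The order of the centralizer of an element of prime order `p`, when `p ∥ |G|` and `p` has only
one neighbour in the prime graph. -/
lemma card_centralizer_eq {p r : ℕ} (hp : p.Prime)
    (hr : ∀ q, q.Prime → p ≠ q → (∃ g : G, orderOf g = p * q) → q = r)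
    (hpp : ¬ p ^ 2 ∣ Nat.card G) {x : G} (hx : orderOf x = p) :
    ∃ a, Nat.card (Subgroup.centralizer {x}) = p * r ^ a := by
  have hxC : x ∈ Subgroup.centralizer {x} := by
    rw [Subgroup.mem_centralizer_singleton_iff]
  have hdvd : p ∣ Nat.card (Subgroup.centralizer {x}) := by
    have := orderOf_dvd_natCard (⟨x, hxC⟩ : Subgroup.centralizer {x})
    rwa [Subgroup.orderOf_mk, hx] at this
  obtain ⟨m, hm⟩ := hdvd
  have hpm : ¬ p ∣ m := by
    rintro ⟨k, rfl⟩
    apply hpp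
    refine Dvd.dvd.trans ⟨k, ?_⟩ (Subgroup.card_subgroup_dvd_card (Subgroup.centralizer {x}))
    rw [hm]; ring
  have hm0 : m ≠ 0 := by
    rintro rfl
    exact hpm (dvd_zero _)
  have key : ∀ q, q.Prime → q ∣ m → q = r := by
    intro q hq hqm
    have hpq : p ≠ q := by rintro rfl; exact hpm hqm
    haveI := Fact.mk hq
    obtain ⟨y, hy⟩ := exists_prime_orderOf_dvd_card' (G := Subgroup.centralizer {x}) q
      (hm ▸ Dvd.dvd.mul_left hqm p)
    refine hr q hq hpq ⟨x * y, ?_⟩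
    have hc : Commute x (y : G) := (Subgroup.mem_centralizer_singleton_iff.1 y.2).symm
    rw [hc.orderOf_mul_eq_mul_orderOf_of_coprime, hx, Subgroup.orderOf_coe, hy]
    rw [hx, Subgroup.orderOf_coe, hy]
    exact (Nat.coprime_primes hp hq).2 hpq
  exact ⟨_, by rw [hm, Nat.eq_prime_pow_of_unique_prime_dvd hm0 (fun {d} hd hd' => key d hd hd')]⟩

lemma centralizer_zpowers (x : G) :
    Subgroup.centralizer (Subgroup.zpowers x : Set G) = Subgroup.centralizer {x} := by
  rw [Subgroup.zpowers_eq_closure, Subgroup.centralizer_closure]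

lemma index_normalizer_modEq {p : ℕ} [Fact p.Prime] (hpp : ¬ p ^ 2 ∣ Nat.card G)
    (hpG : p ∣ Nat.card G) {S : Subgroup G} (hS : Nat.card S = p) :
    (Subgroup.normalizer (S : Set G)).index ≡ 1 [MOD p] := by
  have hf : (Nat.card G).factorization p = 1 := by
    apply le_antisymm
    · by_contra h
      exact hpp ((Fact.out : p.Prime).pow_dvd_iff_le_factorization Nat.card_pos.ne' |>.2
        (by omega))
    · exact ((Fact.out : p.Prime).dvd_iff_one_le_factorization Nat.card_pos.ne').1 hpG
  have h1 := card_sylow_modEq_one p G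
  rw [Sylow.card_eq_index_normalizer (Sylow.ofCard S (by rw [hS, hf, pow_one]))] at h1
  exact h1

lemma card_normalizer_eq (S : Subgroup G) :
    Nat.card (Subgroup.normalizer (S : Set G)) =
      Nat.card (Subgroup.centralizer (S : Set G)) * Nat.card (S.normalizerMonoidHom).range := by
  have h1 := Subgroup.card_mul_index (S.normalizerMonoidHom).ker
  rw [Subgroup.index_ker, Subgroup.normalizerMonoidHom_ker] at h1
  rw [← h1]
  congr 1
  refine Nat.card_congr (Subgroup.subgroupOfEquivOfLe ?_).toEquiv
  exact Subgroup.centralizer_le_normalizer _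

end LocalStructure

section Torals

open scoped Pointwise

variable {G : Type*} [Group G] [Finite G]

lemma pow_le_of_dvd {r a b m : ℕ} (h : r ^ a ∣ m) (hb : ¬ r ^ (b + 1) ∣ m) : a ≤ b := by
  by_contra hab
  exact hb ((pow_dvd_pow r (by omega)).trans h)

/-- The arithmetic which identifies the neighbour of `373`. -/
lemma arith_373 {r a w i : ℕ} (hr : r.Prime) (hr373 : 373 ≠ r) (hw : w ∣ 372)
    (hcard : 373 * r ^ a * w * i = 2^5 * 3^4 * 5^2 * 7 * 11 * 89^3 * 373)
    (hi : i ≡ 1 [MOD 373]) : r = 7 ∧ a = 1 ∧ w = 3 := by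
  have h1 : r ^ a * w * i = 2^5 * 3^4 * 5^2 * 7 * 11 * 89^3 := by
    apply Nat.eq_of_mul_eq_mul_left (show 0 < 373 by norm_num)
    linarith
  have hw12 : w ∣ 12 := by
    have h2 : w ∣ 2^5 * 3^4 * 5^2 * 7 * 11 * 89^3 := ⟨r ^ a * i, by rw [← h1]; ring⟩
    have := Nat.dvd_gcd hw h2
    simpa using this
  have hmod : r ^ a * w ≡ 21 [MOD 373] := by
    have h3 : r ^ a * w * i ≡ r ^ a * w * 1 [MOD 373] := Nat.ModEq.mul_left _ hi
    rw [mul_one, h1] at h3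
    exact h3.symm.trans (by decide)
  have hra : r ^ a ∣ 2^5 * 3^4 * 5^2 * 7 * 11 * 89^3 := ⟨w * i, by rw [← h1]; ring⟩
  have hwle : w ∈ ({1, 2, 3, 4, 6, 12} : Finset ℕ) := by
    have : w ∈ Nat.divisors 12 := Nat.mem_divisors.2 ⟨hw12, by norm_num⟩
    have h4 : Nat.divisors 12 = {1, 2, 3, 4, 6, 12} := by decide
    rwa [h4] at this
  rcases Nat.eq_zero_or_pos a with rfl | ha
  · exfalso
    rw [pow_zero] at hmod
    simp only [Finset.mem_insert, Finset.mem_singleton] at hwle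
    rcases hwle with rfl | rfl | rfl | rfl | rfl | rfl <;> exact absurd hmod (by decide)
  have hr1 : r ∣ 2^5 * 3^4 * 5^2 * 7 * 11 * 89^3 := (dvd_pow_self r ha.ne').trans hra
  have hrm : r = 2 ∨ r = 3 ∨ r = 5 ∨ r = 7 ∨ r = 11 ∨ r = 89 := by
    have hd : ∀ p k : ℕ, p.Prime → r ∣ p ^ k → r = p := fun p k hp h =>
      (Nat.prime_dvd_prime_iff_eq hr hp).1 (hr.dvd_of_dvd_pow h)
    rcases hr.dvd_mul.1 hr1 with h | h
    · rcases hr.dvd_mul.1 h with h | h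
      · rcases hr.dvd_mul.1 h with h | h
        · rcases hr.dvd_mul.1 h with h | h
          · rcases hr.dvd_mul.1 h with h | h
            · exact Or.inl (hd 2 5 (by norm_num) h)
            · exact Or.inr (Or.inl (hd 3 4 (by norm_num) h))
          · exact Or.inr (Or.inr (Or.inl (hd 5 2 (by norm_num) h)))
        · exact Or.inr (Or.inr (Or.inr (Or.inl (hd 7 1 (by norm_num) (by simpa using h)))))
      · exact Or.inr (Or.inr (Or.inr (Or.inr (Or.inl (hd 11 1 (by norm_num) (by simpa using h))))))
    · exact Or.inr (Or.inr (Or.inr (Or.inr (Or.inr (hd 89 3 (by norm_num) h)))))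
  simp only [Finset.mem_insert, Finset.mem_singleton] at hwle
  have hle : a ≤ 5 := by
    rcases hrm with rfl | rfl | rfl | rfl | rfl | rfl <;>
      exact pow_le_of_dvd hra (by norm_num)
  have hle7 : r = 7 → a ≤ 1 := by rintro rfl; exact pow_le_of_dvd hra (by norm_num)
  have hle11 : r = 11 → a ≤ 1 := by rintro rfl; exact pow_le_of_dvd hra (by norm_num)
  have hle5 : r = 5 → a ≤ 2 := by rintro rfl; exact pow_le_of_dvd hra (by norm_num)
  have hle3 : r = 3 → a ≤ 4 := by rintro rfl; exact pow_le_of_dvd hra (by norm_num)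
  have hle89 : r = 89 → a ≤ 3 := by rintro rfl; exact pow_le_of_dvd hra (by norm_num)
  clear hra hr1 h1 hcard hi hw hw12 hr hr373
  rcases hrm with rfl | rfl | rfl | rfl | rfl | rfl <;>
    rcases hwle with rfl | rfl | rfl | rfl | rfl | rfl <;> interval_cases a <;>
    simp_all (decide := true)


/-- Elements of the same prime order `p ∥ |G|` have centralizers of the same order. -/
lemma card_centralizer_congr {p : ℕ} [Fact p.Prime] (hpp : ¬ p ^ 2 ∣ Nat.card G) {x y : G}
    (hx : orderOf x = p) (hy : orderOf y = p) :
    Nat.card (Subgroup.centralizer {x}) = Nat.card (Subgroup.centralizer {y}) := by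
  have hp : p.Prime := Fact.out
  have hpG : p ∣ Nat.card G := hx ▸ orderOf_dvd_natCard x
  have hf : (Nat.card G).factorization p = 1 := by
    apply le_antisymm
    · by_contra h
      exact hpp (hp.pow_dvd_iff_le_factorization Nat.card_pos.ne' |>.2 (by omega))
    · exact (hp.dvd_iff_one_le_factorization Nat.card_pos.ne').1 hpG
  have hX : Nat.card (Subgroup.zpowers x) = p ^ (Nat.card G).factorization p := by
    rw [hf, pow_one, Nat.card_zpowers, hx]
  have hY : Nat.card (Subgroup.zpowers y) = p ^ (Nat.card G).factorization p := by
    rw [hf, pow_one, Nat.card_zpowers, hy]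
  obtain ⟨g, hg⟩ := MulAction.exists_smul_eq G (Sylow.ofCard _ hX) (Sylow.ofCard _ hY)
  have hg' : MulAut.conj g • Subgroup.zpowers x = Subgroup.zpowers y := by
    have := congrArg (fun P : Sylow p G => (P : Subgroup G)) hg
    rwa [Sylow.coe_subgroup_smul, Sylow.coe_ofCard, Sylow.coe_ofCard] at this
  rw [← centralizer_zpowers x, ← centralizer_zpowers y, ← hg']
  refine Nat.card_congr ((MulAut.conj g).toEquiv.subtypeEquiv fun a => ?_)
  simp only [Subgroup.mem_centralizer_iff]
  constructor
  · intro h b hb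
    obtain ⟨c, hc, rfl⟩ := hb
    exact (show Commute c a from h c hc).map (MulAut.conj g)
  · intro h b hb
    have := h (MulAut.conj g b) ⟨b, hb, rfl⟩
    exact Commute.of_map (f := MulAut.conj g) (MulAut.conj g).injective this

/-- The common order of the groups under consideration. -/
abbrev ordU : ℕ := 2^5 * 3^4 * 5^2 * 7 * 11 * 89^3 * 373

instance fact_prime_373 : Fact (Nat.Prime 373) := ⟨by norm_num⟩

instance fact_prime_7 : Fact (Nat.Prime 7) := ⟨by norm_num⟩

instance fact_prime_89 : Fact (Nat.Prime 89) := ⟨by norm_num⟩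

lemma local_373 (hG : Nat.card G = ordU) (h373 : gkDegree G 373 = 1) :
    (∃ g : G, orderOf g = 7 * 373) ∧ ∀ x : G, orderOf x = 373 →
      Nat.card (Subgroup.centralizer {x}) = 2611 ∧
      Nat.card (Subgroup.normalizer (Subgroup.zpowers x : Set G)) = 7833 := by
  obtain ⟨r, hr, hne, ⟨g, hg⟩, hun⟩ := exists_unique_neighbour (by norm_num) h373
  have hpp : ¬ 373 ^ 2 ∣ Nat.card G := by rw [hG]; norm_num
  have key : ∀ x : G, orderOf x = 373 → r = 7 ∧
      Nat.card (Subgroup.centralizer {x}) = 2611 ∧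
      Nat.card (Subgroup.normalizer (Subgroup.zpowers x : Set G)) = 7833 := by
    intro x hx
    obtain ⟨a, ha⟩ := card_centralizer_eq (by norm_num) hun hpp hx
    have hS : Nat.card (Subgroup.zpowers x) = 373 := by rw [Nat.card_zpowers, hx]
    have hi := index_normalizer_modEq hpp (by rw [hG]; norm_num) hS
    have hN := card_normalizer_eq (Subgroup.zpowers x)
    have hw : Nat.card ((Subgroup.zpowers x).normalizerMonoidHom).range ∣ 372 := by
      refine (Subgroup.card_subgroup_dvd_card _).trans ?_
      rw [IsCyclic.card_mulAut, hS, Nat.totient_prime (by norm_num)]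
    have hc := Subgroup.card_mul_index (Subgroup.normalizer (Subgroup.zpowers x : Set G))
    rw [centralizer_zpowers, ha] at hN
    rw [hN, hG] at hc
    obtain ⟨rfl, rfl, h3⟩ := arith_373 hr hne hw hc hi
    rw [h3] at hN
    exact ⟨rfl, by rw [ha]; norm_num, by rw [hN]; norm_num⟩
  refine ⟨?_, fun x hx => (key x hx).2⟩
  have hx : orderOf (g ^ r) = 373 := by
    rw [orderOf_pow_of_dvd hr.ne_zero (hg ▸ Dvd.intro_left 373 rfl), hg,
      Nat.mul_div_cancel _ hr.pos]
  obtain ⟨rfl, -⟩ := key _ hx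
  exact ⟨g, by rw [hg]⟩

lemma local_7 (hG : Nat.card G = ordU) (h7 : gkDegree G 7 = 1) (h373 : gkDegree G 373 = 1) :
    ∀ x : G, orderOf x = 7 → Nat.card (Subgroup.centralizer {x}) = 2611 := by
  obtain ⟨⟨g, hg⟩, -⟩ := local_373 hG h373
  obtain ⟨r, hr, hne, -, hun⟩ := exists_unique_neighbour (by norm_num) h7
  obtain rfl : 373 = r := hun 373 (by norm_num) (by norm_num) ⟨g, hg⟩
  have hpp : ¬ 7 ^ 2 ∣ Nat.card G := by rw [hG]; norm_num
  intro x hx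
  have hy : orderOf (g ^ 373) = 7 := by
    rw [orderOf_pow_of_dvd (by norm_num) (by rw [hg]; norm_num), hg]
  rw [card_centralizer_congr hpp hx hy]
  obtain ⟨b, hb⟩ := card_centralizer_eq (by norm_num) hun hpp hy
  have h1 : 373 ∣ Nat.card (Subgroup.centralizer {g ^ 373}) := by
    have hgC : g ∈ Subgroup.centralizer {g ^ 373} := by
      rw [Subgroup.mem_centralizer_singleton_iff]
      exact (Commute.refl g).pow_right 373
    have := orderOf_dvd_natCard (⟨g, hgC⟩ : Subgroup.centralizer {g ^ 373})
    rw [Subgroup.orderOf_mk, hg] at this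
    exact (Dvd.intro_left 7 rfl).trans this
  have hble : b ≤ 1 := by
    refine pow_le_of_dvd (r := 373) (m := Nat.card G) ?_ (by rw [hG]; norm_num)
    exact (Dvd.intro_left _ hb.symm).trans (Subgroup.card_subgroup_dvd_card _)
  rw [hb] at h1 ⊢
  interval_cases b
  · norm_num at h1
  · norm_num

/-- The structure of the centralizer of a Sylow `373`-subgroup. -/
theorem exists_torus (hG : Nat.card G = ordU) (h7 : gkDegree G 7 = 1)
    (h373 : gkDegree G 373 = 1) : ∃ τ : G, orderOf τ = 2611 ∧
      (∀ a : ℕ, ¬ 2611 ∣ a → ∀ g : G, Commute g (τ ^ a) → g ∈ Subgroup.zpowers τ) ∧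
      Nat.card (Subgroup.normalizer (Subgroup.zpowers τ : Set G)) = 7833 := by
  obtain ⟨⟨τ, hτ⟩, hl⟩ := local_373 hG h373
  have hl7 := local_7 hG h7 h373
  have hcard : Nat.card (Subgroup.zpowers τ) = 2611 := by rw [Nat.card_zpowers, hτ]
  have hC : ∀ k, Nat.card (Subgroup.centralizer {τ ^ k}) = 2611 →
      Subgroup.centralizer {τ ^ k} = Subgroup.zpowers τ := by
    intro k hk
    symm
    apply Subgroup.eq_of_le_of_card_ge
    · rw [Subgroup.zpowers_le, Subgroup.mem_centralizer_singleton_iff]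
      exact (Commute.refl τ).pow_right k
    · rw [hk, hcard]
  have h373' : orderOf (τ ^ 7) = 373 := by
    rw [orderOf_pow_of_dvd (by norm_num) (by rw [hτ]; norm_num), hτ]
  have hC7 := hC 7 (hl _ h373').1
  have hmem : ∀ a : ℕ, ¬ 2611 ∣ a → ∀ g : G, Commute g (τ ^ a) → g ∈ Subgroup.zpowers τ := by
    intro a ha g hg
    have hpow : ∀ k, (τ ^ a) ^ k = τ ^ (a * k) := fun k => (pow_mul _ _ _).symm
    by_cases h7a : 7 ∣ a
    · have h373a : ¬ 373 ∣ a := fun h => ha (Nat.Coprime.mul_dvd_of_dvd_of_dvd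
        (show Nat.Coprime 7 373 by norm_num) h7a h)
      obtain ⟨c, rfl⟩ := h7a
      rw [← hC (7 * c), Subgroup.mem_centralizer_singleton_iff]
      · exact hg
      · refine (hl _ ?_).1
        rw [pow_mul, Nat.Coprime.orderOf_pow, h373']
        rw [h373']
        exact ((Nat.Prime.coprime_iff_not_dvd (by norm_num)).2
          fun h => h373a (Dvd.dvd.mul_left h 7))
    · rw [← hC (373 * a), Subgroup.mem_centralizer_singleton_iff]
      · rw [mul_comm, ← hpow]; exact hg.pow_right 373
      · refine hl7 _ ?_
        have h7' : orderOf (τ ^ 373) = 7 := by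
          rw [orderOf_pow_of_dvd (by norm_num) (by rw [hτ]; norm_num), hτ]
        rw [pow_mul, Nat.Coprime.orderOf_pow, h7']
        rw [h7']
        exact (Nat.Prime.coprime_iff_not_dvd (by norm_num)).2 h7a
  refine ⟨τ, hτ, hmem, ?_⟩
  rw [← (hl _ h373').2]
  congr 2
  apply le_antisymm
  · intro g hg
    have h1 : g * τ * g⁻¹ ∈ Subgroup.zpowers τ :=
      (Subgroup.mem_normalizer_iff.1 hg τ).1 (Subgroup.mem_zpowers τ)
    obtain ⟨m, hm⟩ := h1
    rw [Subgroup.mem_normalizer_iff_map_conj_eq]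
    apply Subgroup.eq_of_le_of_card_ge
    · rw [MonoidHom.map_zpowers, Subgroup.zpowers_le]
      refine ⟨m, ?_⟩
      simp only [MonoidHom.coe_coe, MulAut.conj_apply]
      rw [← conj_pow, ← hm, ← zpow_natCast, ← zpow_natCast, ← zpow_mul, ← zpow_mul, mul_comm]
    · rw [Subgroup.card_map_of_injective]
      exact (MulAut.conj g).injective
  · intro g hg
    have h1 : g⁻¹ * τ ^ 7 * g ∈ Subgroup.zpowers (τ ^ 7) :=
      (Subgroup.mem_normalizer_iff''.1 hg (τ ^ 7)).1 (Subgroup.mem_zpowers _)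
    rw [Subgroup.mem_normalizer_iff_map_conj_eq]
    apply Subgroup.eq_of_le_of_card_ge
    · rw [MonoidHom.map_zpowers, Subgroup.zpowers_le]
      refine hmem 7 (by norm_num) _ ?_
      obtain ⟨m, hm⟩ := h1
      have h2 : Commute τ (g⁻¹ * τ ^ 7 * g) := by
        rw [← hm]; exact ((Commute.refl τ).pow_right 7).zpow_right m
      have h3 := h2.map (MulAut.conj g)
      simpa [mul_assoc] using h3
    · rw [Subgroup.card_map_of_injective]
      exact (MulAut.conj g).injective

end Torals

section Wedderburn

/-- The complex irreducible matrix representations of a finite group, together with the two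
orthogonality properties from which all character theory below is derived. -/
structure IrrData (G : Type*) [Group G] [Fintype G] where
  /-- the number of representations -/
  n : ℕ
  /-- the degrees -/
  d : Fin n → ℕ
  pos : ∀ i, 0 < d i
  /-- the representations -/
  ρ : ∀ i, G →* Matrix (Fin (d i)) (Fin (d i)) ℂ
  orth : ∀ s t, ∑ i, (ρ i s).trace * (ρ i t).trace = Nat.card {g // s * g * t = g}
  surj : ∀ i A, ((d i : ℂ) / Fintype.card G) • ∑ g, (A * ρ i g⁻¹).trace • ρ i g = A

variable {G : Type*} [Group G] [Fintype G]

lemma trace_mulLeftRight_single (s t : G) :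
    LinearMap.trace ℂ (MonoidAlgebra ℂ G)
      (LinearMap.mulLeft ℂ (MonoidAlgebra.single s (1 : ℂ)) ∘ₗ
        LinearMap.mulRight ℂ (MonoidAlgebra.single t (1 : ℂ))) =
      Nat.card {g // s * g * t = g} := by
  classical
  rw [LinearMap.trace_eq_matrix_trace ℂ (MonoidAlgebra.basis G ℂ), Matrix.trace,
    Nat.card_eq_fintype_card, Fintype.card_subtype, Finset.card_filter]
  push_cast
  refine Finset.sum_congr rfl fun g _ => ?_
  rw [Matrix.diag_apply, LinearMap.toMatrix_apply]
  simp [MonoidAlgebra.single_mul_single, ← mul_assoc, MonoidAlgebra.basis, Finsupp.single_apply]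

lemma trace_mulLeftRight_pi {n : ℕ} {d : Fin n → ℕ}
    (a b : ∀ i, Matrix (Fin (d i)) (Fin (d i)) ℂ) :
    LinearMap.trace ℂ (∀ i, Matrix (Fin (d i)) (Fin (d i)) ℂ)
      (LinearMap.mulLeft ℂ a ∘ₗ LinearMap.mulRight ℂ b) =
      ∑ i, (a i).trace * (b i).trace := by
  classical
  rw [LinearMap.trace_eq_matrix_trace ℂ (Pi.basis fun i =>
    Matrix.stdBasis ℂ (Fin (d i)) (Fin (d i))),
    Matrix.trace, Fintype.sum_sigma]
  refine Finset.sum_congr rfl fun i _ => ?_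
  rw [Fintype.sum_prod_type, Matrix.trace, Matrix.trace, Finset.sum_mul_sum]
  refine Finset.sum_congr rfl fun j _ => Finset.sum_congr rfl fun k _ => ?_
  rw [Matrix.diag_apply, LinearMap.toMatrix_apply]
  have hr : ∀ M : Matrix (Fin (d i)) (Fin (d i)) ℂ,
      (Matrix.stdBasis ℂ (Fin (d i)) (Fin (d i))).repr M (j, k) = M j k := fun M => rfl
  simp only [Pi.basis_repr, Pi.basis_apply, Matrix.stdBasis_eq_single, LinearMap.comp_apply,
    LinearMap.mulLeft_apply, LinearMap.mulRight_apply, hr, Pi.mul_apply, Pi.single_eq_same]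
  rw [← mul_assoc]
  simp [Matrix.mul_apply, Matrix.single_apply, ite_and]

theorem exists_irrData (G : Type*) [Group G] [Fintype G] : Nonempty (IrrData G) := by
  classical
  obtain ⟨n, d, hd, ⟨Φ⟩⟩ :=
    IsSemisimpleRing.exists_algEquiv_pi_matrix_of_isAlgClosed ℂ (MonoidAlgebra ℂ G)
  let ρ : ∀ i, G →* Matrix (Fin (d i)) (Fin (d i)) ℂ := fun i =>
    ((Pi.evalAlgHom ℂ _ i).comp Φ.toAlgHom : _ →* _).comp (MonoidAlgebra.of ℂ G)
  have hρ : ∀ i g, ρ i g = Φ (MonoidAlgebra.single g 1) i := fun i g => rfl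
  have horth : ∀ s t, ∑ i, (ρ i s).trace * (ρ i t).trace = Nat.card {g // s * g * t = g} := by
    intro s t
    rw [← trace_mulLeftRight_single s t, ← LinearMap.trace_conj' _ Φ.toLinearEquiv]
    simp only [hρ]
    rw [← trace_mulLeftRight_pi]
    congr 1
    refine LinearMap.ext fun x => ?_
    simp [LinearEquiv.conj_apply]
  refine ⟨⟨n, d, fun i => Nat.pos_of_ne_zero (hd i).1, ρ, horth, ?_⟩⟩
  intro i A
  have hcard : (Fintype.card G : ℂ) ≠ 0 := by simp
  have hreg : ∀ x : MonoidAlgebra ℂ G, ∑ j, (d j : ℂ) * (Φ x j).trace =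
    Fintype.card G * x.coeff 1 := by
    intro x
    induction x using MonoidAlgebra.induction_linear with
    | zero => simp
    | add x y hx hy => simp [mul_add, Finset.sum_add_distrib, hx, hy]
    | single g r =>
      have h1 := horth g 1
      have h2 : MonoidAlgebra.single g r = r • MonoidAlgebra.single g (1 : ℂ) := by simp
      rw [h2]
      simp only [map_smul, Pi.smul_apply, Matrix.trace_smul, smul_eq_mul, ← hρ]
      simp only [map_one, Matrix.trace_one, Fintype.card_fin, mul_one] at h1
      have h3 : ∑ j, (d j : ℂ) * (r * (ρ j g).trace) = r * ∑ j, (ρ j g).trace * (d j : ℂ) := by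
        rw [Finset.mul_sum]; exact Finset.sum_congr rfl fun j _ => by ring
      rw [h3, h1]
      by_cases hg : g = 1
      · subst hg; simp; ring
      · simp [hg]
  set a := Φ.symm (Pi.single i A) with ha
  have hcoeff : ∀ g, a.coeff g = (d i : ℂ) / Fintype.card G * (A * ρ i g⁻¹).trace := by
    intro g
    have h1 := hreg (a * MonoidAlgebra.single g⁻¹ 1)
    have h2 : (a * MonoidAlgebra.single g⁻¹ (1 : ℂ)).coeff 1 = a.coeff g := by
      simp
    rw [h2, Finset.sum_eq_single i] at h1
    · rw [map_mul, Pi.mul_apply, ← hρ, ha, AlgEquiv.apply_symm_apply, Pi.single_eq_same] at h1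
      field_simp
      rw [h1]; ring
    · intro j _ hj
      rw [map_mul, Pi.mul_apply, ha, AlgEquiv.apply_symm_apply, Pi.single_eq_of_ne hj]
      simp
    · simp
  have hsum : a = ∑ g, a.coeff g • MonoidAlgebra.single g (1 : ℂ) := by
    ext g
    simp
  have h := congrArg (fun x => Φ x i) hsum
  simp only [map_sum, map_smul, Finset.sum_apply, Pi.smul_apply, ← hρ, hcoeff] at h
  rw [ha, AlgEquiv.apply_symm_apply, Pi.single_eq_same] at h
  rw [Finset.smul_sum]
  conv_rhs => rw [h]
  exact Finset.sum_congr rfl fun g _ => by rw [smul_smul]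

end Wedderburn

section Averages

lemma Matrix_trace_eq_nat {d : ℕ} {E : Matrix (Fin d) (Fin d) ℂ} (hE : E * E = E) :
    ∃ m : ℕ, E.trace = m := by
  have h : IsIdempotentElem (Matrix.toLin' E) := by
    rw [IsIdempotentElem, Module.End.mul_eq_comp, ← Matrix.toLin'_mul, hE]
  refine ⟨Module.finrank ℂ (LinearMap.range (Matrix.toLin' E)), ?_⟩
  rw [← Matrix.trace_toLin'_eq]
  exact LinearMap.IsProj.trace (LinearMap.IsIdempotentElem.isProj_range _ h)

lemma Matrix_eq_zero_of_trace {d : ℕ} {E : Matrix (Fin d) (Fin d) ℂ} (hE : E * E = E)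
    (ht : E.trace = 0) : E = 0 := by
  have h : IsIdempotentElem (Matrix.toLin' E) := by
    rw [IsIdempotentElem, Module.End.mul_eq_comp, ← Matrix.toLin'_mul, hE]
  rw [← Matrix.trace_toLin'_eq] at ht
  have := (LinearMap.IsIdempotentElem.trace_eq_zero_iff h).1 ht
  simpa using this

variable {A : Type*} [Group A] [Fintype A] {d : ℕ}

/-- The projection onto the `μ`-isotypic part of a representation. -/
noncomputable def avg (ρ : A →* Matrix (Fin d) (Fin d) ℂ) (μ : A →* ℂ) :
    Matrix (Fin d) (Fin d) ℂ :=
  (Fintype.card A : ℂ)⁻¹ • ∑ a, μ a⁻¹ • ρ a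

variable (ρ : A →* Matrix (Fin d) (Fin d) ℂ) (μ : A →* ℂ)

lemma char_mul_inv (a : A) : μ a * μ a⁻¹ = 1 := by
  rw [← map_mul, mul_inv_cancel, map_one]

lemma mul_avg (b : A) : ρ b * avg ρ μ = μ b • avg ρ μ := by
  rw [avg, mul_smul_comm, smul_comm (μ b)]
  congr 1
  rw [Finset.mul_sum, Finset.smul_sum]
  refine Fintype.sum_equiv (Equiv.mulLeft b) _ _ fun a => ?_
  rw [Equiv.coe_mulLeft, mul_smul_comm, ← map_mul, smul_smul, mul_inv_rev, map_mul μ,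
    mul_left_comm, char_mul_inv, mul_one]

lemma avg_mul_avg : avg ρ μ * avg ρ μ = avg ρ μ := by
  conv_lhs => enter [1]; rw [avg]
  rw [smul_mul_assoc, Finset.sum_mul]
  have : ∀ a, (μ a⁻¹ • ρ a) * avg ρ μ = avg ρ μ := by
    intro a
    rw [smul_mul_assoc, mul_avg, smul_smul, mul_comm, char_mul_inv, one_smul]
  simp only [this, Finset.sum_const, Finset.card_univ]
  rw [← Nat.cast_smul_eq_nsmul ℂ, smul_smul, inv_mul_cancel₀ (by simp), one_smul]

lemma avg_trace : (avg ρ μ).trace = (Fintype.card A : ℂ)⁻¹ * ∑ a, μ a⁻¹ * (ρ a).trace := by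
  simp [avg, Matrix.trace_smul, Matrix.trace_sum]

/-- The multiplicity of the linear character `μ` in a representation. -/
noncomputable def mult : ℕ := (Matrix_trace_eq_nat (avg_mul_avg ρ μ)).choose

lemma mult_eq : (avg ρ μ).trace = mult ρ μ :=
  (Matrix_trace_eq_nat (avg_mul_avg ρ μ)).choose_spec

end Averages

section Abelian

variable {A : Type*} [AddCommGroup A] [Fintype A] {d : ℕ}
  (ρ : Multiplicative A →* Matrix (Fin d) (Fin d) ℂ)

lemma trace_eq_sum_mult (a : A) :
    (ρ (Multiplicative.ofAdd a)).trace = ∑ ψ : AddChar A ℂ, mult ρ ψ.toMonoidHom * ψ a := by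
  classical
  have hA : (Fintype.card A : ℂ) ≠ 0 := by simp
  have h1 : ∀ ψ : AddChar A ℂ, (mult ρ ψ.toMonoidHom : ℂ) * ψ a =
      (Fintype.card A : ℂ)⁻¹ * ∑ b : A, ψ (a - b) * (ρ (Multiplicative.ofAdd b)).trace := by
    intro ψ
    rw [← mult_eq, avg_trace, mul_assoc, Finset.sum_mul, Fintype.card_multiplicative]
    congr 1
    refine Fintype.sum_equiv Multiplicative.toAdd _ _ fun b => ?_
    rw [sub_eq_add_neg, AddChar.map_add_eq_mul]
    change ψ (-(Multiplicative.toAdd b)) * _ * _ = _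
    rw [ofAdd_toAdd]; ring
  simp only [h1]
  rw [← Finset.mul_sum, Finset.sum_comm]
  simp only [← Finset.sum_mul, AddChar.sum_apply_eq_ite]
  simp only [sub_eq_zero, ite_mul, zero_mul, Finset.sum_ite_eq, Finset.mem_univ, if_true]
  field_simp

end Abelian

section Cyclic

variable {G : Type*} [Group G]

/-- The homomorphism from `ℤ/n` onto the cyclic group generated by `g`, where `g ^ n = 1`. -/
def zmodHom (n : ℕ) (g : G) (h : g ^ n = 1) : Multiplicative (ZMod n) →* G :=
  AddMonoidHom.toMultiplicativeLeft
    (ZMod.lift n ⟨zmultiplesHom (Additive G) (Additive.ofMul g), by simp [← ofMul_pow, h]⟩)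

lemma zmodHom_natCast {n : ℕ} {g : G} (h : g ^ n = 1) (k : ℕ) :
    zmodHom n g h (Multiplicative.ofAdd (k : ZMod n)) = g ^ k := by
  rw [zmodHom, AddMonoidHom.coe_toMultiplicativeLeft]
  have : ((k : ℤ) : ZMod n) = k := by simp
  simp only [Function.comp_apply, toAdd_ofAdd]
  rw [← this, ZMod.lift_coe]
  simp

end Cyclic

section Chi
variable {G : Type*} [Group G] [Fintype G] (D : IrrData G)

/-- The irreducible characters. -/
noncomputable def IrrData.χ (i : Fin D.n) (g : G) : ℂ := (D.ρ i g).trace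

lemma IrrData.χ_one (i : Fin D.n) : D.χ i 1 = D.d i := by simp [IrrData.χ]

lemma IrrData.orth' (s t : G) : ∑ i, D.χ i s * D.χ i t = Nat.card {g // s * g * t = g} := D.orth s t

lemma IrrData.row (i : Fin D.n) : ∑ g, D.χ i g * D.χ i g⁻¹ = Fintype.card G := by
  have h := congrArg Matrix.trace (D.surj i 1)
  have h0 : (D.d i : ℂ) ≠ 0 := by simp [(D.pos i).ne']
  have h1 : (Fintype.card G : ℂ) ≠ 0 := by simp
  simp only [one_mul, Matrix.trace_smul, Matrix.trace_sum, Matrix.trace_one, Fintype.card_fin,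
    smul_eq_mul] at h
  have h2 : ∑ g, D.χ i g * D.χ i g⁻¹ = ∑ g, (D.ρ i g⁻¹).trace * (D.ρ i g).trace :=
    Finset.sum_congr rfl fun g _ => mul_comm _ _
  rw [h2]
  field_simp at h
  exact h

lemma exists_sum_addChar (i : Fin D.n) (g : G) :
    ∃ (ι : Type) (_ : Fintype ι) (m : ι → ℕ) (z : ι → ℂ),
    (∀ k, ‖z k‖ = 1 ∧ IsIntegral ℤ (z k)) ∧ D.χ i g = ∑ k, m k * z k ∧
      D.χ i g⁻¹ = ∑ k, m k * (starRingEnd ℂ) (z k) := by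
  let n := orderOf g
  have : NeZero n := ⟨(orderOf_pos g).ne'⟩
  let f : Multiplicative (ZMod n) →* G := zmodHom n g (pow_orderOf_eq_one g)
  have hf : f (Multiplicative.ofAdd 1) = g := by
    simpa using zmodHom_natCast (pow_orderOf_eq_one g) 1
  have hf' : f (Multiplicative.ofAdd (-1)) = g⁻¹ := by
    rw [ofAdd_neg, map_inv, hf]
  refine ⟨AddChar (ZMod n) ℂ, inferInstance, fun ψ => mult ((D.ρ i).comp f) ψ.toMonoidHom,
    fun ψ => ψ 1, fun ψ => ⟨AddChar.norm_apply _ _, ?_⟩, ?_, ?_⟩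
  · refine IsIntegral.of_pow (n := n) (NeZero.pos n) ?_
    rw [← AddChar.map_nsmul_eq_pow]
    simp [isIntegral_one]
  · rw [← trace_eq_sum_mult]
    simp [hf, IrrData.χ]
  · simp only [← AddChar.map_neg_eq_conj]
    rw [← trace_eq_sum_mult]
    rw [MonoidHom.comp_apply, hf', IrrData.χ]

lemma IrrData.χ_inv (i : Fin D.n) (g : G) : D.χ i g⁻¹ = (starRingEnd ℂ) (D.χ i g) := by
  obtain ⟨ι, _, m, z, -, h1, h2⟩ := exists_sum_addChar D i g
  simp [h1, h2]

lemma IrrData.χ_isIntegral (i : Fin D.n) (g : G) : IsIntegral ℤ (D.χ i g) := by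
  obtain ⟨ι, _, m, z, hz, h1, h2⟩ := exists_sum_addChar D i g
  rw [h1]
  exact IsIntegral.sum _ fun k _ => (isIntegral_natCast _).mul (hz k).2


/-- Degrees of irreducible characters divide the group order. -/
lemma IrrData.d_dvd (i : Fin D.n) : D.d i ∣ Fintype.card G := by
  let O := integralClosure ℤ ℂ
  have h0 : (D.d i : ℂ) ≠ 0 := by simp [(D.pos i).ne']
  have h1 : (Fintype.card G : ℂ) ≠ 0 := by simp
  let f : MonoidAlgebra O G →ₐ[O] Matrix (Fin (D.d i)) (Fin (D.d i)) ℂ :=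
    MonoidAlgebra.lift O _ G (D.ρ i)
  let E : MonoidAlgebra O G := ∑ g, MonoidAlgebra.single g ⟨D.χ i g⁻¹, D.χ_isIntegral i g⁻¹⟩
  have hE : IsIntegral O E := Algebra.IsIntegral.isIntegral E
  have hfE : f E = algebraMap ℂ _ ((Fintype.card G : ℂ) / D.d i) := by
    have h := D.surj i 1
    have h2 : f E = ∑ g, (1 * D.ρ i g⁻¹).trace • D.ρ i g := by
      simp only [E, map_sum, f, MonoidAlgebra.lift_single, one_mul]
      rfl
    rw [h2, Algebra.algebraMap_eq_smul_one]
    conv_rhs => rw [← h]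
    rw [smul_smul, div_mul_div_cancel₀ h0, div_self h1, one_smul]
  have h2 : IsIntegral O ((Fintype.card G : ℂ) / D.d i) := by
    have : Nonempty (Fin (D.d i)) := ⟨⟨0, D.pos i⟩⟩
    rw [← isIntegral_algebraMap_iff (B := Matrix (Fin (D.d i)) (Fin (D.d i)) ℂ)
      (FaithfulSMul.algebraMap_injective _ _), ← hfE]
    exact hE.map f
  have h3 : IsIntegral ℤ ((Fintype.card G : ℂ) / D.d i) := isIntegral_trans _ h2
  have h4 : IsIntegral ℤ ((Fintype.card G : ℚ) / D.d i) := by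
    rw [← isIntegral_algebraMap_iff (B := ℂ) (FaithfulSMul.algebraMap_injective _ _)]
    simpa using h3
  obtain ⟨y, hy⟩ := IsIntegrallyClosed.isIntegral_iff.1 h4
  have h5 : (D.d i : ℚ) ≠ 0 := by simp [(D.pos i).ne']
  have h6 : (Fintype.card G : ℤ) = D.d i * y := by
    rw [eq_div_iff h5] at hy
    have : (y : ℚ) * (D.d i : ℚ) = Fintype.card G := hy
    rw [mul_comm]
    exact_mod_cast this.symm
  exact Int.natCast_dvd_natCast.1 ⟨y, h6⟩

/-- The multiplicity of the linear character `μ` of `A` in the restriction of `ρ i` along `f`. -/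
noncomputable def IrrData.m {A : Type*} [Group A] [Fintype A] (f : A →* G) (μ : A →* ℂ)
    (i : Fin D.n) : ℕ := mult ((D.ρ i).comp f) μ

lemma IrrData.m_eq {A : Type*} [Group A] [Fintype A] (f : A →* G) (μ : A →* ℂ) (i : Fin D.n) :
    (D.m f μ i : ℂ) = (Fintype.card A : ℂ)⁻¹ * ∑ a, μ a⁻¹ * D.χ i (f a) := by
  rw [IrrData.m, ← mult_eq, avg_trace]
  rfl

lemma IrrData.sum_m_mul_m {A : Type*} [Group A] [Fintype A] (f : A →* G) (μ ν : A →* ℂ) :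
    (∑ i, D.m f μ i * D.m f ν i : ℂ) = (Fintype.card A : ℂ)⁻¹ ^ 2 *
      ∑ a, ∑ b, μ a⁻¹ * ν b⁻¹ * Nat.card {g // f a * g * f b = g} := by
  have h : ∀ i, (D.m f μ i * D.m f ν i : ℂ) = (Fintype.card A : ℂ)⁻¹ ^ 2 *
      ∑ a, ∑ b, μ a⁻¹ * ν b⁻¹ * (D.χ i (f a) * D.χ i (f b)) := by
    intro i
    rw [D.m_eq, D.m_eq, mul_mul_mul_comm, Finset.sum_mul_sum, sq]
    congr 1
    refine Finset.sum_congr rfl fun a _ => Finset.sum_congr rfl fun b _ => by ring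
  simp only [h]
  rw [← Finset.mul_sum, Finset.sum_comm]
  congr 1
  refine Finset.sum_congr rfl fun a _ => ?_
  rw [Finset.sum_comm]
  refine Finset.sum_congr rfl fun b _ => ?_
  rw [← Finset.mul_sum, D.orth']

lemma IrrData.sum_d_mul_χ (g : G) [Decidable (g = 1)] :
    ∑ i, D.d i * D.χ i g = if g = 1 then (Fintype.card G : ℂ) else 0 := by
  have h := D.orth' 1 g
  simp only [D.χ_one] at h
  rw [h]
  split_ifs with hg
  · simp [hg]
  · have : IsEmpty {x : G // 1 * x * g = x} := ⟨fun x => hg (by simpa using x.2)⟩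
    rw [Nat.card_of_isEmpty, Nat.cast_zero]

lemma IrrData.sum_d_mul_m {A : Type*} [Group A] [Fintype A] (f : A →* G)
    (hf : Function.Injective f) (μ : A →* ℂ) :
    (∑ i, D.d i * D.m f μ i) * Fintype.card A = Fintype.card G := by
  classical
  have hA : (Fintype.card A : ℂ) ≠ 0 := by simp
  have h : ∀ i, (D.d i * D.m f μ i : ℂ) = (Fintype.card A : ℂ)⁻¹ *
      ∑ a, μ a⁻¹ * (D.d i * D.χ i (f a)) := by
    intro i
    rw [D.m_eq, mul_left_comm, Finset.mul_sum]
    congr 1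
    exact Finset.sum_congr rfl fun a _ => by ring
  have h2 : (∑ i, D.d i * D.m f μ i : ℂ) * Fintype.card A = Fintype.card G := by
    simp only [h]
    rw [← Finset.mul_sum, Finset.sum_comm]
    simp only [← Finset.mul_sum, D.sum_d_mul_χ]
    have h3 : ∀ a, f a = 1 ↔ a = 1 := fun a => map_eq_one_iff f hf
    simp only [h3, mul_ite, mul_zero, Finset.sum_ite_eq', Finset.mem_univ, if_true]
    rw [inv_one, map_one, one_mul, mul_comm, mul_inv_cancel_left₀ hA]
  exact_mod_cast h2

/-- The trivial representation. -/
lemma IrrData.exists_trivial : ∃ i, D.d i = 1 ∧ ∀ g, D.ρ i g = 1 := by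
  classical
  have h1 := D.sum_d_mul_m (MonoidHom.id G) Function.injective_id (1 : G →* ℂ)
  have h2 : ∑ i, D.d i * D.m (MonoidHom.id G) 1 i = 1 := by
    refine Nat.eq_of_mul_eq_mul_right (Fintype.card_pos (α := G)) ?_
    rw [h1, one_mul]
  obtain ⟨i, -, hi⟩ := Finset.exists_ne_zero_of_sum_ne_zero (h2 ▸ one_ne_zero)
  have hle : D.d i * D.m (MonoidHom.id G) 1 i ≤ 1 := by
    rw [← h2]
    exact Finset.single_le_sum (f := fun i => D.d i * D.m (MonoidHom.id G) 1 i)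
      (fun _ _ => Nat.zero_le _) (Finset.mem_univ i)
  have h3 : D.d i * D.m (MonoidHom.id G) 1 i = 1 := by omega
  obtain ⟨hd, hm⟩ := mul_eq_one.1 h3
  refine ⟨i, hd, fun g => ?_⟩
  have ht := mult_eq (D.ρ i) 1
  have ht' : mult (D.ρ i) 1 = 1 := hm
  have hE := mul_avg (D.ρ i) 1 g
  have : Unique (Fin (D.d i)) := by rw [hd]; infer_instance
  rw [ht'] at ht
  have hE1 : avg (D.ρ i) 1 = 1 := by
    ext a b
    rw [Subsingleton.elim b a, Matrix.one_apply_eq, ← Nat.cast_one, ← ht, Matrix.trace,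
      Fintype.sum_unique, Matrix.diag_apply, Subsingleton.elim a default]
  rwa [hE1, mul_one, MonoidHom.one_apply, one_smul] at hE

end Chi

section Sunflower

/-- Five or more triples meeting pairwise in pairs have a pair in common. -/
lemma sunflower {α : Type*} [DecidableEq α] (S : Finset (Finset α))
    (h3 : ∀ A ∈ S, A.card = 3) (h2 : ∀ A ∈ S, ∀ B ∈ S, A ≠ B → (A ∩ B).card = 2)
    (h5 : 5 ≤ S.card) : ∃ Q : Finset α, Q.card = 2 ∧ ∀ A ∈ S, Q ⊆ A := by
  obtain ⟨A, hA, B, hB, hAB⟩ := Finset.one_lt_card.1 (show 1 < S.card by omega)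
  refine ⟨A ∩ B, h2 A hA B hB hAB, ?_⟩
  by_contra! hc
  obtain ⟨C, hC, hnot⟩ := hc
  have hU : (A ∪ B).card = 4 := by
    have := Finset.card_union_add_card_inter A B
    rw [h2 A hA B hB hAB, h3 A hA, h3 B hB] at this
    omega
  have key : ∀ X ∈ S, X ⊆ A ∪ B ∨ (A ∩ B ⊆ X ∧ X ∩ (A ∪ B) = A ∩ B) := by
    intro X hX
    by_cases hXA : X = A
    · subst hXA; exact Or.inl Finset.subset_union_left
    by_cases hXB : X = B
    · subst hXB; exact Or.inl Finset.subset_union_right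
    by_cases hXU : X ⊆ A ∪ B
    · exact Or.inl hXU
    right
    have hlt : (X ∩ (A ∪ B)).card ≤ 2 := by
      have : (X ∩ (A ∪ B)).card < X.card := by
        refine Finset.card_lt_card ⟨Finset.inter_subset_left, fun h => hXU ?_⟩
        exact fun x hx => (Finset.mem_inter.1 (h hx)).2
      rw [h3 X hX] at this; omega
    have e1 : X ∩ A = X ∩ (A ∪ B) := Finset.eq_of_subset_of_card_le
      (Finset.inter_subset_inter_left Finset.subset_union_left)
      (by rw [h2 X hX A hA hXA]; exact hlt)
    have e2 : X ∩ B = X ∩ (A ∪ B) := Finset.eq_of_subset_of_card_le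
      (Finset.inter_subset_inter_left Finset.subset_union_right)
      (by rw [h2 X hX B hB hXB]; exact hlt)
    have e3 : X ∩ (A ∪ B) ⊆ A ∩ B := by
      intro x hx
      have h1 := hx; have h2' := hx
      rw [← e1] at h1; rw [← e2] at h2'
      exact Finset.mem_inter.2 ⟨(Finset.mem_inter.1 h1).2, (Finset.mem_inter.1 h2').2⟩
    have e4 : X ∩ (A ∪ B) = A ∩ B := Finset.eq_of_subset_of_card_le e3
      (by rw [h2 A hA B hB hAB, ← e1, h2 X hX A hA hXA])
    exact ⟨e4 ▸ Finset.inter_subset_left, e4⟩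
  have hCU : C ⊆ A ∪ B := (key C hC).resolve_right fun h => hnot h.1
  have hall : S ⊆ (A ∪ B).powersetCard 3 := by
    intro X hX
    rw [Finset.mem_powersetCard]
    refine ⟨?_, h3 X hX⟩
    by_contra hXU
    obtain ⟨h, h'⟩ := (key X hX).resolve_left hXU
    have hXC : X ≠ C := by rintro rfl; exact hXU hCU
    have e : X ∩ C = A ∩ B := Finset.eq_of_subset_of_card_le
      (h' ▸ Finset.inter_subset_inter_left hCU)
      (by rw [h2 A hA B hB hAB, h2 X hX C hC hXC])
    exact hnot (e ▸ Finset.inter_subset_right)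
  have := Finset.card_le_card hall
  rw [Finset.card_powersetCard, hU] at this
  have h4 : Nat.choose 4 3 = 4 := by decide
  omega

/-- Integral vectors with the Gram matrix of the generalized characters `c_ψ`. -/
lemma exists_common_coords {ι : Type*} [Fintype ι] [DecidableEq ι] (C : Finset (ι → ℤ)) (i₀ : ι)
    (h0 : ∀ c ∈ C, c i₀ = 1) (h4 : ∀ c ∈ C, ∑ i, c i * c i = 4)
    (h3 : ∀ c ∈ C, ∀ c' ∈ C, c ≠ c' → ∑ i, c i * c' i = 3) (h5 : 5 ≤ C.card) :
    ∃ i₂ i₃ : ι, ∃ e₂ e₃ : ℤ, i₂ ≠ i₀ ∧ i₃ ≠ i₀ ∧ i₂ ≠ i₃ ∧ e₂ * e₂ = 1 ∧ e₃ * e₃ = 1 ∧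
      ∀ c ∈ C, c i₂ = e₂ ∧ c i₃ = e₃ ∧ ∃ x, ∃ e : ℤ, x ≠ i₀ ∧ x ≠ i₂ ∧ x ≠ i₃ ∧
        e * e = 1 ∧ c x = e ∧
        (∀ i, i ≠ i₀ → i ≠ i₂ → i ≠ i₃ → i ≠ x → c i = 0) ∧
        ∀ c' ∈ C, c' ≠ c → c' x = 0 := by
  let R := Finset.univ.erase i₀
  have hsplit : ∀ f : ι → ℤ, ∑ i, f i = f i₀ + ∑ i ∈ R, f i := fun f =>
    (Finset.add_sum_erase _ f (Finset.mem_univ i₀)).symm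
  have hR : ∀ c ∈ C, ∑ i ∈ R, c i * c i = 3 := by
    intro c hc
    have := h4 c hc
    rw [hsplit, h0 c hc] at this
    linarith
  have hR2 : ∀ c ∈ C, ∀ c' ∈ C, c ≠ c' → ∑ i ∈ R, c i * c' i = 2 := by
    intro c hc c' hc' hne
    have := h3 c hc c' hc' hne
    rw [hsplit, h0 c hc, h0 c' hc'] at this
    linarith
  have hval : ∀ c ∈ C, ∀ i ∈ R, c i = 0 ∨ c i = 1 ∨ c i = -1 := by
    intro c hc i hi
    have h1 : c i * c i ≤ 3 := by
      rw [← hR c hc]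
      exact Finset.single_le_sum (f := fun i => c i * c i) (fun i _ => mul_self_nonneg _) hi
    have h2 : c i ≤ 1 := by nlinarith
    have h3 : -1 ≤ c i := by nlinarith
    omega
  let A : (ι → ℤ) → Finset (ι × ℤ) := fun c => (R.filter fun i => c i ≠ 0).image fun i => (i, c i)
  have hAmem : ∀ c p, p ∈ A c ↔ p.1 ≠ i₀ ∧ c p.1 ≠ 0 ∧ c p.1 = p.2 := by
    rintro c ⟨i, e⟩
    simp only [A, R, Finset.mem_image, Finset.mem_filter, Finset.mem_erase, Finset.mem_univ,
      and_true, Prod.mk.injEq]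
    constructor
    · rintro ⟨j, ⟨h1, h2⟩, rfl, h3⟩
      exact ⟨h1, h2, h3⟩
    · rintro ⟨h1, h2, h3⟩
      exact ⟨i, ⟨h1, h2⟩, rfl, h3⟩
  have hAcard : ∀ c ∈ C, (A c).card = 3 := by
    intro c hc
    rw [Finset.card_image_of_injective _ (fun a b h => (Prod.mk.inj h).1)]
    have : ((R.filter fun i => c i ≠ 0).card : ℤ) = 3 := by
      rw [Finset.card_filter, ← hR c hc]
      push_cast
      refine Finset.sum_congr rfl fun i hi => ?_
      rcases hval c hc i hi with h | h | h <;> simp [h]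
    exact_mod_cast this
  have hAinter : ∀ c ∈ C, ∀ c' ∈ C, c ≠ c' → (A c ∩ A c').card = 2 ∧
      ∀ i ∈ R, c i ≠ 0 → c' i ≠ 0 → c i = c' i := by
    intro c hc c' hc' hne
    have e1 : A c ∩ A c' = (R.filter fun i => c i ≠ 0 ∧ c i = c' i).image fun i => (i, c i) := by
      ext ⟨i, e⟩
      rw [Finset.mem_inter, hAmem, hAmem]
      simp only [R, Finset.mem_image, Finset.mem_filter, Finset.mem_erase, Finset.mem_univ,
        and_true, Prod.mk.injEq]
      constructor
      · rintro ⟨⟨h1, h2, h3⟩, ⟨h4, h5, h6⟩⟩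
        exact ⟨i, ⟨h1, h2, h3.trans h6.symm⟩, rfl, h3⟩
      · rintro ⟨j, ⟨h1, h2, h3⟩, rfl, h4⟩
        exact ⟨⟨h1, h2, h4⟩, h1, h3 ▸ h2, h3 ▸ h4⟩
    rw [e1, Finset.card_image_of_injective _ (fun a b h => (Prod.mk.inj h).1)]
    set p : ℕ := (R.filter fun i => c i ≠ 0 ∧ c i = c' i).card with hp
    set m : ℕ := (R.filter fun i => c i ≠ 0 ∧ c' i ≠ 0 ∧ c i ≠ c' i).card with hm
    have h1 : (p : ℤ) - m = 2 := by
      rw [← hR2 c hc c' hc' hne, hp, hm, Finset.card_filter, Finset.card_filter]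
      push_cast
      rw [← Finset.sum_sub_distrib]
      refine Finset.sum_congr rfl fun i hi => ?_
      rcases hval c hc i hi with h | h | h <;> rcases hval c' hc' i hi with h' | h' | h' <;>
        simp [h, h']
    have h2 : (p : ℤ) + m ≤ 3 := by
      rw [← hR c hc, hp, hm, Finset.card_filter, Finset.card_filter]
      push_cast
      rw [← Finset.sum_add_distrib]
      refine Finset.sum_le_sum fun i hi => ?_
      rcases hval c hc i hi with h | h | h <;> rcases hval c' hc' i hi with h' | h' | h' <;>
        simp [h, h']
    refine ⟨by omega, fun i hi h3 h4 => ?_⟩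
    have h5 : m = 0 := by omega
    rw [hm, Finset.card_eq_zero] at h5
    by_contra h6
    exact Finset.notMem_empty i (h5 ▸ Finset.mem_filter.2 ⟨hi, h3, h4, h6⟩)
  have hAinj : Set.InjOn A C := by
    intro c hc c' hc' h
    by_contra hne
    have := (hAinter c hc c' hc' hne).1
    rw [← h, Finset.inter_self, hAcard c hc] at this
    omega
  obtain ⟨Q, hQ, hQA⟩ := sunflower (C.image A)
    (by simpa using hAcard)
    (by
      intro X hX Y hY hXY
      obtain ⟨c, hc, rfl⟩ := Finset.mem_image.1 hX
      obtain ⟨c', hc', rfl⟩ := Finset.mem_image.1 hY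
      exact (hAinter c hc c' hc' (fun h => hXY (by rw [h]))).1)
    (by rwa [Finset.card_image_of_injOn hAinj])
  obtain ⟨⟨i₂, e₂⟩, ⟨i₃, e₃⟩, hne, rfl⟩ := Finset.card_eq_two.1 hQ
  have hin : ∀ c ∈ C, (i₂ ≠ i₀ ∧ c i₂ ≠ 0 ∧ c i₂ = e₂) ∧ (i₃ ≠ i₀ ∧ c i₃ ≠ 0 ∧ c i₃ = e₃) := by
    intro c hc
    have h := hQA _ (Finset.mem_image_of_mem A hc)
    exact ⟨(hAmem c (i₂, e₂)).1 (h (by simp)), (hAmem c (i₃, e₃)).1 (h (by simp))⟩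
  obtain ⟨c₁, hc₁⟩ : C.Nonempty := Finset.card_pos.1 (by omega)
  have hi₂ := (hin c₁ hc₁).1.1
  have hi₃ := (hin c₁ hc₁).2.1
  have hi₂₃ : i₂ ≠ i₃ := by
    rintro rfl
    apply hne
    rw [← (hin c₁ hc₁).1.2.2, ← (hin c₁ hc₁).2.2.2]
  have hsq : ∀ c ∈ C, ∀ i, i ≠ i₀ → c i ≠ 0 → c i * c i = 1 := by
    intro c hc i hi h
    rcases hval c hc i (by simpa [R] using hi) with h' | h' | h'
    · exact absurd h' h
    · rw [h']; rfl
    · rw [h']; rfl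
  refine ⟨i₂, i₃, e₂, e₃, hi₂, hi₃, hi₂₃, ?_, ?_, ?_⟩
  · rw [← (hin c₁ hc₁).1.2.2]; exact hsq c₁ hc₁ _ hi₂ (hin c₁ hc₁).1.2.1
  · rw [← (hin c₁ hc₁).2.2.2]; exact hsq c₁ hc₁ _ hi₃ (hin c₁ hc₁).2.2.1
  intro c hc
  refine ⟨(hin c hc).1.2.2, (hin c hc).2.2.2, ?_⟩
  have hsub : ({(i₂, e₂), (i₃, e₃)} : Finset (ι × ℤ)) ⊆ A c := hQA _ (Finset.mem_image_of_mem A hc)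
  have hd : (A c \ {(i₂, e₂), (i₃, e₃)}).card = 1 := by
    rw [Finset.card_sdiff_of_subset hsub, hAcard c hc, hQ]
  obtain ⟨⟨x, e⟩, hxe⟩ := Finset.card_eq_one.1 hd
  have hx : (x, e) ∈ A c \ {(i₂, e₂), (i₃, e₃)} := by rw [hxe]; simp
  rw [Finset.mem_sdiff, hAmem] at hx
  obtain ⟨⟨hx0, hcx, hce⟩, hxn⟩ := hx
  dsimp only at hx0 hcx hce
  have hx2 : x ≠ i₂ := by
    rintro rfl; apply hxn; rw [← hce, (hin c hc).1.2.2]; simp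
  have hx3 : x ≠ i₃ := by
    rintro rfl; apply hxn; rw [← hce, (hin c hc).2.2.2]; simp
  refine ⟨x, e, hx0, hx2, hx3, hce ▸ hsq c hc x hx0 hcx, hce, ?_, ?_⟩
  · intro i h0 h2 h3 hix
    by_contra hci
    have : (i, c i) ∈ A c \ {(i₂, e₂), (i₃, e₃)} := by
      rw [Finset.mem_sdiff, hAmem]
      exact ⟨⟨h0, hci, rfl⟩, by simp [h2, h3]⟩
    rw [hxe, Finset.mem_singleton] at this
    exact hix (Prod.mk.inj this).1
  · intro c' hc' hcc
    by_contra hx'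
    have hI := hAinter c hc c' hc' hcc.symm
    have hex : c x = c' x := hI.2 x (by simpa [R] using hx0) hcx hx'
    have hsub3 : A c ⊆ A c' := by
      intro p hp
      by_cases hpq : p ∈ ({(i₂, e₂), (i₃, e₃)} : Finset (ι × ℤ))
      · exact hQA _ (Finset.mem_image_of_mem A hc') hpq
      · have : p ∈ A c \ {(i₂, e₂), (i₃, e₃)} := Finset.mem_sdiff.2 ⟨hp, hpq⟩
        rw [hxe, Finset.mem_singleton] at this
        rw [this, hAmem]
        exact ⟨hx0, hx', hex ▸ hce⟩
    have := hI.1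
    rw [Finset.inter_eq_left.2 hsub3, hAcard c hc] at this
    omega

end Sunflower

section Torus

variable {G : Type*} [Group G] [Fintype G] {n : ℕ} [NeZero n] {τ : G} (hτ : orderOf τ = n)

/-- The parametrization of the cyclic group generated by `τ` by integers modulo `n`. -/
def tor (hτ : orderOf τ = n) : Multiplicative (ZMod n) →* G :=
  zmodHom n τ (hτ ▸ pow_orderOf_eq_one τ)

open Multiplicative (ofAdd)

lemma tor_natCast (k : ℕ) : tor hτ (ofAdd (k : ZMod n)) = τ ^ k := zmodHom_natCast _ k

lemma tor_one : tor hτ (ofAdd (1 : ZMod n)) = τ := by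
  simpa using tor_natCast hτ 1

lemma tor_val (a : ZMod n) : tor hτ (ofAdd a) = τ ^ a.val := by
  rw [← tor_natCast hτ, ZMod.natCast_zmod_val]

lemma tor_zero : tor hτ (ofAdd (0 : ZMod n)) = 1 := by simp

lemma tor_injective : Function.Injective (tor hτ) := by
  rw [injective_iff_map_eq_one]
  intro a ha
  have h := tor_val hτ (Multiplicative.toAdd a)
  rw [ofAdd_toAdd, ha] at h
  have h2 := orderOf_dvd_of_pow_eq_one h.symm
  rw [hτ] at h2
  have h3 := Nat.eq_zero_of_dvd_of_lt h2 (ZMod.val_lt _)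
  exact (ZMod.val_eq_zero _).1 h3

lemma mem_zpowers_iff_tor (g : G) : g ∈ Subgroup.zpowers τ ↔
    ∃ a : ZMod n, tor hτ (ofAdd a) = g := by
  constructor
  · intro h
    obtain ⟨k, rfl⟩ := (mem_powers_iff_mem_zpowers).2 h
    exact ⟨k, tor_natCast hτ k⟩
  · rintro ⟨a, rfl⟩
    rw [tor_val]
    exact Subgroup.pow_mem _ (Subgroup.mem_zpowers τ) _

lemma conj_tor {g : G} {u : ZMod n} (h : g * τ * g⁻¹ = tor hτ (ofAdd u)) (b : ZMod n) :
    g * tor hτ (ofAdd b) * g⁻¹ = tor hτ (ofAdd (u * b)) := by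
  rw [tor_val hτ b, ← conj_pow, h, ← map_pow, ← ofAdd_nsmul, nsmul_eq_mul, ZMod.natCast_zmod_val,
    mul_comm]

lemma mem_of_commute_tor (hc : ∀ a : ℕ, ¬ n ∣ a → ∀ g, Commute g (τ ^ a) → g ∈ Subgroup.zpowers τ)
    {b : ZMod n} (hb : b ≠ 0) {g : G} (h : Commute g (tor hτ (ofAdd b))) :
    g ∈ Subgroup.zpowers τ := by
  refine hc b.val (fun h1 => hb ?_) g (by rwa [← tor_val hτ b])
  exact (ZMod.val_eq_zero _).1 (Nat.eq_zero_of_dvd_of_lt h1 (ZMod.val_lt _))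

open Classical in
/-- The multipliers `u` such that `τ` is conjugate to `τ ^ u`. -/
noncomputable def torW (hτ : orderOf τ = n) : Finset (ZMod n) :=
  {u | ∃ g : G, g * τ * g⁻¹ = tor hτ (ofAdd u)}

lemma mem_torW {u : ZMod n} : u ∈ torW hτ ↔ ∃ g : G, g * τ * g⁻¹ = tor hτ (ofAdd u) := by
  simp [torW]

lemma one_mem_torW : (1 : ZMod n) ∈ torW hτ := (mem_torW hτ).2 ⟨1, by simp [tor_one]⟩

lemma torW_cancel (hc : ∀ a : ℕ, ¬ n ∣ a → ∀ g, Commute g (τ ^ a) → g ∈ Subgroup.zpowers τ)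
    {u v b : ZMod n} (hu : u ∈ torW hτ) (hv : v ∈ torW hτ) (hb : b ≠ 0) (h : u * b = v * b) :
    u = v := by
  obtain ⟨g, hg⟩ := (mem_torW hτ).1 hu
  obtain ⟨k, hk⟩ := (mem_torW hτ).1 hv
  have h1 := conj_tor hτ hg b
  rw [h, ← conj_tor hτ hk b] at h1
  have h2 : Commute (k⁻¹ * g) (tor hτ (ofAdd b)) := by
    rw [Commute, SemiconjBy]
    have h3 := congrArg (fun y => k⁻¹ * y * g) h1
    simpa [mul_assoc] using h3
  have h3 := mem_of_commute_tor hτ hc hb h2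
  obtain ⟨m, hm⟩ := h3
  have h4 : g * τ * g⁻¹ = k * τ * k⁻¹ := by
    have h5 : g = k * τ ^ m := by rw [show τ ^ m = k⁻¹ * g from hm]; simp
    rw [h5, mul_inv_rev]
    simp only [mul_assoc]
    rw [← mul_assoc τ, ((Commute.refl τ).zpow_right m).inv_right.eq]
    simp [← mul_assoc]
  rw [hg, hk] at h4
  exact Multiplicative.ofAdd.injective (tor_injective hτ h4)

lemma torW_ne_zero {u : ZMod n} (hu : u ∈ torW hτ) {b : ZMod n}
    (h : u * b = 0) : b = 0 := by
  obtain ⟨g, hg⟩ := (mem_torW hτ).1 hu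
  have h1 := conj_tor hτ hg b
  rw [h, tor_zero, conj_eq_one_iff] at h1
  exact ofAdd_eq_one.1 ((injective_iff_map_eq_one _).1 (tor_injective hτ) _ h1)

lemma card_conj_fiber
    (hc : ∀ a : ℕ, ¬ n ∣ a → ∀ g, Commute g (τ ^ a) → g ∈ Subgroup.zpowers τ) (hn : 1 < n)
    {u : ZMod n} (hu : u ∈ torW hτ) :
    Nat.card {g : G // g * τ * g⁻¹ = tor hτ (ofAdd u)} = n := by
  obtain ⟨k, hk⟩ := (mem_torW hτ).1 hu
  refine Eq.trans ?_ ((Nat.card_zpowers τ).trans hτ)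
  refine Nat.card_congr
    { toFun := fun g => ⟨k⁻¹ * g.1, ?_⟩
      invFun := fun x => ⟨k * x.1, ?_⟩
      left_inv := fun g => by simp
      right_inv := fun x => by simp }
  · refine hc 1 (by simpa using hn.ne') _ ?_
    have h := g.2.trans hk.symm
    rw [pow_one, Commute, SemiconjBy]
    have h2 := congrArg (fun y => k⁻¹ * y * g.1) h
    simpa [mul_assoc] using h2
  · obtain ⟨x, m, rfl⟩ := x
    rw [← hk]
    change k * τ ^ m * τ * (k * τ ^ m)⁻¹ = _
    simp only [mul_inv_rev, mul_assoc]
    rw [← mul_assoc τ, ((Commute.refl τ).zpow_right m).inv_right.eq]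
    simp [← mul_assoc]

lemma card_solutions
    (hc : ∀ a : ℕ, ¬ n ∣ a → ∀ g, Commute g (τ ^ a) → g ∈ Subgroup.zpowers τ) (hn : 1 < n)
    (a : ZMod n) {b : ZMod n} (hb : b ≠ 0) :
    Nat.card {g : G // tor hτ (ofAdd a) * g * tor hτ (ofAdd b) = g} =
      n * ((torW hτ).filter fun u => u * b = -a).card := by
  classical
  have hmem : ∀ g : G, tor hτ (ofAdd a) * g * tor hτ (ofAdd b) = g ↔
      g * tor hτ (ofAdd b) * g⁻¹ = tor hτ (ofAdd (-a)) := by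
    intro g
    rw [ofAdd_neg, map_inv, mul_assoc, ← eq_inv_mul_iff_mul_eq, mul_inv_eq_iff_eq_mul]
  have e : {g : G // tor hτ (ofAdd a) * g * tor hτ (ofAdd b) = g} ≃
      Σ u : {u // u ∈ (torW hτ).filter fun u => u * b = -a},
        {g : G // g * τ * g⁻¹ = tor hτ (ofAdd u.1)} := by
    refine Equiv.symm (Equiv.ofBijective (fun x => ⟨x.2.1, ?_⟩) ⟨?_, ?_⟩)
    · rw [hmem, conj_tor hτ x.2.2, (Finset.mem_filter.1 x.1.2).2]
    · rintro ⟨⟨u, hu⟩, g, hg⟩ ⟨⟨v, hv⟩, g', hg'⟩ h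
      have h1 : g = g' := congrArg Subtype.val h
      subst h1
      have : u = v := Multiplicative.ofAdd.injective (tor_injective hτ (hg.symm.trans hg'))
      subst this
      rfl
    · rintro ⟨g, hg⟩
      rw [hmem] at hg
      have ha : -a ≠ 0 := by
        intro h
        rw [h, tor_zero, conj_eq_one_iff] at hg
        exact hb (ofAdd_eq_one.1 ((injective_iff_map_eq_one _).1 (tor_injective hτ) _ hg))
      have h1 : Commute (g * τ * g⁻¹) (tor hτ (ofAdd (-a))) := by
        rw [← hg, tor_val hτ b]
        exact ((Commute.refl τ).pow_right _).map (MulAut.conj g)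
      obtain ⟨u, hu⟩ := (mem_zpowers_iff_tor hτ _).1 (mem_of_commute_tor hτ hc ha h1)
      have h2 := conj_tor hτ hu.symm b
      rw [hg] at h2
      refine ⟨⟨⟨u, Finset.mem_filter.2 ⟨(mem_torW hτ).2 ⟨g, hu.symm⟩, ?_⟩⟩, ⟨g, hu.symm⟩⟩, rfl⟩
      exact (Multiplicative.ofAdd.injective (tor_injective hτ h2)).symm
  rw [Nat.card_congr e, Nat.card_sigma]
  rw [Finset.sum_congr rfl fun u _ =>
    card_conj_fiber hτ hc hn (Finset.mem_filter.1 u.2).1]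
  simp [mul_comm]

lemma card_torW
    (hc : ∀ a : ℕ, ¬ n ∣ a → ∀ g, Commute g (τ ^ a) → g ∈ Subgroup.zpowers τ) (hn : 1 < n) :
    Nat.card (Subgroup.normalizer (Subgroup.zpowers τ : Set G)) = n * (torW hτ).card := by
  classical
  have e : (Subgroup.normalizer (Subgroup.zpowers τ : Set G)) ≃
      Σ u : {u // u ∈ torW hτ}, {g : G // g * τ * g⁻¹ = tor hτ (ofAdd u.1)} := by
    refine Equiv.symm (Equiv.ofBijective (fun x => ⟨x.2.1, ?_⟩) ⟨?_, ?_⟩)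
    · rw [Subgroup.mem_normalizer_iff_map_conj_eq]
      apply Subgroup.eq_of_le_of_card_ge
      · rw [MonoidHom.map_zpowers, Subgroup.zpowers_le, mem_zpowers_iff_tor hτ]
        exact ⟨_, x.2.2.symm⟩
      · rw [Subgroup.card_map_of_injective]
        exact (MulAut.conj x.2.1).injective
    · rintro ⟨⟨u, hu⟩, g, hg⟩ ⟨⟨v, hv⟩, g', hg'⟩ h
      have h1 : g = g' := congrArg Subtype.val h
      subst h1
      have : u = v := Multiplicative.ofAdd.injective (tor_injective hτ (hg.symm.trans hg'))
      subst this
      rfl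
    · rintro ⟨g, hg⟩
      have h1 : g * τ * g⁻¹ ∈ Subgroup.zpowers τ :=
        (Subgroup.mem_normalizer_iff.1 hg τ).1 (Subgroup.mem_zpowers τ)
      obtain ⟨u, hu⟩ := (mem_zpowers_iff_tor hτ _).1 h1
      exact ⟨⟨⟨u, (mem_torW hτ).2 ⟨g, hu.symm⟩⟩, ⟨g, hu.symm⟩⟩, rfl⟩
  rw [Nat.card_congr e, Nat.card_sigma]
  rw [Finset.sum_congr rfl fun u _ => card_conj_fiber hτ hc hn u.2]
  simp [mul_comm]

end Torus

section Gram

open Multiplicative (ofAdd)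

variable {G : Type*} [Group G] [Fintype G] {n : ℕ} [NeZero n] {τ : G} (hτ : orderOf τ = n)
  (D : IrrData G)

/-- Multiplicities of the characters of the cyclic group generated by `τ`. -/
noncomputable def IrrData.mt (hτ : orderOf τ = n) (ψ : AddChar (ZMod n) ℂ) (i : Fin D.n) : ℕ :=
  D.m (tor hτ) ψ.toMonoidHom i

lemma IrrData.sum_mt_mul_mt
    (hc : ∀ a : ℕ, ¬ n ∣ a → ∀ g, Commute g (τ ^ a) → g ∈ Subgroup.zpowers τ) (hn : 1 < n)
    [DecidableEq (AddChar (ZMod n) ℂ)] (ψ φ : AddChar (ZMod n) ℂ) :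
    (∑ i, D.mt hτ ψ i * D.mt hτ φ i : ℂ) =
      (n : ℂ)⁻¹ ^ 2 * ((Fintype.card G : ℂ) - n * (torW hτ).card) +
        ((torW hτ).filter fun u => ψ.mulShift u = φ).card := by
  classical
  have hn0 : (n : ℂ) ≠ 0 := by exact_mod_cast NeZero.ne n
  have hcount : ∀ a b : ZMod n,
      (Nat.card {g : G // tor hτ (ofAdd a) * g * tor hτ (ofAdd b) = g} : ℂ) =
        n * ∑ u ∈ torW hτ, (if a = -(u * b) then 1 else 0) +
          (if b = 0 then (if a = 0 then ((Fintype.card G : ℂ) - n *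
            (torW hτ).card) else 0) else 0) := by
    intro a b
    by_cases hb : b = 0
    · subst hb
      by_cases ha : a = 0
      · subst ha
        have : Nat.card {g : G // tor hτ (ofAdd (0 : ZMod n)) * g * tor hτ
          (ofAdd (0 : ZMod n)) = g} =
            Fintype.card G := by
          rw [Nat.card_eq_fintype_card]
          exact Fintype.card_congr (Equiv.subtypeUnivEquiv (by simp))
        rw [this]
        simp
      · have : IsEmpty {g : G // tor hτ (ofAdd a) * g * tor hτ (ofAdd (0 : ZMod n)) = g} := by
          refine ⟨fun ⟨g, this⟩ => ha ?_⟩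
          rw [tor_zero, mul_one, mul_eq_right] at this
          exact ofAdd_eq_one.1 ((injective_iff_map_eq_one _).1 (tor_injective hτ) _ this)
        rw [Nat.card_of_isEmpty]
        simp [ha]
    · rw [card_solutions hτ hc hn a hb]
      simp only [hb, if_false, add_zero, Finset.card_filter]
      push_cast
      congr 1
      refine Finset.sum_congr rfl fun u _ => ?_
      congr 1
      rw [eq_iff_iff]
      constructor
      · rintro h; rw [h, neg_neg]
      · rintro h; rw [h, neg_neg]
  have h := D.sum_m_mul_m (tor hτ) ψ.toMonoidHom φ.toMonoidHom
  change (∑ i, D.mt hτ ψ i * D.mt hτ φ i : ℂ) = _ at h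
  rw [h]
  have h2 : ∑ a, ∑ b, ψ.toMonoidHom a⁻¹ * φ.toMonoidHom b⁻¹ *
      (Nat.card {g // tor hτ a * g * tor hτ b = g} : ℂ) =
      ∑ b : ZMod n, ∑ a : ZMod n, ψ (-a) * φ (-b) *
        (n * ∑ u ∈ torW hτ, (if a = -(u * b) then 1 else 0) +
          (if b = 0 then (if a = 0 then ((Fintype.card G : ℂ) - n *
            (torW hτ).card) else 0) else 0)) := by
    rw [Finset.sum_comm]
    refine Fintype.sum_equiv Multiplicative.toAdd _ _ fun b => ?_
    refine Fintype.sum_equiv Multiplicative.toAdd _ _ fun a => ?_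
    rw [← hcount]
    rfl
  rw [h2, Fintype.card_multiplicative, ZMod.card]
  have h3 : ∀ u : ZMod n, ∑ b : ZMod n, ψ (u * b) * φ (-b) =
      if ψ.mulShift u = φ then (n : ℂ) else 0 := by
    intro u
    have h4 : ∀ b, ψ (u * b) * φ (-b) = (ψ.mulShift u - φ) b := by
      intro b
      rw [AddChar.sub_apply', AddChar.mulShift_apply, AddChar.map_neg_eq_inv, div_eq_mul_inv]
    simp only [h4]
    rw [AddChar.sum_eq_ite]
    simp [sub_eq_zero]
  simp only [mul_add, Finset.sum_add_distrib]
  have h5 : ∑ b : ZMod n, ∑ a : ZMod n,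
      ψ (-a) * φ (-b) * (n * ∑ u ∈ torW hτ, if a = -(u * b) then (1 : ℂ) else 0) =
      (n : ℂ) ^ 2 * ((torW hτ).filter fun u => ψ.mulShift u = φ).card := by
    have h6 : ∀ b : ZMod n, ∑ a : ZMod n,
      ψ (-a) * φ (-b) * (n * ∑ u ∈ torW hτ, if a = -(u * b) then (1 : ℂ) else 0) =
        ∑ u ∈ torW hτ, n * (ψ (u * b) * φ (-b)) := by
      intro b
      simp only [Finset.mul_sum]
      rw [Finset.sum_comm]
      refine Finset.sum_congr rfl fun u _ => ?_
      simp [mul_comm]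
    simp only [h6]
    rw [Finset.sum_comm]
    simp only [← Finset.mul_sum, h3, Finset.sum_ite, Finset.sum_const_zero, add_zero,
      Finset.sum_const, nsmul_eq_mul]
    ring
  rw [h5]
  have h7 : ∑ b : ZMod n, ∑ a : ZMod n, ψ (-a) * φ (-b) *
      (if b = 0 then (if a = 0 then ((Fintype.card G : ℂ) - n * (torW hτ).card) else 0) else 0) =
      (Fintype.card G : ℂ) - n * (torW hτ).card := by
    simp
  rw [h7]
  field_simp
  ring

lemma mulShift_ne_zero {u : ZMod n} (hu : u ∈ torW hτ)
    {ψ : AddChar (ZMod n) ℂ} (hψ : ψ ≠ 0) : ψ.mulShift u ≠ 0 := by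
  intro h
  apply hψ
  have h1 : Function.Injective fun b : ZMod n => u * b := by
    intro b b' hb
    have : u * (b - b') = 0 := by rw [mul_sub]; exact sub_eq_zero.2 hb
    exact sub_eq_zero.1 (torW_ne_zero hτ hu this)
  ext x
  obtain ⟨b, rfl⟩ := (Finite.injective_iff_surjective.1 h1) x
  rw [← AddChar.mulShift_apply, h]
  rfl

lemma mulShift_inj
    (hc : ∀ a : ℕ, ¬ n ∣ a → ∀ g, Commute g (τ ^ a) → g ∈ Subgroup.zpowers τ)
    {u v : ZMod n} (hu : u ∈ torW hτ) (hv : v ∈ torW hτ)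
    {ψ : AddChar (ZMod n) ℂ} (hψ : ψ ≠ 0) (h : ψ.mulShift u = ψ.mulShift v) : u = v := by
  by_contra hne
  apply hψ
  have h1 : Function.Injective fun b : ZMod n => (u - v) * b := by
    intro b b' hb
    by_contra hbb
    refine hne (torW_cancel hτ hc hu hv (sub_ne_zero.2 hbb) ?_)
    have : (u - v) * b = (u - v) * b' := hb
    linear_combination this
  ext x
  obtain ⟨b, rfl⟩ := (Finite.injective_iff_surjective.1 h1) x
  have h2 := DFunLike.congr_fun h b
  rw [AddChar.mulShift_apply, AddChar.mulShift_apply] at h2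
  change ψ ((u - v) * b) = 1
  rw [sub_mul, AddChar.map_sub_eq_div, h2, div_self ((ψ.val_isUnit _).ne_zero)]

end Gram

section TorusVectors

open Multiplicative (ofAdd)

variable {G : Type*} [Group G] [Fintype G] {n : ℕ} [NeZero n] {τ : G} (hτ : orderOf τ = n)
  (D : IrrData G)

/-- The generalized character multiplicities `m(1) - m(ψ)`. -/
noncomputable def IrrData.cvec (hτ : orderOf τ = n) (ψ : AddChar (ZMod n) ℂ) (i : Fin D.n) : ℤ :=
  D.mt hτ 0 i - D.mt hτ ψ i

lemma IrrData.cvec_gram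
    (hc : ∀ a : ℕ, ¬ n ∣ a → ∀ g, Commute g (τ ^ a) → g ∈ Subgroup.zpowers τ) (hn : 1 < n)
    [DecidableEq (AddChar (ZMod n) ℂ)] {ψ φ : AddChar (ZMod n) ℂ} (hψ : ψ ≠ 0) (hφ : φ ≠ 0) :
    ∑ i, D.cvec hτ ψ i * D.cvec hτ φ i =
      (torW hτ).card + ((torW hτ).filter fun u => ψ.mulShift u = φ).card := by
  have h00 := D.sum_mt_mul_mt hτ hc hn 0 0
  have h0φ := D.sum_mt_mul_mt hτ hc hn 0 φ
  have hψ0 := D.sum_mt_mul_mt hτ hc hn ψ 0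
  have hψφ := D.sum_mt_mul_mt hτ hc hn ψ φ
  have hz : ∀ u : ZMod n, (0 : AddChar (ZMod n) ℂ).mulShift u = 0 := fun u => by ext x; simp
  have e0 : ((torW hτ).filter fun u => (0 : AddChar (ZMod n) ℂ).mulShift u = 0) = torW hτ :=
    Finset.filter_true_of_mem fun u _ => hz u
  have e1 : ((torW hτ).filter fun u => (0 : AddChar (ZMod n) ℂ).mulShift u = φ) = ∅ :=
    Finset.filter_false_of_mem fun u _ => by rw [hz]; exact hφ.symm
  have e2 : ((torW hτ).filter fun u => ψ.mulShift u = 0) = ∅ :=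
    Finset.filter_false_of_mem fun u hu => mulShift_ne_zero hτ hu hψ
  rw [e0] at h00
  rw [e1] at h0φ
  rw [e2] at hψ0
  have h : ((∑ i, D.cvec hτ ψ i * D.cvec hτ φ i : ℤ) : ℂ) =
      ((torW hτ).card + ((torW hτ).filter fun u => ψ.mulShift u = φ).card : ℕ) := by
    have e : ∀ i, ((D.cvec hτ ψ i * D.cvec hτ φ i : ℤ) : ℂ) =
      (D.mt hτ 0 i * D.mt hτ 0 i : ℂ) - D.mt hτ 0 i * D.mt hτ φ i - D.mt hτ ψ i * D.mt hτ 0 i +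
        D.mt hτ ψ i * D.mt hτ φ i := by
      intro i
      simp only [IrrData.cvec]
      push_cast
      ring
    rw [Int.cast_sum]
    simp only [e, Finset.sum_add_distrib, Finset.sum_sub_distrib]
    rw [h00, h0φ, hψ0, hψφ]
    push_cast
    simp
    ring
  exact_mod_cast h

lemma IrrData.cvec_eq_iff
    (hc : ∀ a : ℕ, ¬ n ∣ a → ∀ g, Commute g (τ ^ a) → g ∈ Subgroup.zpowers τ) (hn : 1 < n)
    {ψ φ : AddChar (ZMod n) ℂ} (hψ : ψ ≠ 0) (hφ : φ ≠ 0) :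
    (D.cvec hτ ψ = D.cvec hτ φ ↔ ∃ u ∈ torW hτ, ψ.mulShift u = φ) ∧
    ∑ i, D.cvec hτ ψ i * D.cvec hτ ψ i = (torW hτ).card + 1 ∧
    (D.cvec hτ ψ ≠ D.cvec hτ φ → ∑ i, D.cvec hτ ψ i * D.cvec hτ φ i = (torW hτ).card) := by
  classical
  have hone : ∀ {ψ φ : AddChar (ZMod n) ℂ}, ψ ≠ 0 → (∃ u ∈ torW hτ, ψ.mulShift u = φ) →
      ((torW hτ).filter fun u => ψ.mulShift u = φ).card = 1 := by
    rintro ψ φ hψ ⟨u, hu, hu2⟩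
    rw [Finset.card_eq_one]
    refine ⟨u, Finset.eq_singleton_iff_unique_mem.2 ⟨Finset.mem_filter.2 ⟨hu, hu2⟩, fun v hv => ?_⟩⟩
    rw [Finset.mem_filter] at hv
    exact mulShift_inj hτ hc hv.1 hu hψ (hv.2.trans hu2.symm)
  have hself : ∀ {ψ : AddChar (ZMod n) ℂ}, ψ ≠ 0 →
      ∑ i, D.cvec hτ ψ i * D.cvec hτ ψ i = (torW hτ).card + 1 := by
    intro ψ hψ
    rw [D.cvec_gram hτ hc hn hψ hψ, hone hψ ⟨1, one_mem_torW hτ, by ext; simp⟩]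
    rfl
  have hnot : ¬ (∃ u ∈ torW hτ, ψ.mulShift u = φ) →
      ∑ i, D.cvec hτ ψ i * D.cvec hτ φ i = (torW hτ).card := by
    intro h
    push Not at h
    rw [D.cvec_gram hτ hc hn hψ hφ, Finset.filter_false_of_mem h]
    simp
  have hiff : D.cvec hτ ψ = D.cvec hτ φ ↔ ∃ u ∈ torW hτ, ψ.mulShift u = φ := by
    constructor
    · intro h
      by_contra hno
      have h1 := hnot hno
      rw [← h, hself hψ] at h1
      omega
    · intro h
      have h1 := D.cvec_gram hτ hc hn hψ hφ
      rw [hone hψ h] at h1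
      have h2 : ∑ i, (D.cvec hτ ψ i - D.cvec hτ φ i) * (D.cvec hτ ψ i - D.cvec hτ φ i) = 0 := by
        have e : ∀ i, (D.cvec hτ ψ i - D.cvec hτ φ i) * (D.cvec hτ ψ i - D.cvec hτ φ i) =
          D.cvec hτ ψ i * D.cvec hτ ψ i + D.cvec hτ φ i * D.cvec hτ φ i -
            2 * (D.cvec hτ ψ i * D.cvec hτ φ i) := fun i => by ring
        simp only [e, Finset.sum_sub_distrib, Finset.sum_add_distrib, ← Finset.mul_sum]
        rw [hself hψ, hself hφ, h1]
        push_cast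
        ring
      rw [Finset.sum_eq_zero_iff_of_nonneg fun i _ => mul_self_nonneg _] at h2
      funext i
      exact sub_eq_zero.1 (mul_self_eq_zero.1 (h2 i (Finset.mem_univ i)))
  exact ⟨hiff, hself hψ, fun h => hnot fun h' => h (hiff.2 h')⟩

lemma IrrData.sum_χ_mul_mt (ψ : AddChar (ZMod n) ℂ) {g : G}
    (hg : g = 1 ∨ ∀ h, h * g * h⁻¹ ∉ Subgroup.zpowers τ) :
    ∑ i, D.χ i g * D.mt hτ ψ i = (n : ℂ)⁻¹ * Nat.card {h // g * h = h} := by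
  classical
  have h1 : ∀ i, D.χ i g * D.mt hτ ψ i = (n : ℂ)⁻¹ * ∑ a : ZMod n, ψ (-a) *
      (D.χ i g * D.χ i (tor hτ (ofAdd a))) := by
    intro i
    rw [IrrData.mt, D.m_eq, mul_left_comm, Finset.mul_sum, Fintype.card_multiplicative, ZMod.card]
    congr 1
    refine Fintype.sum_equiv Multiplicative.toAdd _ _ fun a => ?_
    rw [mul_left_comm]
    rfl
  simp only [h1]
  rw [← Finset.mul_sum, Finset.sum_comm]
  simp only [← Finset.mul_sum, D.orth']
  congr 1
  rw [Finset.sum_eq_single 0]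
  · simp
  · intro a _ ha
    have : IsEmpty {h // g * h * tor hτ (ofAdd a) = h} := by
      refine ⟨fun ⟨h, hh⟩ => ?_⟩
      have h2 : h⁻¹ * g * h = tor hτ (ofAdd (-a)) := by
        rw [ofAdd_neg, map_inv, eq_inv_iff_mul_eq_one]
        calc h⁻¹ * g * h * tor hτ (ofAdd a) = h⁻¹ * (g * h * tor hτ (ofAdd a)) := by
              simp only [mul_assoc]
          _ = 1 := by rw [hh, inv_mul_cancel]
      rcases hg with rfl | hg
      · rw [mul_one, inv_mul_cancel] at h2
        have := (injective_iff_map_eq_one _).1 (tor_injective hτ) _ h2.symm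
        exact ha (neg_eq_zero.1 (ofAdd_eq_one.1 this))
      · apply hg h⁻¹
        rw [inv_inv, h2, mem_zpowers_iff_tor hτ]
        exact ⟨_, rfl⟩
    rw [Nat.card_of_isEmpty]
    simp
  · simp

theorem IrrData.exists_torus_vectors
    (hc : ∀ a : ℕ, ¬ n ∣ a → ∀ g, Commute g (τ ^ a) → g ∈ Subgroup.zpowers τ) (hn : 1 < n) :
    ∃ C : Finset (Fin D.n → ℤ), C.card * (torW hτ).card + 1 = n ∧
      (∀ c ∈ C, ∑ i, c i * c i = (torW hτ).card + 1) ∧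
      (∀ c ∈ C, ∀ c' ∈ C, c ≠ c' → ∑ i, c i * c' i = (torW hτ).card) ∧
      (∀ i, (D.d i : ℤ) = n * D.mt hτ 0 i - (torW hτ).card * ∑ c ∈ C, c i) ∧
      (∀ c ∈ C, ∀ g, (g = 1 ∨ ∀ h, h * g * h⁻¹ ∉ Subgroup.zpowers τ) → ∑ i, D.χ i g * c i = 0) ∧
      (∀ i, D.d i = 1 → (∀ g, D.ρ i g = 1) → ∀ c ∈ C, c i = 1) ∧
      (∀ i, (∀ c ∈ C, c i = 0) → ∀ g ∈ Subgroup.zpowers τ, g ≠ 1 → D.χ i g = 0) := by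
  classical
  let S : Finset (AddChar (ZMod n) ℂ) := Finset.univ.erase 0
  have hS : ∀ ψ, ψ ∈ S ↔ ψ ≠ 0 := by simp [S]
  have hfib : ∀ c ∈ S.image (D.cvec hτ), (S.filter fun ψ => D.cvec hτ ψ = c).card =
    (torW hτ).card := by
    intro c hc'
    obtain ⟨ψ, hψ, rfl⟩ := Finset.mem_image.1 hc'
    rw [hS] at hψ
    have : (S.filter fun φ => D.cvec hτ φ = D.cvec hτ ψ) =
      (torW hτ).image fun u => ψ.mulShift u := by
      ext φ
      rw [Finset.mem_filter, Finset.mem_image, hS]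
      constructor
      · rintro ⟨h1, h2⟩
        exact (D.cvec_eq_iff hτ hc hn hψ h1).1.1 h2.symm
      · rintro ⟨u, hu, rfl⟩
        have h1 := mulShift_ne_zero hτ hu hψ
        exact ⟨h1, ((D.cvec_eq_iff hτ hc hn hψ h1).1.2 ⟨u, hu, rfl⟩).symm⟩
    rw [this, Finset.card_image_of_injOn]
    intro u hu v hv h
    exact mulShift_inj hτ hc hu hv hψ h
  refine ⟨S.image (D.cvec hτ), ?_, ?_, ?_, ?_, ?_, ?_, ?_⟩
  · have h := Finset.card_eq_sum_card_image (D.cvec hτ) S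
    rw [Finset.sum_congr rfl hfib, Finset.sum_const, smul_eq_mul] at h
    rw [← h, Finset.card_erase_of_mem (Finset.mem_univ _), Finset.card_univ,
      AddChar.card_eq, ZMod.card]
    omega
  · intro c hc'
    obtain ⟨ψ, hψ, rfl⟩ := Finset.mem_image.1 hc'
    rw [hS] at hψ
    exact (D.cvec_eq_iff hτ hc hn hψ hψ).2.1
  · intro c hc' c' hc'' hne
    obtain ⟨ψ, hψ, rfl⟩ := Finset.mem_image.1 hc'
    obtain ⟨φ, hφ, rfl⟩ := Finset.mem_image.1 hc''
    rw [hS] at hψ hφ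
    exact (D.cvec_eq_iff hτ hc hn hψ hφ).2.2 hne
  · intro i
    have h1 : ((torW hτ).card : ℤ) * ∑ c ∈ S.image (D.cvec hτ), c i = ∑ ψ ∈ S, D.cvec hτ ψ i := by
      rw [← Finset.sum_fiberwise_of_maps_to (g := D.cvec hτ) (t := S.image (D.cvec hτ))
        (fun ψ hψ => Finset.mem_image_of_mem _ hψ), Finset.mul_sum]
      refine Finset.sum_congr rfl fun c hc' => ?_
      rw [Finset.sum_congr rfl fun ψ hψ => congrFun (Finset.mem_filter.1 hψ).2 i, Finset.sum_const,
        hfib c hc', nsmul_eq_mul]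
    have h2 : ∑ ψ ∈ S, D.cvec hτ ψ i = ∑ ψ, D.cvec hτ ψ i := by
      refine Finset.sum_subset (Finset.subset_univ _) fun ψ _ hψ => ?_
      rw [hS, not_not] at hψ
      simp [IrrData.cvec, hψ]
    have h3 : (D.d i : ℤ) = ∑ ψ, (D.mt hτ ψ i : ℤ) := by
      have := trace_eq_sum_mult ((D.ρ i).comp (tor hτ)) 0
      simp only [ofAdd_zero, map_one, Matrix.trace_one, Fintype.card_fin, AddChar.map_zero_eq_one,
        mul_one] at this
      exact_mod_cast this
    rw [h1, h2]
    simp only [IrrData.cvec, Finset.sum_sub_distrib, Finset.sum_const, Finset.card_univ,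
      AddChar.card_eq, ZMod.card, nsmul_eq_mul]
    rw [← h3]
    ring
  · intro c hc' g hg
    obtain ⟨ψ, hψ, rfl⟩ := Finset.mem_image.1 hc'
    simp only [IrrData.cvec, Int.cast_sub, Int.cast_natCast, mul_sub, Finset.sum_sub_distrib,
      D.sum_χ_mul_mt hτ _ hg, sub_self]
  · intro i hi htriv c hc'
    obtain ⟨ψ, hψ, rfl⟩ := Finset.mem_image.1 hc'
    rw [hS] at hψ
    have hm : ∀ φ : AddChar (ZMod n) ℂ, (D.mt hτ φ i : ℂ) = if φ = 0 then 1 else 0 := by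
      intro φ
      rw [IrrData.mt, D.m_eq]
      have e : ∑ a, φ.toMonoidHom a⁻¹ * D.χ i (tor hτ a) = ∑ a : ZMod n, φ a := by
        refine Fintype.sum_equiv ((Equiv.inv _).trans Multiplicative.toAdd) _ _ fun a => ?_
        simp only [IrrData.χ, htriv, Matrix.trace_one, Fintype.card_fin, hi, Nat.cast_one, mul_one]
        rfl
      rw [e, AddChar.sum_eq_ite, Fintype.card_multiplicative, ZMod.card]
      have hn0 : (n : ℂ) ≠ 0 := by exact_mod_cast NeZero.ne n
      split_ifs <;> simp [hn0]
    have h0 := hm 0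
    have h1 := hm ψ
    simp only [if_true, hψ, if_false] at h0 h1
    have h0' : D.mt hτ 0 i = 1 := by exact_mod_cast h0
    have h1' : D.mt hτ ψ i = 0 := by exact_mod_cast h1
    simp [IrrData.cvec, h0', h1']
  · intro i hi g hg hg1
    obtain ⟨a, rfl⟩ := (mem_zpowers_iff_tor hτ g).1 hg
    have ha : a ≠ 0 := by rintro rfl; exact hg1 (tor_zero hτ)
    have hconst : ∀ ψ, D.mt hτ ψ i = D.mt hτ 0 i := by
      intro ψ
      by_cases hψ : ψ = 0
      · rw [hψ]
      · have := hi _ (Finset.mem_image_of_mem (D.cvec hτ) ((hS ψ).2 hψ))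
        simp only [IrrData.cvec] at this
        omega
    have h1 := trace_eq_sum_mult ((D.ρ i).comp (tor hτ)) a
    change D.χ i _ = ∑ ψ : AddChar (ZMod n) ℂ, (D.mt hτ ψ i : ℂ) * ψ a at h1
    rw [h1]
    simp only [hconst, ← Finset.mul_sum]
    rw [AddChar.sum_apply_eq_ite, if_neg ha, mul_zero]

end TorusVectors

section Arith

lemma dvd_ordU {d : ℕ} (h : d ∣ ordU) : ∃ a < 6, ∃ b < 5, ∃ c < 3, ∃ e < 2, ∃ f < 2,
    ∃ g < 4, ∃ k < 2,
    d = 2^a * 3^b * 5^c * 7^e * 11^f * 89^g * 373^k := by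
  have hp : ∀ p n x : ℕ, p.Prime → x ∣ p ^ n → ∃ m < n + 1, x = p ^ m := fun p n x hp hx => by
    obtain ⟨m, hm, rfl⟩ := (Nat.dvd_prime_pow hp).1 hx
    exact ⟨m, by omega, rfl⟩
  rw [ordU, Nat.dvd_mul] at h
  obtain ⟨x6, x7, h, h7, rfl⟩ := h
  rw [Nat.dvd_mul] at h
  obtain ⟨x5, x6, h, h6, rfl⟩ := h
  rw [Nat.dvd_mul] at h
  obtain ⟨x4, x5, h, h5, rfl⟩ := h
  rw [Nat.dvd_mul] at h
  obtain ⟨x3, x4, h, h4, rfl⟩ := h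
  rw [Nat.dvd_mul] at h
  obtain ⟨x2, x3, h, h3, rfl⟩ := h
  rw [Nat.dvd_mul] at h
  obtain ⟨x1, x2, h1, h2, rfl⟩ := h
  obtain ⟨a, ha, rfl⟩ := hp 2 5 _ (by norm_num) h1
  obtain ⟨b, hb, rfl⟩ := hp 3 4 _ (by norm_num) h2
  obtain ⟨c, hc, rfl⟩ := hp 5 2 _ (by norm_num) h3
  obtain ⟨e, he, rfl⟩ := hp 7 1 _ (by norm_num) (by simpa using h4)
  obtain ⟨f, hf, rfl⟩ := hp 11 1 _ (by norm_num) (by simpa using h5)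
  obtain ⟨g, hg, rfl⟩ := hp 89 3 _ (by norm_num) h6
  obtain ⟨k, hk, rfl⟩ := hp 373 1 _ (by norm_num) (by simpa using h7)
  exact ⟨a, ha, b, hb, c, hc, e, he, f, hf, g, hg, k, hk, rfl⟩

/-- The congruence and size restrictions on a degree leave few possibilities. -/
def DegreeCandidate (d : ℕ) : Prop :=
  (d * d ≤ ordU → (d % 2611 = 1 → d = 1) ∧
      (d % 2611 = 2610 → d = 7832 ∨ d = 237600 ∨ d = 704969 ∨ d = 21386700)) ∧
    (870 * (d * d) ≤ ordU → (d % 2611 = 3 → d = 3) ∧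
      (d % 2611 = 2608 → d = 23496 ∨ d = 712800))

instance : DecidablePred DegreeCandidate := fun _ => by unfold DegreeCandidate; infer_instance

lemma degree_candidates {d : ℕ} (h : d ∣ ordU) : DegreeCandidate d := by
  obtain ⟨a, ha, b, hb, c, hc, e, he, f, hf, g, hg, k, hk, rfl⟩ := dvd_ordU h
  have key : ∀ (a : Fin 6) (b : Fin 5) (c : Fin 3) (e f : Fin 2) (g : Fin 4) (k : Fin 2),
      DegreeCandidate (2^a.1 * 3^b.1 * 5^c.1 * 7^e.1 * 11^f.1 * 89^g.1 * 373^k.1) := by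
    decide +kernel
  exact key ⟨a, ha⟩ ⟨b, hb⟩ ⟨c, hc⟩ ⟨e, he⟩ ⟨f, hf⟩ ⟨g, hg⟩ ⟨k, hk⟩

lemma degree_arith {x y d : ℕ} {e₂ e₃ e : ℤ} (hx : x ∣ ordU) (hy : y ∣ ordU) (hd : d ∣ ordU)
    (h2 : e₂ * e₂ = 1) (h3 : e₃ * e₃ = 1) (h1 : e * e = 1)
    (hx2 : x * x ≤ ordU) (hy2 : y * y ≤ ordU) (hd2 : 870 * (d * d) ≤ ordU)
    (mx : (2611 : ℤ) ∣ x - e₂) (my : (2611 : ℤ) ∣ y - e₃) (md : (2611 : ℤ) ∣ d + 3 * e)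
    (hrel : 1 + e₂ * x + e₃ * y + e * d = 0) :
    (x = 1 ∧ y = 1 ∧ d = 3 ∧ e₂ = 1 ∧ e₃ = 1 ∧ e = -1) ∨
    (d = 712800 ∧ ((x = 7832 ∧ y = 704969) ∨ (y = 7832 ∧ x = 704969))) := by
  have hX : ∀ {x : ℕ} {e : ℤ}, x ∣ ordU → e * e = 1 → x * x ≤ ordU → (2611 : ℤ) ∣ x - e →
      (e = 1 ∧ x = 1) ∨ (e = -1 ∧ (x = 7832 ∨ x = 237600 ∨ x = 704969 ∨ x = 21386700)) := by
    intro x e hx he hx2 mx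
    obtain ⟨c1, c2⟩ := (degree_candidates hx).1 hx2
    rcases mul_self_eq_one_iff.1 he with rfl | rfl
    · exact Or.inl ⟨rfl, c1 (by omega)⟩
    · exact Or.inr ⟨rfl, c2 (by omega)⟩
  have hD : (e = -1 ∧ d = 3) ∨ (e = 1 ∧ (d = 23496 ∨ d = 712800)) := by
    obtain ⟨c1, c2⟩ := (degree_candidates hd).2 hd2
    rcases mul_self_eq_one_iff.1 h1 with rfl | rfl
    · exact Or.inr ⟨rfl, c2 (by omega)⟩
    · exact Or.inl ⟨rfl, c1 (by omega)⟩
  rcases hX hx h2 hx2 mx with ⟨rfl, rfl⟩ | ⟨rfl, rfl | rfl | rfl | rfl⟩ <;>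
  rcases hX hy h3 hy2 my with ⟨rfl, rfl⟩ | ⟨rfl, rfl | rfl | rfl | rfl⟩ <;>
  rcases hD with ⟨rfl, rfl⟩ | ⟨rfl, rfl | rfl⟩ <;> first | (exfalso; norm_num at hrel; done) | simp

end Arith

/-- The order of `G` together with the local consequences of the degree conditions at the
primes `7` and `373`. -/
structure LocalData (G : Type*) [Group G] : Prop where
  card : Nat.card G = ordU
  cent373 : ∀ x : G, orderOf x = 373 → Nat.card (Subgroup.centralizer {x}) = 2611 ∧
    Nat.card (Subgroup.normalizer (Subgroup.zpowers x : Set G)) = 7833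
  cent7 : ∀ x : G, orderOf x = 7 → Nat.card (Subgroup.centralizer {x}) = 2611
  torus : ∃ τ : G, orderOf τ = 2611 ∧
      (∀ a : ℕ, ¬ 2611 ∣ a → ∀ g : G, Commute g (τ ^ a) → g ∈ Subgroup.zpowers τ) ∧
      Nat.card (Subgroup.normalizer (Subgroup.zpowers τ : Set G)) = 7833

lemma localData {G : Type*} [Group G] [Finite G] (hG : Nat.card G = ordU) (h7 : gkDegree G 7 = 1)
    (h373 : gkDegree G 373 = 1) : LocalData G :=
  ⟨hG, (local_373 hG h373).2, local_7 hG h7 h373, exists_torus hG h7 h373⟩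

section Frattini

variable {G : Type*} [Group G] [Finite G]

lemma fixedPoints_conj_aux {p : ℕ} [Fact p.Prime] {s : G} (hs : orderOf s = p) (R : Subgroup G)
    (hR : s ∈ Subgroup.normalizer (R : Set G))
    (hcop : Nat.Coprime (Nat.card R) (Nat.card (Subgroup.centralizer {s}))) :
    Nat.card R ≡ 1 [MOD p] := by
  let act : Subgroup.zpowers s →* MulAut R :=
    R.normalizerMonoidHom.comp (Subgroup.inclusion ((Subgroup.zpowers_le).2 hR))
  letI : MulAction (Subgroup.zpowers s) R := MulAction.compHom R act
  have hp : IsPGroup p (Subgroup.zpowers s) :=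
    IsPGroup.of_card (n := 1) (by rw [Nat.card_zpowers, hs, pow_one])
  have h := hp.card_modEq_card_fixedPoints R
  have h1 : Nat.card (MulAction.fixedPoints (Subgroup.zpowers s) R) = 1 := by
    rw [Nat.card_eq_one_iff_unique]
    refine ⟨⟨?_⟩, ⟨⟨1, fun g => map_one (act g)⟩⟩⟩
    have h2 : ∀ x ∈ MulAction.fixedPoints (Subgroup.zpowers s) R, x = 1 := by
      intro x hx
      have h3 := congrArg Subtype.val (hx ⟨s, Subgroup.mem_zpowers s⟩)
      change s * x.1 * s⁻¹ = x.1 at h3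
      have h4 : x.1 ∈ R ⊓ Subgroup.centralizer {s} := by
        refine Subgroup.mem_inf.2 ⟨x.2, ?_⟩
        rw [Subgroup.mem_centralizer_singleton_iff]
        exact (mul_inv_eq_iff_eq_mul.1 h3).symm
      rw [(Subgroup.disjoint_of_coprime_natCard hcop).eq_bot, Subgroup.mem_bot] at h4
      exact Subtype.ext h4
    intro x y
    exact Subtype.ext ((h2 _ x.2).trans (h2 _ y.2).symm)
  rwa [h1] at h

lemma LocalData.exists_373 (L : LocalData G) : ∃ s : G, orderOf s = 373 := by
  have : 373 ∣ Nat.card G := by rw [L.card]; norm_num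
  exact exists_prime_orderOf_dvd_card' 373 this

lemma LocalData.modEq_of_normalizes (L : LocalData G) {s : G} (hs : orderOf s = 373)
    (R : Subgroup G)
    (hR : s ∈ Subgroup.normalizer (R : Set G)) (hcop : Nat.Coprime (Nat.card R) 2611) :
    Nat.card R ≡ 1 [MOD 373] :=
  fixedPoints_conj_aux hs R hR (by rwa [(L.cent373 s hs).1])

instance fact_prime_5 : Fact (Nat.Prime 5) := ⟨by norm_num⟩

lemma LocalData.dvd_card_of_normal (L : LocalData G) (M : Subgroup G) [M.Normal]
    (h5 : 5 ∣ Nat.card M) :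
    373 ∣ Nat.card M := by
  by_contra h373
  let R : Sylow 5 M := default
  let R' : Subgroup G := R.1.map M.subtype
  have hF : Subgroup.normalizer (R' : Set G) ⊔ M = ⊤ := Sylow.normalizer_sup_eq_top R
  have hdvd : 373 ∣ Nat.card (Subgroup.normalizer (R' : Set G)) := by
    have h1 : Nat.card G ∣ Nat.card (Subgroup.normalizer (R' : Set G)) * Nat.card M := by
      have h2 : M.index ∣ Nat.card (Subgroup.normalizer (R' : Set G)) := by
        rw [← Subgroup.relIndex_top_right, ← hF, Subgroup.relIndex_sup_right]
        exact Subgroup.relIndex_dvd_card _ _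
      rw [← M.index_mul_card]
      exact mul_dvd_mul_right h2 _
    have h2 : 373 ∣ Nat.card (Subgroup.normalizer (R' : Set G)) * Nat.card M :=
      dvd_trans (by rw [L.card]; norm_num) h1
    exact ((Nat.Prime.dvd_mul (by norm_num)).1 h2).resolve_right h373
  obtain ⟨⟨s, hs⟩, hs1⟩ := exists_prime_orderOf_dvd_card' 373 hdvd
  rw [Subgroup.orderOf_mk] at hs1
  have hcard : Nat.card R' = Nat.card R.1 :=
    Subgroup.card_map_of_injective M.subtype_injective
  obtain ⟨k, hk⟩ := IsPGroup.iff_card.1 R.2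
  have hk2 : k ≤ 2 := by
    refine pow_le_of_dvd (r := 5) (m := Nat.card G) ?_ (by rw [L.card]; norm_num)
    rw [← hk]
    exact hcard ▸ Subgroup.card_subgroup_dvd_card R'
  have hk1 : k ≠ 0 := by
    rintro rfl
    have := R.dvd_card_of_dvd_card h5
    rw [hk] at this
    norm_num at this
  have h := L.modEq_of_normalizes hs1 R' hs (by
    rw [hcard, hk]; exact Nat.Coprime.pow_left _ (by norm_num))
  rw [hcard, hk] at h
  interval_cases k
  · exact hk1 rfl
  · exact absurd h (by decide)
  · exact absurd h (by decide)

/-- Linear characters are trivial on elements of order dividing `5`. -/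
lemma LocalData.linear_eq_one (L : LocalData G) (f : G →* ℂˣ) {g : G} (hg : g ^ 5 = 1) :
    f g = 1 := by
  obtain ⟨s, hs⟩ := L.exists_373
  let N : Subgroup G := (Subgroup.zpowers (f s)).comap f
  have hsN : s ∈ N := Subgroup.mem_zpowers (f s)
  have hN : N.Normal := inferInstance
  let S : Sylow 373 N := default
  have hF := Sylow.normalizer_sup_eq_top S
  have hcS : ∃ x : G, orderOf x = 373 ∧ S.1.map N.subtype = Subgroup.zpowers x := by
    have hcard : Nat.card (S.1.map N.subtype) = Nat.card S.1 :=
      Subgroup.card_map_of_injective N.subtype_injective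
    obtain ⟨k, hk⟩ := IsPGroup.iff_card.1 S.2
    have hk2 : k ≤ 1 := by
      refine pow_le_of_dvd (r := 373) (m := Nat.card G) ?_ (by rw [L.card]; norm_num)
      rw [← hk]
      exact hcard ▸ Subgroup.card_subgroup_dvd_card _
    have hd : 373 ∣ Nat.card N := by
      have := orderOf_dvd_natCard (⟨s, hsN⟩ : N)
      rwa [Subgroup.orderOf_mk, hs] at this
    have h1 := S.dvd_card_of_dvd_card hd
    have hS : Nat.card (S.1.map N.subtype) = 373 := by
      rw [hcard]
      interval_cases k
      · rw [hk] at h1; norm_num at h1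
      · exact hk
    obtain ⟨⟨x, hx⟩, hx1⟩ := exists_prime_orderOf_dvd_card' 373 (dvd_of_eq hS.symm)
    rw [Subgroup.orderOf_mk] at hx1
    refine ⟨x, hx1, (Subgroup.eq_of_le_of_card_ge ((Subgroup.zpowers_le).2 hx) ?_).symm⟩
    rw [hS, Nat.card_zpowers, hx1]
  obtain ⟨x, hx, hxS⟩ := hcS
  rw [hxS] at hF
  have hg2 : g ∈ Subgroup.normalizer (Subgroup.zpowers x : Set G) ⊔ N := by rw [hF]; trivial
  rw [← SetLike.mem_coe, Subgroup.mul_normal] at hg2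
  obtain ⟨y, hy, n, hn, rfl⟩ := hg2
  have h1 : f n ^ 7833 = 1 := by
    obtain ⟨m, hm⟩ := hn
    have hm' : f s ^ m = f n := hm
    rw [← hm', ← zpow_natCast, ← zpow_mul, mul_comm, zpow_mul, zpow_natCast]
    have : s ^ 7833 = 1 := orderOf_dvd_iff_pow_eq_one.1 (by rw [hs]; norm_num)
    rw [← map_pow, this, map_one, one_zpow]
  have h2 : f y ^ 7833 = 1 := by
    have : orderOf y ∣ 7833 := by
      have := orderOf_dvd_natCard (⟨y, hy⟩ : Subgroup.normalizer (Subgroup.zpowers x : Set G))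
      rwa [Subgroup.orderOf_mk, (L.cent373 x hx).2] at this
    rw [← map_pow, orderOf_dvd_iff_pow_eq_one.1 this, map_one]
  have h3 : orderOf (f (y * n)) ∣ 5 := orderOf_dvd_of_pow_eq_one (by rw [← map_pow, hg, map_one])
  have h4 : orderOf (f (y * n)) ∣ 7833 := orderOf_dvd_of_pow_eq_one (by
    rw [map_mul, mul_pow, h1, h2, mul_one])
  have h5 := Nat.dvd_gcd h3 h4
  rw [show Nat.gcd 5 7833 = 1 by norm_num] at h5
  exact orderOf_eq_one_iff.1 (Nat.dvd_one.1 h5)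

end Frattini

lemma IrrData.eq_one_of_m_eq {G : Type*} [Group G] [Fintype G] (D : IrrData G) {A : Type*} [Group A]
    [Fintype A] (f : A →* G) {i : Fin D.n} (h : D.m f 1 i = D.d i) (a : A) : D.ρ i (f a) = 1 := by
  let E := avg ((D.ρ i).comp f) 1
  have hE : E * E = E := avg_mul_avg _ _
  have ht : (1 - E).trace = 0 := by
    rw [Matrix.trace_sub, Matrix.trace_one, Fintype.card_fin, mult_eq, sub_eq_zero]
    exact_mod_cast h.symm
  have h1 : 1 - E = 0 := by
    refine Matrix_eq_zero_of_trace ?_ ht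
    simp [mul_sub, sub_mul, hE]
  have h2 := mul_avg ((D.ρ i).comp f) 1 a
  change _ * E = _ • E at h2
  rw [← sub_eq_zero.1 h1] at h2
  simpa using h2

variable {G : Type*} [Group G]

lemma exists_linear {d : ℕ} (hd : d = 1) (ρ : G →* Matrix (Fin d) (Fin d) ℂ) :
    ∃ f : G →* ℂˣ, ∀ g, ρ g = (f g : ℂ) • 1 := by
  subst hd
  refine ⟨(Matrix.detMonoidHom.comp ρ).toHomUnits, fun g => ?_⟩
  ext i j
  fin_cases i
  fin_cases j
  simp

variable [Fintype G]

lemma IrrData.exists_linear (D : IrrData G) {i : Fin D.n} (hd : D.d i = 1) :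
    ∃ f : G →* ℂˣ, (∀ g, D.ρ i g = (f g : ℂ) • 1) ∧ ∀ g, D.χ i g = f g := by
  obtain ⟨f, hf⟩ := U389.exists_linear hd (D.ρ i)
  exact ⟨f, hf, fun g => by simp [IrrData.χ, hf, hd]⟩

lemma IrrData.sum_d_mul_d (D : IrrData G) : ∑ i, D.d i * D.d i = Nat.card G := by
  have h := D.orth' 1 1
  simp only [D.χ_one] at h
  have : Nat.card {g : G // 1 * g * 1 = g} = Nat.card G :=
    Nat.card_congr (Equiv.subtypeUnivEquiv fun g => by simp)
  rw [this] at h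
  exact_mod_cast h

/-- The representations nontrivial on a torus of order `2611`, apart from the exceptional ones. -/
structure TorusData (D : IrrData G) (τ : G) where
  /-- index of the trivial representation -/
  i₀ : Fin D.n
  /-- index of the first exceptional representation -/
  i₂ : Fin D.n
  /-- index of the second exceptional representation -/
  i₃ : Fin D.n
  /-- sign of the first exceptional representation -/
  e₂ : ℤ
  /-- sign of the second exceptional representation -/
  e₃ : ℤ
  /-- common sign of the other representations -/
  e : ℤ
  /-- indices of the other representations -/
  X : Finset (Fin D.n)
  d₀ : D.d i₀ = 1
  ρ₀ : ∀ g, D.ρ i₀ g = 1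
  h20 : i₂ ≠ i₀
  h30 : i₃ ≠ i₀
  h23 : i₂ ≠ i₃
  hX : ∀ x ∈ X, x ≠ i₀ ∧ x ≠ i₂ ∧ x ≠ i₃
  he₂ : e₂ * e₂ = 1
  he₃ : e₃ * e₃ = 1
  he : e * e = 1
  card : X.card = 870
  rel : ∀ x ∈ X, ∀ g, (g = 1 ∨ ∀ h, h * g * h⁻¹ ∉ Subgroup.zpowers τ) →
    1 + e₂ * D.χ i₂ g + e₃ * D.χ i₃ g + e * D.χ x g = 0
  mod₂ : (2611 : ℤ) ∣ D.d i₂ - e₂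
  mod₃ : (2611 : ℤ) ∣ D.d i₃ - e₃
  mod : ∀ x ∈ X, (2611 : ℤ) ∣ D.d x + 3 * e
  dvd : ∀ i, i ≠ i₀ → i ≠ i₂ → i ≠ i₃ → i ∉ X → 2611 ∣ D.d i
  vanish : ∀ i, i ≠ i₀ → i ≠ i₂ → i ≠ i₃ → i ∉ X → ∀ g ∈ Subgroup.zpowers τ, g ≠ 1 → D.χ i g = 0

lemma LocalData.exists_torusData (L : LocalData G) (D : IrrData G) :
    ∃ τ : G, orderOf τ = 2611 ∧ Nonempty (TorusData D τ) := by
  classical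
  obtain ⟨τ, hτ, hc, hN⟩ := L.torus
  refine ⟨τ, hτ, ?_⟩
  have hW : (torW hτ).card = 3 := by
    have := card_torW hτ hc (by norm_num)
    omega
  obtain ⟨C, h1, h2, h3, h4, h5, h6, h7⟩ := D.exists_torus_vectors hτ hc (by norm_num)
  rw [hW] at h1 h2 h3 h4
  obtain ⟨i₀, hd0, hρ0⟩ := D.exists_trivial
  have hCc : C.card = 870 := by omega
  obtain ⟨i₂, i₃, e₂, e₃, h20, h30, h23, he2, he3, hC⟩ := exists_common_coords C i₀ (h6 i₀ hd0 hρ0)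
    (by simpa using h2) (by simpa using h3) (by omega)
  have : Nonempty (Fin D.n) := ⟨i₀⟩
  choose! hc2 hc3 x e hx0 hx2 hx3 hee hxe hzero hother using hC
  have hsum : ∀ c ∈ C, ∀ f : Fin D.n → ℂ, ∑ i, f i * c i =
      f i₀ + e₂ * f i₂ + e₃ * f i₃ + e c * f (x c) := by
    intro c hcC f
    rw [← Finset.sum_subset (Finset.subset_univ {i₀, i₂, i₃, x c}), Finset.sum_insert,
      Finset.sum_insert,
      Finset.sum_insert, Finset.sum_singleton, h6 i₀ hd0 hρ0 c hcC, hc2 c hcC, hc3 c hcC, hxe c hcC]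
    · push_cast; ring
    · simpa using (hx3 c hcC).symm
    · simpa using ⟨h23, (hx2 c hcC).symm⟩
    · simpa using ⟨h20.symm, h30.symm, (hx0 c hcC).symm⟩
    · intro i _ hi
      simp only [Finset.mem_insert, Finset.mem_singleton, not_or] at hi
      rw [hzero c hcC i hi.1 hi.2.1 hi.2.2.1 hi.2.2.2]
      simp
  have hrel : ∀ c ∈ C, ∀ g, (g = 1 ∨ ∀ h, h * g * h⁻¹ ∉ Subgroup.zpowers τ) →
      1 + e₂ * D.χ i₂ g + e₃ * D.χ i₃ g + e c * D.χ (x c) g = 0 := by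
    intro c hcC g hg
    have := h5 c hcC g hg
    rw [hsum c hcC] at this
    rwa [IrrData.χ, hρ0, Matrix.trace_one, Fintype.card_fin, hd0, Nat.cast_one] at this
  have hinj : Set.InjOn x (C : Set (Fin D.n → ℤ)) := by
    intro c hcC c' hcC' hxx
    by_contra hne
    have h := hother c hcC c' hcC' (Ne.symm hne)
    have h' := hee c' hcC'
    rw [← hxe c' hcC', ← hxx, h] at h'
    simp at h'
  obtain ⟨c₀, hc₀⟩ : C.Nonempty := Finset.card_pos.1 (by omega)
  have hedz : ∀ c ∈ C, 1 + e₂ * (D.d i₂ : ℤ) + e₃ * D.d i₃ + e c * D.d (x c) = 0 := by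
    intro c hcC
    have h := hrel c hcC 1 (Or.inl rfl)
    simp only [D.χ_one] at h
    exact_mod_cast h
  have hecc : ∀ c ∈ C, e c = e c₀ := by
    intro c hcC
    have h1 := hedz c hcC
    have h2 := hedz c₀ hc₀
    have p1 := D.pos (x c)
    have p2 := D.pos (x c₀)
    rcases mul_self_eq_one_iff.1 (hee c hcC) with h | h <;>
      rcases mul_self_eq_one_iff.1 (hee c₀ hc₀) with h' | h' <;> rw [h] at h1 ⊢ <;>
      rw [h'] at h2 ⊢ <;> omega
  have hsumx : ∀ c ∈ C, ∑ c' ∈ C, c' (x c) = e c := by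
    intro c hcC
    rw [Finset.sum_eq_single_of_mem c hcC fun c' hc' hne => hother c hcC c' hc' hne, hxe c hcC]
  have hnz : ∀ i, i ≠ i₀ → i ≠ i₂ → i ≠ i₃ → i ∉ C.image x → ∀ c ∈ C, c i = 0 := by
    intro i h0 h2 h3 hX c hcC
    refine hzero c hcC i h0 h2 h3 ?_
    rintro rfl
    exact hX (Finset.mem_image_of_mem x hcC)
  refine ⟨⟨i₀, i₂, i₃, e₂, e₃, e c₀, C.image x, hd0, hρ0, h20, h30, h23, ?_, he2, he3,
    hee c₀ hc₀, ?_, ?_,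
    ?_, ?_, ?_, ?_, fun i h0 h2 h3 hX => h7 i (hnz i h0 h2 h3 hX)⟩⟩
  · intro y hy
    obtain ⟨c, hcC, rfl⟩ := Finset.mem_image.1 hy
    exact ⟨hx0 c hcC, hx2 c hcC, hx3 c hcC⟩
  · rw [Finset.card_image_of_injOn hinj, hCc]
  · intro y hy
    obtain ⟨c, hcC, rfl⟩ := Finset.mem_image.1 hy
    rw [← hecc c hcC]
    exact hrel c hcC
  · have h := h4 i₂
    rw [Finset.sum_congr rfl hc2, Finset.sum_const, hCc] at h
    simp only [nsmul_eq_mul] at h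
    omega
  · have h := h4 i₃
    rw [Finset.sum_congr rfl hc3, Finset.sum_const, hCc] at h
    simp only [nsmul_eq_mul] at h
    omega
  · intro y hy
    obtain ⟨c, hcC, rfl⟩ := Finset.mem_image.1 hy
    have h := h4 (x c)
    rw [hsumx c hcC, hecc c hcC] at h
    omega
  · intro i h0 h2 h3 hX
    have h := h4 i
    rw [Finset.sum_eq_zero (hnz i h0 h2 h3 hX)] at h
    omega

variable {G : Type*} [Group G] [Fintype G]

lemma not_conj_mem_zpowers {τ : G} (hτ : orderOf τ = 2611) {g : G} {p : ℕ} (hp : p.Coprime 2611)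
    (hg : g ^ p = 1) : g = 1 ∨ ∀ h, h * g * h⁻¹ ∉ Subgroup.zpowers τ := by
  by_contra! hcon
  obtain ⟨h1, h, h2⟩ := hcon
  have h3 : orderOf (h * g * h⁻¹) ∣ 2611 := by
    rw [← hτ]
    exact orderOf_dvd_of_mem_zpowers h2
  have h4 : orderOf (h * g * h⁻¹) ∣ p := orderOf_dvd_of_pow_eq_one (by rw [conj_pow, hg]; simp)
  have h5 := Nat.dvd_gcd h4 h3
  rw [hp.gcd_eq_one, Nat.dvd_one, orderOf_eq_one_iff] at h5
  exact h1 (by simpa using h5)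

/-- The exceptional representations are not both linear. -/
lemma LocalData.not_linear (L : LocalData G) (D : IrrData G) {τ : G} (hτ : orderOf τ = 2611)
    (T : TorusData D τ) (h2 : D.d T.i₂ = 1) (h3 : D.d T.i₃ = 1) (hd : ∀ x ∈ T.X, D.d x = 3)
    (he2 : T.e₂ = 1) (he3 : T.e₃ = 1) (he : T.e = -1) : False := by
  classical
  obtain ⟨f₂, -, hf₂⟩ := D.exists_linear h2
  obtain ⟨f₃, -, hf₃⟩ := D.exists_linear h3
  have hχ : ∀ x ∈ T.X, ∀ g : G, g ^ 5 = 1 → D.χ x g = 3 := by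
    intro x hx g hg
    have h := T.rel x hx g (not_conj_mem_zpowers hτ (by norm_num) hg)
    rw [he2, he3, he, hf₂, hf₃, L.linear_eq_one f₂ hg, L.linear_eq_one f₃ hg] at h
    push_cast at h
    linear_combination -h
  obtain ⟨g, hg⟩ : ∃ g : G, orderOf g = 5 :=
    exists_prime_orderOf_dvd_card' 5 (by rw [L.card]; norm_num)
  have hg5 : g ^ 5 = 1 := hg ▸ pow_orderOf_eq_one g
  have hker : ∀ x ∈ T.X, D.ρ x g = 1 := by
    intro x hx
    have h := D.eq_one_of_m_eq (zmodHom 5 g hg5) (i := x) ?_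
      (Multiplicative.ofAdd ((1 : ℕ) : ZMod 5))
    · rwa [zmodHom_natCast, pow_one] at h
    · have h := D.m_eq (zmodHom 5 g hg5) 1 x
      have h5 : ∀ a, D.χ x (zmodHom 5 g hg5 a) = 3 := by
        intro a
        refine hχ x hx _ ?_
        rw [← map_pow]
        have : a ^ 5 = 1 := by
          have := pow_card_eq_one (x := a)
          rwa [Fintype.card_multiplicative, ZMod.card] at this
        rw [this, map_one]
      simp only [h5, MonoidHom.one_apply, one_mul, Finset.sum_const, Finset.card_univ,
        Fintype.card_multiplicative, ZMod.card] at h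
      rw [hd x hx]
      norm_num at h
      exact_mod_cast h
  let s := τ ^ 7
  have hs : orderOf s = 373 := by rw [orderOf_pow, hτ]; norm_num
  have hs1 : s ≠ 1 := by
    intro h
    rw [h, orderOf_one] at hs
    norm_num at hs
  have hsρ : ∀ x ∈ T.X, D.ρ x s = 1 := by
    intro x hx
    let M := (D.ρ x).ker
    have h5 : 5 ∣ Nat.card M := by
      have hgM : g ∈ M := (D.ρ x).mem_ker.2 (hker x hx)
      have := orderOf_dvd_natCard (⟨g, hgM⟩ : M)
      rwa [Subgroup.orderOf_mk, hg] at this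
    have h6 := L.dvd_card_of_normal M h5
    obtain ⟨⟨t, htM⟩, ht⟩ := exists_prime_orderOf_dvd_card' 373 h6
    rw [Subgroup.orderOf_mk] at ht
    have hsyl : ∀ r : G, orderOf r = 373 → ∃ S : Sylow 373 G, S.1 = Subgroup.zpowers r := by
      intro r hr
      refine ⟨Sylow.ofCard (Subgroup.zpowers r) ?_, Sylow.coe_ofCard _ _⟩
      rw [Nat.card_zpowers, hr, L.card]
      have : ordU = 373 * (2^5*3^4*5^2*7*11*89^3) := by norm_num
      rw [this, Nat.factorization_mul (by norm_num) (by norm_num), Finsupp.add_apply,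
        Nat.Prime.factorization_self (by norm_num), Nat.factorization_eq_zero_of_not_dvd
          (by norm_num)]
      norm_num
    obtain ⟨S, hS⟩ := hsyl s hs
    obtain ⟨S', hS'⟩ := hsyl t ht
    obtain ⟨h, hh⟩ := MulAction.exists_smul_eq G S' S
    have h7 : s ∈ (h • S' : Sylow 373 G).1 := by rw [hh, hS]; exact Subgroup.mem_zpowers s
    rw [Sylow.coe_subgroup_smul, hS', Subgroup.mem_pointwise_smul_iff_inv_smul_mem] at h7
    have h8 : (MulAut.conj h)⁻¹ • s ∈ M := (Subgroup.zpowers_le.2 htM) h7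
    rw [← map_inv, MulAut.smul_def, MulAut.conj_apply, inv_inv] at h8
    have h9 := (inferInstance : M.Normal).conj_mem _ h8 h
    have : h * (h⁻¹ * s * h) * h⁻¹ = s := by group
    rwa [this] at h9
  have hsum := D.sum_d_mul_χ s
  rw [if_neg hs1, ← Finset.sum_subset (Finset.subset_univ
    (insert T.i₀ (insert T.i₂ (insert T.i₃ T.X)))),
    Finset.sum_insert, Finset.sum_insert, Finset.sum_insert,
      Finset.sum_congr rfl (g := fun _ => 9)] at hsum
  · rw [IrrData.χ, T.ρ₀, Matrix.trace_one, Fintype.card_fin, T.d₀, h2, h3, hf₂, hf₃,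
      Finset.sum_const,
      T.card] at hsum
    have hn : ∀ f : G →* ℂˣ, ‖(f s : ℂ)‖ = 1 := by
      intro f
      refine Complex.norm_eq_one_of_pow_eq_one (n := 373) ?_ (by norm_num)
      rw [← Units.val_pow_eq_pow_val, ← map_pow, ← hs, pow_orderOf_eq_one, map_one, Units.val_one]
    have h1 : (f₂ s : ℂ) + f₃ s = -7831 := by
      simp only [Nat.cast_one, one_mul, nsmul_eq_mul] at hsum
      norm_num at hsum
      linear_combination hsum
    have h4 := norm_add_le (f₂ s : ℂ) (f₃ s)
    rw [h1, hn, hn] at h4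
    norm_num at h4
  · intro x hx
    rw [IrrData.χ, hsρ x hx, Matrix.trace_one, Fintype.card_fin, hd x hx]
    norm_num
  · exact fun h => (T.hX _ h).2.2 rfl
  · simp only [Finset.mem_insert, not_or]
    exact ⟨T.h23, fun h => (T.hX _ h).2.1 rfl⟩
  · simp only [Finset.mem_insert, not_or]
    exact ⟨T.h20.symm, T.h30.symm, fun h => (T.hX _ h).1 rfl⟩
  · intro i _ hi
    simp only [Finset.mem_insert, not_or] at hi
    rw [T.vanish i hi.1 hi.2.1 hi.2.2.1 hi.2.2.2 s ⟨7, by simp [s]⟩ hs1, mul_zero]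

theorem LocalData.exists_degrees (L : LocalData G) (D : IrrData G) :
    ∃ i₀ i₂ i₃, D.d i₀ = 1 ∧ (∀ g, D.ρ i₀ g = 1) ∧ D.d i₂ = 7832 ∧ D.d i₃ = 704969 ∧
      ∀ i, D.d i = 1 → i = i₀ := by
  obtain ⟨τ, hτ, ⟨T⟩⟩ := L.exists_torusData D
  have hcard : Fintype.card G = ordU := by rw [← Nat.card_eq_fintype_card, L.card]
  have hdvd : ∀ i, D.d i ∣ ordU := fun i => hcard ▸ D.d_dvd i
  have hle : ∀ s : Finset (Fin D.n), ∑ i ∈ s, D.d i * D.d i ≤ ordU := by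
    intro s
    rw [← L.card, ← D.sum_d_mul_d]
    exact Finset.sum_le_sum_of_subset (Finset.subset_univ s)
  have hdz : ∀ x ∈ T.X, 1 + T.e₂ * (D.d T.i₂ : ℤ) + T.e₃ * D.d T.i₃ + T.e * D.d x = 0 := by
    intro x hx
    have h := T.rel x hx 1 (Or.inl rfl)
    simp only [D.χ_one] at h
    exact_mod_cast h
  obtain ⟨x₀, hx₀⟩ : T.X.Nonempty := Finset.card_pos.1 (by rw [T.card]; norm_num)
  have hconst : ∀ x ∈ T.X, D.d x = D.d x₀ := by
    intro x hx
    have h1 := hdz x hx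
    have h2 := hdz x₀ hx₀
    rcases mul_self_eq_one_iff.1 T.he with h | h <;> rw [h] at h1 h2 <;> omega
  have h870 : 870 * (D.d x₀ * D.d x₀) ≤ ordU := by
    have h := hle T.X
    rw [Finset.sum_congr rfl (g := fun _ => D.d x₀ * D.d x₀) fun x hx => by rw [hconst x hx],
      Finset.sum_const, T.card] at h
    exact h
  have h1 : ∀ i, D.d i * D.d i ≤ ordU := fun i => by simpa using hle {i}
  have key := degree_arith (hdvd T.i₂) (hdvd T.i₃) (hdvd x₀) T.he₂ T.he₃ T.he (h1 _) (h1 _) h870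
    T.mod₂ T.mod₃ (T.mod x₀ hx₀) (hdz x₀ hx₀)
  have huniq : D.d x₀ ≠ 1 → D.d T.i₂ ≠ 1 → D.d T.i₃ ≠ 1 → ∀ i, D.d i = 1 → i = T.i₀ := by
    intro hx h2 h3 i hi
    by_contra h0
    have n2 : i ≠ T.i₂ := fun h => h2 (h ▸ hi)
    have n3 : i ≠ T.i₃ := fun h => h3 (h ▸ hi)
    have n4 : i ∉ T.X := fun h => hx (hconst i h ▸ hi)
    have := T.dvd i h0 n2 n3 n4
    rw [hi] at this
    norm_num at this
  rcases key with ⟨hx, hy, hd, he2, he3, he⟩ | ⟨hd, ⟨hx, hy⟩ | ⟨hx, hy⟩⟩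
  · exact (L.not_linear D hτ T hx hy (fun x h => (hconst x h).trans hd) he2 he3 he).elim
  · exact ⟨T.i₀, T.i₂, T.i₃, T.d₀, T.ρ₀, hx, hy, huniq (by omega) (by omega) (by omega)⟩
  · exact ⟨T.i₀, T.i₃, T.i₂, T.d₀, T.ρ₀, hx, hy, huniq (by omega) (by omega) (by omega)⟩

section FixedVector

variable {P X k : Type*} [Group P] [Fintype P] [MulAction P X] [CommRing k] {p : ℕ} [Fact p.Prime]
  [CharP k p]

lemma exists_fixed_combination (hP : IsPGroup p P) (f : X → k) (hf : f ≠ 0) :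
    ∃ n : P → ℤ, (∃ y, ∑ z, n z * f (z⁻¹ • y) ≠ 0) ∧
      ∀ (x : P) (y : X), ∑ z, (n z : k) * f (z⁻¹ • x • y) = ∑ z, n z * f (z⁻¹ • y) := by
  classical
  let Φ : (P → ℤ) →+ (X → k) :=
    { toFun := fun n y => ∑ z, n z * f (z⁻¹ • y)
      map_zero' := by ext; simp
      map_add' := fun a b => by ext; simp [add_mul, Finset.sum_add_distrib] }
  let act : MulAction P (X → k) := arrowAction
  have hact : ∀ (x : P) (g : X → k) (y : X), (x • g) y = g (x⁻¹ • y) := fun _ _ _ => rfl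
  have hΦ : ∀ (x : P) (n : P → ℤ), x • Φ n = Φ fun z => n (x⁻¹ * z) := by
    intro x n
    ext y
    rw [hact]
    change ∑ z, (n z : k) * f (z⁻¹ • x⁻¹ • y) = ∑ z, (n (x⁻¹ * z) : k) * f (z⁻¹ • y)
    refine Fintype.sum_equiv (Equiv.mulLeft x) _ _ fun z => ?_
    simp [mul_smul]
  let T : AddSubgroup (X → k) := Φ.range
  let actT : MulAction P T :=
    { smul := fun x t => ⟨x • t.1, by
        obtain ⟨n, hn⟩ := t.2
        exact ⟨_, by rw [← hΦ, hn]⟩⟩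
      one_smul := fun t => Subtype.ext (one_smul P t.1)
      mul_smul := fun x y t => Subtype.ext (mul_smul x y t.1) }
  have hpz : ∀ t : T, p • t = 0 := fun t => by ext y; simp
  have hfin : Finite T := by
    refine Finite.of_surjective (fun n : P → ZMod p => (⟨Φ fun z => (n z).val, _, rfl⟩ : T)) ?_
    rintro ⟨_, n, rfl⟩
    refine ⟨fun z => (n z : ZMod p), Subtype.ext ?_⟩
    ext y
    change ∑ z, (((n z : ZMod p).val : ℤ) : k) * f (z⁻¹ • y) = ∑ z, (n z : k) * f (z⁻¹ • y)
    refine Finset.sum_congr rfl fun z _ => ?_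
    congr 1
    rw [← sub_eq_zero, ← Int.cast_sub, CharP.intCast_eq_zero_iff k p,
      ← ZMod.intCast_zmod_eq_zero_iff_dvd]
    simp
  have hfT : f ∈ T := ⟨Pi.single 1 1, by
    ext y
    change ∑ z, (((Pi.single 1 1 : P → ℤ) z : ℤ) : k) * f (z⁻¹ • y) = f y
    rw [Finset.sum_eq_single 1] <;> simp +contextual⟩
  have hdvd : p ∣ Nat.card T := by
    have h1 : addOrderOf (⟨f, hfT⟩ : T) = p :=
      addOrderOf_eq_prime (hpz _) fun h => hf (congrArg Subtype.val h)
    rw [← h1]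
    exact addOrderOf_dvd_natCard _
  obtain ⟨⟨_, n, rfl⟩, hb, hb0⟩ := hP.exists_fixed_point_of_prime_dvd_card_of_fixed_point T hdvd
    (a := 0) (fun x => Subtype.ext (by ext y; rfl))
  refine ⟨n, ?_, fun x y => ?_⟩
  · by_contra! h
    exact hb0 (Subtype.ext (funext fun y => (h y).symm))
  · have := congrFun (congrArg Subtype.val (hb x⁻¹)) y
    change Φ n (x⁻¹⁻¹ • y) = Φ n y at this
    rwa [inv_inv] at this

end FixedVector

section Valuation

lemma exists_valuationSubring (p : ℕ) [Fact p.Prime] :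
    ∃ R : ValuationSubring ℂ, R.valuation (p : ℂ) < 1 := by
  let A : Subring ℂ := (algebraMap ℤ ℂ).range
  obtain ⟨R, -, hR⟩ := Ideal.image_subset_nonunits_valuationSubring
    (Ideal.span {(⟨(p : ℂ), p, by simp⟩ : A)}) (by
      rw [Ne, Ideal.span_singleton_eq_top, isUnit_iff_exists_inv]
      rintro ⟨⟨_, b, rfl⟩, hb⟩
      have h1 := congrArg Subtype.val hb
      simp only [eq_intCast, Subring.coe_mul, Subring.coe_one] at h1
      have h2 : (p : ℤ) * b = 1 := by exact_mod_cast h1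
      have h3 := Int.isUnit_iff.1 (IsUnit.of_mul_eq_one b h2)
      have := (Fact.out : p.Prime).two_le
      omega)
  exact ⟨R, R.mem_nonunits_iff.1 (hR ⟨_, Ideal.mem_span_singleton_self _, rfl⟩)⟩

variable (R : ValuationSubring ℂ)

lemma valuation_natCast_le (n : ℕ) : R.valuation (n : ℂ) ≤ 1 :=
  (R.valuation_le_one_iff _).2 (natCast_mem R n)

lemma valuation_intCast_le (n : ℤ) : R.valuation (n : ℂ) ≤ 1 :=
  (R.valuation_le_one_iff _).2 (intCast_mem R n)

lemma valuation_le_of_isIntegral {x : ℂ} (hx : IsIntegral ℤ x) : R.valuation x ≤ 1 := by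
  rw [R.valuation_le_one_iff]
  have h : IsIntegral R x := hx.tower_top
  obtain ⟨y, hy⟩ := IsIntegrallyClosed.isIntegral_iff.1 h
  rw [← hy]
  exact y.2

lemma valuation_eq_one_of_coprime {p m : ℕ} (hp : R.valuation (p : ℂ) < 1) (h : Nat.Coprime p m) :
    R.valuation (m : ℂ) = 1 := by
  refine le_antisymm (valuation_natCast_le R m) (not_lt.1 fun hm => ?_)
  obtain ⟨a, b, hab⟩ := Nat.isCoprime_iff_coprime.2 h
  have h1 : (a : ℂ) * p + b * m = 1 := by exact_mod_cast hab
  have h2 : R.valuation ((a : ℂ) * p + b * m) < 1 := by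
    refine R.valuation.map_add_lt ?_ ?_
    · rw [map_mul]; exact mul_lt_one_of_nonneg_of_lt_one_right (valuation_intCast_le R a) zero_le hp
    · rw [map_mul]; exact mul_lt_one_of_nonneg_of_lt_one_right (valuation_intCast_le R b) zero_le hm
  rw [h1, map_one] at h2
  exact lt_irrefl _ h2

lemma exists_fixed_combination_valuation {P X : Type*} [Group P] [Fintype P] [MulAction P X] {p : ℕ}
    [Fact p.Prime] (hp : R.valuation (p : ℂ) < 1) (hP : IsPGroup p P) (f : X → ℂ)
    (hf : ∀ y, R.valuation (f y) ≤ 1) (hf1 : ∃ y, R.valuation (f y) = 1) :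
    ∃ n : P → ℤ, (∃ y, R.valuation (∑ z, n z * f (z⁻¹ • y)) = 1) ∧
      ∀ (x : P) (y : X), R.valuation (∑ z, n z * f (z⁻¹ • x • y) - ∑ z, n z * f (z⁻¹ • y)) < 1 := by
  let k := IsLocalRing.ResidueField R
  let F : X → R := fun y => ⟨f y, (R.valuation_le_one_iff _).1 (hf y)⟩
  have hres : ∀ a : R, IsLocalRing.residue R a = 0 ↔ R.valuation (a : ℂ) < 1 := fun a => by
    rw [IsLocalRing.residue_eq_zero_iff, R.valuation_lt_one_iff]
  have hchar : CharP k p := by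
    refine (CharP.charP_iff_prime_eq_zero Fact.out).2 ?_
    have := (hres (p : R)).2 (by simpa using hp)
    simpa using this
  obtain ⟨n, ⟨y, hy⟩, h2⟩ := exists_fixed_combination (k := k) hP
    (fun y => IsLocalRing.residue R (F y))
    (by
      obtain ⟨y, hy⟩ := hf1
      intro h
      exact hy.not_lt ((hres _).1 (congrFun h y)))
  have hsum : ∀ y, ∑ z, (n z : k) * IsLocalRing.residue R (F (z⁻¹ • y)) =
      IsLocalRing.residue R (∑ z, n z * F (z⁻¹ • y)) := fun y => by simp
  have hco : ∀ y, ((∑ z, n z * F (z⁻¹ • y) : R) : ℂ) = ∑ z, n z * f (z⁻¹ • y) := fun y => by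
    simp [F]
  refine ⟨n, ⟨y, ?_⟩, fun x y => ?_⟩
  · rw [hsum, Ne, hres, hco, not_lt] at hy
    refine le_antisymm ?_ hy
    rw [← hco]
    exact R.valuation_le_one _
  · have := h2 x y
    rw [hsum, hsum, ← sub_eq_zero, ← map_sub, hres, AddSubgroupClass.coe_sub, hco, hco] at this
    exact this

end Valuation

variable {G : Type*} [Group G] [Fintype G]

section Trace

variable (R : ValuationSubring ℂ) {d : ℕ} (ρ : G → Matrix (Fin d) (Fin d) ℂ) (v₀ : Fin d → ℂ)

/-- The combinations of the vectors `ρ g v₀` with coefficients in the maximal ideal. -/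
def InMaximal (w : Fin d → ℂ) : Prop :=
  ∃ m : G → ℂ, (∀ g, R.valuation (m g) < 1) ∧ w = ∑ g, m g • Matrix.mulVec (ρ g) v₀

lemma exists_max_valuation {ι : Type*} [Finite ι] (y : ι → ℂ) (hy : y ≠ 0) :
    ∃ i, y i ≠ 0 ∧ ∀ j, R.valuation (y j) ≤ R.valuation (y i) := by
  obtain ⟨j, hj⟩ := Function.ne_iff.1 hy
  have : Nonempty ι := ⟨j⟩
  obtain ⟨i, hi⟩ := Finite.exists_max fun i => R.valuation (y i)
  refine ⟨i, fun h => hj ?_, hi⟩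
  have := hi j
  rw [h, map_zero, le_zero_iff, map_eq_zero] at this
  exact this

lemma trace_valuation_lt (A : Matrix (Fin d) (Fin d) ℂ)
    (hspan : ∀ ξ : Fin d → ℂ, ξ ≠ 0 → ∃ h, ξ ⬝ᵥ Matrix.mulVec (ρ h) v₀ ≠ 0)
    (hA : ∀ h, InMaximal R ρ v₀ (Matrix.mulVec A (Matrix.mulVec (ρ h) v₀))) :
    R.valuation A.trace < 1 := by
  rw [Matrix.trace_eq_sum_roots_charpoly]
  have hroot : ∀ l ∈ A.charpoly.roots, R.valuation l < 1 := by
    intro l hl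
    have h1 := (Polynomial.mem_roots'.1 hl).2
    rw [Polynomial.IsRoot, Matrix.eval_charpoly] at h1
    obtain ⟨ξ, hξ, hξA⟩ := Matrix.exists_vecMul_eq_zero_iff.2 h1
    have h2 : Matrix.vecMul ξ A = l • ξ := by
      rw [Matrix.vecMul_sub, sub_eq_zero] at hξA
      rw [← hξA]
      ext j
      simp [Matrix.scalar_apply, Matrix.vecMul_diagonal, mul_comm]
    let y : G → ℂ := fun h => ξ ⬝ᵥ Matrix.mulVec (ρ h) v₀
    obtain ⟨h, hy, hmax⟩ := exists_max_valuation R y (by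
      obtain ⟨h, hh⟩ := hspan ξ hξ
      exact Function.ne_iff.2 ⟨h, hh⟩)
    obtain ⟨m, hm, hAm⟩ := hA h
    have h3 : l * y h = ∑ g, m g * y g := by
      have := congrArg (fun w => ξ ⬝ᵥ w) hAm
      simp only [Matrix.dotProduct_mulVec ξ A, h2, smul_dotProduct, dotProduct_sum, dotProduct_smul,
        smul_eq_mul] at this
      exact this
    have hpos : 0 < R.valuation (y h) := by
      rw [zero_lt_iff]
      exact (Valuation.ne_zero_iff _).2 hy
    have h4 : R.valuation (l * y h) < R.valuation (y h) := by
      rw [h3]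
      refine R.valuation.map_sum_lt hpos.ne' fun g _ => ?_
      rw [map_mul]
      exact (mul_le_mul_right (hmax g) _).trans_lt (mul_lt_of_lt_one_left hpos (hm g))
    rw [map_mul] at h4
    exact lt_of_not_ge fun h5 => (le_mul_of_one_le_left zero_le h5).not_gt h4
  have : ∀ s : Multiset ℂ, (∀ l ∈ s, R.valuation l < 1) → R.valuation s.sum < 1 := by
    intro s
    induction s using Multiset.induction with
    | empty => intro _; simp
    | cons a s ih =>
      intro h
      rw [Multiset.sum_cons]
      exact R.valuation.map_add_lt (h a (Multiset.mem_cons_self _ _))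
        (ih fun l hl => h l (Multiset.mem_cons_of_mem hl))
  exact this _ hroot

end Trace

lemma sum_eq_sum_quotient (P : Subgroup G) [Fintype P] [Fintype (G ⧸ P)] {M : Type*}
    [AddCommMonoid M]
    (f : G → M) : ∑ g, f g = ∑ q : G ⧸ P, ∑ x : P, f (q.out * x) := by
  rw [← Fintype.sum_prod_type']
  refine (Function.Bijective.sum_comp (e := fun z : (G ⧸ P) × P => z.1.out * z.2.1) ⟨?_, ?_⟩ f).symm
  · rintro ⟨q, x⟩ ⟨q', x'⟩ h
    have hq : q = q' := by
      have := congrArg (QuotientGroup.mk : G → G ⧸ P) h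
      simpa [QuotientGroup.mk_mul_of_mem] using this
    subst hq
    simpa using h
  · intro g
    refine ⟨⟨QuotientGroup.mk g, ⟨(QuotientGroup.mk g : G ⧸ P).out⁻¹ * g, ?_⟩⟩, by simp⟩
    rw [← QuotientGroup.eq, QuotientGroup.out_eq']

variable {G : Type*} [Group G] [Fintype G] (D : IrrData G)

lemma IrrData.sum_χ_mul_χ (i : Fin D.n) (g : G) :
    (D.d i : ℂ) / Fintype.card G * ∑ h, D.χ i (h⁻¹ * g) * D.χ i h = D.χ i g := by
  have h := congrArg Matrix.trace (D.surj i (D.ρ i g))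
  simp only [Matrix.trace_smul, Matrix.trace_sum, smul_eq_mul, ← map_mul] at h
  rw [← IrrData.χ] at h
  rw [← h]
  congr 1
  refine Finset.sum_congr rfl fun x _ => ?_
  rw [IrrData.χ, map_mul, Matrix.trace_mul_comm, ← map_mul]
  rfl

lemma IrrData.χ_mul_comm (i : Fin D.n) (g h : G) : D.χ i (g * h) = D.χ i (h * g) := by
  rw [IrrData.χ, map_mul, Matrix.trace_mul_comm, ← map_mul]; rfl

variable {p : ℕ} [Fact p.Prime] (R : ValuationSubring ℂ) (P : Subgroup G) [Fintype P]

lemma IrrData.exists_trace_unit (hp : R.valuation (p : ℂ) < 1) (hP : IsPGroup p P) (i : Fin D.n)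
    {c : ℕ} (hc : c * D.d i = Fintype.card G) (hcp : p.Coprime c) :
    ∃ g, ¬ R.valuation (∑ x : P, D.χ i (x * g)) < 1 := by
  classical
  by_contra! hsmall
  have hc1 : R.valuation (c : ℂ) = 1 := valuation_eq_one_of_coprime R hp hcp
  have hd0 : (D.d i : ℂ) ≠ 0 := by exact_mod_cast (D.pos i).ne'
  have hc0 : (c : ℂ) ≠ 0 := by
    intro h
    rw [h, map_zero] at hc1
    exact zero_ne_one hc1
  have hu : (D.d i : ℂ) / Fintype.card G = (c : ℂ)⁻¹ := by
    rw [← hc]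
    push_cast
    field_simp
  let E : G → ℂ := fun g => (c : ℂ)⁻¹ * D.χ i g⁻¹
  have hE : ∀ g, R.valuation (E g) ≤ 1 := by
    intro g
    simp only [E, map_mul, map_inv₀, hc1, inv_one, one_mul]
    exact valuation_le_of_isIntegral R (D.χ_isIntegral i _)
  have hEE : ∀ g, ∑ h, E (g * h⁻¹) * E h = E g := by
    intro g
    have := D.sum_χ_mul_χ i g⁻¹
    rw [hu] at this
    simp only [E]
    rw [← this, Finset.mul_sum, Finset.mul_sum]
    refine Fintype.sum_equiv (Equiv.inv G) _ _ fun h => ?_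
    simp only [mul_inv_rev, inv_inv, Equiv.inv_apply]
    ring
  have hE1 : ∃ g, R.valuation (E g) = 1 := by
    obtain ⟨g, hg, hmax⟩ := exists_max_valuation R E (Function.ne_iff.2 ⟨1, by
      simp [E, D.χ_one, hc0, hd0]⟩)
    refine ⟨g, le_antisymm (hE g) (not_lt.1 fun hlt => ?_)⟩
    have hpos : 0 < R.valuation (E g) := by
      rw [zero_lt_iff]
      exact (Valuation.ne_zero_iff _).2 hg
    have : R.valuation (E g) < R.valuation (E g) := by
      conv_lhs => rw [← hEE g]
      refine R.valuation.map_sum_lt hpos.ne' fun h _ => ?_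
      rw [map_mul]
      exact (mul_le_mul' (hmax _) (hmax _)).trans_lt (mul_lt_of_lt_one_left hpos hlt)
    exact lt_irrefl _ this
  obtain ⟨n, ⟨y, hy⟩, hfix⟩ := exists_fixed_combination_valuation R hp hP E hE hE1
  let w : G → ℂ := fun y => ∑ z : P, n z * E (z⁻¹ • y)
  have hw1 : ∀ y, R.valuation (w y) ≤ 1 := by
    intro y
    refine R.valuation.map_sum_le fun z _ => ?_
    rw [map_mul]
    exact mul_le_one' (valuation_intCast_le R _) (hE _)
  have hwE : ∀ g, w g = ∑ h, w h * E (h⁻¹ * g) := by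
    intro g
    have h1 : ∀ z : P, E (z⁻¹ • g) = ∑ h, E (z⁻¹ • h) * E (h⁻¹ * g) := by
      intro z
      rw [← hEE]
      refine Fintype.sum_equiv ((Equiv.inv G).trans (Equiv.mulLeft g)) _ _ fun h => ?_
      simp only [Equiv.trans_apply, Equiv.inv_apply, Equiv.coe_mulLeft, mul_inv_rev, inv_inv,
        Subgroup.smul_def, smul_eq_mul, mul_assoc, inv_mul_cancel, mul_one]
    simp only [w]
    simp only [h1, Finset.mul_sum, Finset.sum_mul]
    rw [Finset.sum_comm]
    exact Finset.sum_congr rfl fun h _ => Finset.sum_congr rfl fun z _ => by ring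
  have hsum : ∀ g, ∑ h, w h * E (h⁻¹ * g) =
      ∑ q : G ⧸ P, ∑ x : P, w (q.out * x)⁻¹ * E (q.out * x * g) := by
    intro g
    rw [← sum_eq_sum_quotient P fun h => w h⁻¹ * E (h * g)]
    exact Fintype.sum_equiv (Equiv.inv G) _ _ fun h => by simp
  have hlt : R.valuation (w y) < 1 := by
    rw [hwE, hsum]
    refine R.valuation.map_sum_lt one_ne_zero fun q _ => ?_
    have h2 : ∑ x : P, w (q.out * x)⁻¹ * E (q.out * x * y) =
        ∑ x : P, (w ((x⁻¹ : P) • q.out⁻¹) - w q.out⁻¹) * E (q.out * x * y) +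
          w q.out⁻¹ * ∑ x : P, E (q.out * x * y) := by
      rw [Finset.mul_sum, ← Finset.sum_add_distrib]
      refine Finset.sum_congr rfl fun x _ => ?_
      rw [mul_inv_rev, Subgroup.smul_def, smul_eq_mul, InvMemClass.coe_inv]
      ring
    rw [h2]
    refine R.valuation.map_add_lt (R.valuation.map_sum_lt one_ne_zero fun x _ => ?_) ?_
    · rw [map_mul]
      exact (mul_le_of_le_one_right zero_le (hE _)).trans_lt (hfix _ _)
    · have h3 : ∑ x : P, E (q.out * x * y) = (c : ℂ)⁻¹ * ∑ x : P, D.χ i (x * (q.out⁻¹ * y⁻¹)) := by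
        rw [Finset.mul_sum]
        refine Fintype.sum_equiv (Equiv.inv P) _ _ fun x => ?_
        simp only [E, mul_inv_rev, Equiv.inv_apply, InvMemClass.coe_inv]
        rw [D.χ_mul_comm, mul_assoc]
      rw [h3, map_mul, map_mul, map_inv₀, hc1, inv_one, one_mul]
      exact (mul_le_of_le_one_left zero_le (hw1 _)).trans_lt (hsmall _)
  exact hlt.ne hy

/-- Characters of `p`-defect zero vanish on the nontrivial elements of a Sylow `p`-subgroup. -/
theorem IrrData.χ_eq_zero (hP : IsPGroup p P) (i : Fin D.n) (hcard : Nat.card P = D.d i)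
    {c : ℕ} (hc : c * D.d i = Fintype.card G) (hcp : p.Coprime c) (y : P) (hy : y ≠ 1) :
    D.χ i y = 0 := by
  classical
  obtain ⟨R, hp⟩ := exists_valuationSubring p
  obtain ⟨g, hg⟩ := D.exists_trace_unit R P hp hP i hc hcp
  have hd := D.pos i
  have hd0 : (D.d i : ℂ) ≠ 0 := by exact_mod_cast (D.pos i).ne'
  have hG0 : (Fintype.card G : ℂ) ≠ 0 := by simp
  let v₀ : Fin (D.d i) → ℂ := Pi.single ⟨0, hd⟩ 1
  let S : Matrix (Fin (D.d i)) (Fin (D.d i)) ℂ := ∑ x : P, D.ρ i x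
  have hspan : ∀ ξ : Fin (D.d i) → ℂ, ξ ≠ 0 → ∃ h, ξ ⬝ᵥ Matrix.mulVec (D.ρ i h) v₀ ≠ 0 := by
    intro ξ hξ
    by_contra! hall
    have h1 : ∀ A : Matrix (Fin (D.d i)) (Fin (D.d i)) ℂ, ξ ⬝ᵥ Matrix.mulVec A v₀ = 0 := by
      intro A
      rw [← D.surj i A, Matrix.smul_mulVec, Matrix.sum_mulVec, dotProduct_smul, dotProduct_sum,
        Finset.sum_eq_zero, smul_zero]
      intro h _
      rw [Matrix.smul_mulVec, dotProduct_smul, hall, smul_zero]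
    refine hξ (funext fun j => ?_)
    have := h1 (Matrix.single j ⟨0, hd⟩ 1)
    simpa [v₀, Matrix.mulVec_single_one, dotProduct, Matrix.col_apply,
      Matrix.single_apply] using this
  have htr : (S * D.ρ i g).trace = ∑ x : P, D.χ i (x * g) := by
    simp only [S, Finset.sum_mul, Matrix.trace_sum, ← map_mul]
    rfl
  rw [← htr] at hg
  obtain ⟨h, hh⟩ : ∃ h, ¬ InMaximal R (D.ρ i) v₀
      (Matrix.mulVec (S * D.ρ i g) (Matrix.mulVec (D.ρ i h) v₀)) := by
    by_contra! hall
    exact hg (trace_valuation_lt R (D.ρ i) v₀ _ hspan hall)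
  let u := Matrix.mulVec (D.ρ i (g * h)) v₀
  have hu : ¬ InMaximal R (D.ρ i) v₀ (Matrix.mulVec S u) := by
    rwa [Matrix.mulVec_mulVec, mul_assoc, ← map_mul, ← Matrix.mulVec_mulVec] at hh
  have hmul : ∀ a b : G, Matrix.mulVec (D.ρ i a) (Matrix.mulVec (D.ρ i b) v₀) =
      Matrix.mulVec (D.ρ i (a * b)) v₀ := fun a b => by rw [Matrix.mulVec_mulVec, ← map_mul]
  have hli : LinearIndependent ℂ fun x : P => Matrix.mulVec (D.ρ i x) u := by
    rw [Fintype.linearIndependent_iff]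
    by_contra! hdep
    obtain ⟨a', ha', x₀, hx₀⟩ := hdep
    obtain ⟨x₁, hx₁, hmax⟩ := exists_max_valuation R a' (Function.ne_iff.2 ⟨x₀, hx₀⟩)
    let a : P → ℂ := fun x => (a' x₁)⁻¹ * a' x
    have hpos : 0 < R.valuation (a' x₁) := by
      rw [zero_lt_iff]
      exact (Valuation.ne_zero_iff _).2 hx₁
    have ha1 : ∀ x, R.valuation (a x) ≤ 1 := by
      intro x
      simp only [a, map_mul, map_inv₀]
      rw [inv_mul_le_iff₀ hpos, mul_one]
      exact hmax x
    have ha : ∑ x : P, a x • Matrix.mulVec (D.ρ i x) u = 0 := by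
      simp only [a, mul_smul, ← Finset.smul_sum, ha', smul_zero]
    obtain ⟨n, ⟨y, hy⟩, hfix⟩ := exists_fixed_combination_valuation R hp hP a ha1
      ⟨x₁, by simp [a, hx₁]⟩
    let w : P → ℂ := fun y => ∑ z : P, n z * a (z⁻¹ • y)
    have hw0 : ∑ y, w y • Matrix.mulVec (D.ρ i y) u = 0 := by
      have h1 : ∀ z : P, ∑ y : P, a (z⁻¹ • y) • Matrix.mulVec (D.ρ i y) u = 0 := by
        intro z
        have h2 := congrArg (Matrix.mulVec (D.ρ i z)) ha
        rw [Matrix.mulVec_zero, Matrix.mulVec_sum] at h2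
        rw [← h2]
        refine Fintype.sum_equiv (Equiv.mulLeft z⁻¹) _ _ fun y => ?_
        rw [Matrix.mulVec_smul, Matrix.mulVec_mulVec u, ← map_mul, ← Subgroup.coe_mul,
          Equiv.coe_mulLeft, mul_inv_cancel_left, smul_eq_mul]
      simp only [w, Finset.sum_smul, mul_smul]
      rw [Finset.sum_comm]
      refine Finset.sum_eq_zero fun z _ => ?_
      rw [← Finset.smul_sum, h1, smul_zero]
    have hfix' : ∀ x : P, R.valuation (w y - w x) < 1 := by
      intro x
      have := hfix (y * x⁻¹) x
      rwa [smul_eq_mul, inv_mul_cancel_right] at this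
    have hwy0 : w y ≠ 0 := by
      intro h0
      rw [show ∑ z : P, (n z : ℂ) * a (z⁻¹ • y) = w y from rfl, h0, map_zero] at hy
      exact zero_ne_one hy
    refine hu ⟨fun t => if ht : t * (g * h)⁻¹ ∈ P then (w y)⁻¹ * (w y - w ⟨_, ht⟩) else 0, ?_, ?_⟩
    · intro t
      dsimp only
      split_ifs with ht
      · rw [map_mul, map_inv₀, show R.valuation (w y) = 1 from hy, inv_one, one_mul]
        exact hfix' _
      · simp
    · have h3 : Matrix.mulVec S u = ∑ x : P, ((w y)⁻¹ * (w y - w x)) • Matrix.mulVec (D.ρ i x) u := by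
        have h4 : ∀ x : P, ((w y)⁻¹ * (w y - w x)) • Matrix.mulVec (D.ρ i x) u =
            Matrix.mulVec (D.ρ i x) u - (w y)⁻¹ • w x • Matrix.mulVec (D.ρ i x) u := by
          intro x
          rw [mul_sub, inv_mul_cancel₀ hwy0, sub_smul, one_smul, mul_smul]
        simp only [h4, Finset.sum_sub_distrib, ← Finset.smul_sum, hw0, smul_zero, sub_zero]
        simp only [S, Matrix.sum_mulVec]
      rw [h3]
      refine Finset.sum_of_injOn (fun x : P => (x : G) * (g * h)) ?_ ?_ ?_ ?_
      · intro x _ x' _ hxx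
        exact Subtype.ext (mul_right_cancel hxx)
      · intro x _
        simp
      · intro t _ ht
        dsimp only
        rw [dif_neg, zero_smul]
        intro hmem
        exact ht ⟨⟨_, hmem⟩, by simp, by group⟩
      · intro x _
        have : (x : G) * (g * h) * (g * h)⁻¹ = x := mul_inv_cancel_right _ _
        simp only [this, SetLike.coe_mem, dite_true, u, hmul]
  let b := basisOfLinearIndependentOfCardEqFinrank hli
    (by rw [← Nat.card_eq_fintype_card, hcard, Module.finrank_fin_fun])
  have hb : ∀ x, b x = Matrix.mulVec (D.ρ i x) u := fun x => by
    simp only [b, coe_basisOfLinearIndependentOfCardEqFinrank]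
  rw [IrrData.χ, ← Matrix.trace_toLin'_eq, LinearMap.trace_eq_matrix_trace ℂ b, Matrix.trace]
  refine Finset.sum_eq_zero fun x _ => ?_
  rw [Matrix.diag_apply, LinearMap.toMatrix_apply, Matrix.toLin'_apply, hb, Matrix.mulVec_mulVec,
    ← map_mul, ← Subgroup.coe_mul, ← hb, b.repr_self, Finsupp.single_eq_of_ne]
  simpa using hy

lemma mul_mul_of_trace_eq_one {d : ℕ} {e : Matrix (Fin d) (Fin d) ℂ} (he : e * e = e)
    (ht : e.trace = 1) (A : Matrix (Fin d) (Fin d) ℂ) : e * A * e = (A * e).trace • e := by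
  have h : IsIdempotentElem (Matrix.toLin' e) := by
    rw [IsIdempotentElem, Module.End.mul_eq_comp, ← Matrix.toLin'_mul, he]
  have h1 : Module.finrank ℂ (LinearMap.range (Matrix.toLin' e)) = 1 := by
    have := LinearMap.IsProj.trace (LinearMap.IsIdempotentElem.isProj_range _ h)
    rw [Matrix.trace_toLin'_eq, ht] at this
    exact_mod_cast this.symm
  obtain ⟨⟨u, hu⟩, hu0, hspan⟩ := finrank_eq_one_iff'.1 h1
  have hmem : ∀ x, ∃ c : ℂ, Matrix.mulVec e x = c • u := by
    intro x
    obtain ⟨c, hc⟩ := hspan ⟨Matrix.toLin' e x, LinearMap.mem_range_self _ x⟩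
    exact ⟨c, by simpa using (congrArg Subtype.val hc).symm⟩
  choose c hc using hmem
  have heq : e = Matrix.vecMulVec u fun j => c (Pi.single j 1) := by
    ext i j
    have := congrFun (hc (Pi.single j 1)) i
    rw [Matrix.mulVec_single_one] at this
    simpa [Matrix.vecMulVec_apply, mul_comm] using this
  rw [heq, Matrix.vecMulVec_mul, Matrix.vecMulVec_mul_vecMulVec, Matrix.mul_vecMulVec,
    Matrix.trace_vecMulVec, ← Matrix.dotProduct_mulVec, dotProduct_comm]
  ext i j
  simp [Matrix.vecMulVec_apply, mul_left_comm]

section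

variable {G : Type*} [Group G] [Finite G]

instance fact_prime_2 : Fact (Nat.Prime 2) := ⟨by norm_num⟩

lemma LocalData.card_sylow (L : LocalData G) (P : Sylow 89 G) : Nat.card P = 704969 := by
  have h := P.card_eq_multiplicity
  have h2 : (Nat.card G).factorization 89 = 3 := by
    apply le_antisymm
    · by_contra hcon
      have h4 : 89 ^ 4 ∣ Nat.card G :=
        (Nat.Prime.pow_dvd_iff_le_factorization (by norm_num) Nat.card_pos.ne').2 (by omega)
      rw [L.card] at h4
      revert h4
      decide +kernel
    · rw [← Nat.Prime.pow_dvd_iff_le_factorization (by norm_num) Nat.card_pos.ne', L.card]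
      decide +kernel
  rw [h, h2]
  norm_num

lemma LocalData.index_normalizer (L : LocalData G) (P : Sylow 89 G)
    (hle : 704969 ≤ (Subgroup.normalizer (P : Set G)).index) :
    (Subgroup.normalizer (P : Set G)).index = 704970 := by
  set N := Subgroup.normalizer (P : Set G)
  have h1 : N.index ≡ 1 [MOD 89] := by
    have := card_sylow_modEq_one 89 G
    rwa [P.card_eq_index_normalizer] at this
  have hPN : (P : Subgroup G) ≤ N := Subgroup.le_normalizer
  obtain ⟨k, hk⟩ := Subgroup.card_dvd_of_le hPN
  have hP := L.card_sylow P
  change Nat.card (P : Subgroup G) = _ at hP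
  rw [hP] at hk
  have hmul := Subgroup.card_mul_index N
  rw [hk, L.card, ordU, mul_assoc] at hmul
  have hmul' : k * N.index = 2640 * 704970 := by
    have h3 : 704969 * (k * N.index) = 704969 * (2640 * 704970) := hmul
    omega
  have hk' : k ≤ 2640 := by nlinarith
  have hkmod : k % 89 = 59 := by
    have h2 : k * N.index ≡ k * 1 [MOD 89] := h1.mul_left k
    rw [hmul', mul_one] at h2
    exact h2.symm
  have hcases : k = 504 ∨ k = 2640 := by
    have hdvd : k ∣ 2640 * 704970 := ⟨_, hmul'.symm⟩
    obtain ⟨j, hj, rfl⟩ : ∃ j < 30, k = 89 * j + 59 := ⟨k / 89, by omega, by omega⟩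
    revert hdvd
    have : ∀ j < 30, 89 * j + 59 ∣ 2640 * 704970 → 89 * j + 59 = 504 ∨ 89 * j + 59 = 2640 := by
      decide +kernel
    exact this j hj
  rcases hcases with rfl | rfl
  · exfalso
    obtain ⟨⟨x, hxN⟩, hx⟩ := exists_prime_orderOf_dvd_card' (G := N) 7 (by rw [hk]; norm_num)
    rw [Subgroup.orderOf_mk] at hx
    have := fixedPoints_conj_aux hx (P : Subgroup G) hxN (by rw [L.cent7 x hx, hP]; norm_num)
    rw [hP] at this
    revert this
    decide
  · omega

end

section

variable {G : Type*} [Group G] [Fintype G]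

/-- The group acts with two orbits on pairs of Sylow `89`-subgroups. -/
theorem LocalData.card_orbits (L : LocalData G) (P : Sylow 89 G) :
    (Subgroup.normalizer (P : Set G)).index = 704970 ∧
    Nat.card (MulAction.orbitRel.Quotient (Subgroup.normalizer (P : Set G))
      (G ⧸ Subgroup.normalizer (P : Set G))) = 2 := by
  classical
  obtain ⟨D⟩ := exists_irrData G
  obtain ⟨i₀, i₂, i, h₀, htriv, -, hi, huniq⟩ := L.exists_degrees D
  have hP : Nat.card P = 704969 := L.card_sylow P
  set N := Subgroup.normalizer (P : Set G)
  have hPN : (P : Subgroup G) ≤ N := Subgroup.le_normalizer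
  have hvan : ∀ y : P, y ≠ 1 → D.χ i y = 0 := by
    refine D.χ_eq_zero (p := 89) (P : Subgroup G) P.isPGroup' i (hP.trans hi.symm)
      (c := 2640 * 704970) ?_ (by norm_num)
    rw [hi, ← Nat.card_eq_fintype_card, L.card]
    rfl
  let e := avg ((D.ρ i).comp (P : Subgroup G).subtype) 1
  have hee : e * e = e := avg_mul_avg _ _
  have htr : e.trace = 1 := by
    have : e.trace = (Fintype.card P : ℂ)⁻¹ * ∑ x : P, D.χ i x := by
      simp [e, avg_trace, IrrData.χ]
    have hs : ∑ x : P, D.χ i x = D.χ i (1 : P) :=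
      Fintype.sum_eq_single (1 : P) fun y hy => hvan y hy
    rw [this, hs, OneMemClass.coe_one, D.χ_one, hi, ← Nat.card_eq_fintype_card, hP]
    norm_num
  have hcomm : ∀ n ∈ N, D.ρ i n * e = e * D.ρ i n := by
    intro n hn
    simp only [e, avg, mul_smul_comm, smul_mul_assoc, Finset.mul_sum, Finset.sum_mul]
    congr 1
    let φ := (P : Subgroup G).normalizerMonoidHom ⟨n, hn⟩
    refine Fintype.sum_equiv φ.toEquiv _ _ fun x => ?_
    have : ((φ x : P) : G) = n * x * n⁻¹ := rfl
    simp only [MonoidHom.one_apply, one_smul, MonoidHom.comp_apply, Subgroup.subtype_apply,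
      MulEquiv.toEquiv_eq_coe, EquivLike.coe_coe, ← map_mul]
    rw [this, inv_mul_cancel_right]
  have hscal : ∀ n : N, D.ρ i n * e = (D.ρ i n * e).trace • e := by
    intro n
    rw [← mul_mul_of_trace_eq_one hee htr, ← hcomm n n.2, mul_assoc, hee]
  let μ : N →* ℂ :=
    { toFun := fun n => (D.ρ i n * e).trace
      map_one' := by simp [htr]
      map_mul' := fun a b => by
        conv_lhs => rw [Subgroup.coe_mul, map_mul, mul_assoc, hscal b, mul_smul_comm,
          Matrix.trace_smul, smul_eq_mul, mul_comm] }
  have hμ : ∀ n : N, D.ρ i n * e = μ n • e := hscal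
  have hmi : D.m N.subtype μ i ≠ 0 := by
    intro h0
    have h1 : avg ((D.ρ i).comp N.subtype) μ = 0 :=
      Matrix_eq_zero_of_trace (avg_mul_avg _ _) (by
        rw [mult_eq]; exact_mod_cast h0)
    have h2 : avg ((D.ρ i).comp N.subtype) μ * e = e := by
      rw [avg, smul_mul_assoc, Finset.sum_mul]
      have : ∀ n : N, (μ n⁻¹ • ((D.ρ i).comp N.subtype) n) * e = e := by
        intro n
        rw [smul_mul_assoc, MonoidHom.comp_apply, Subgroup.subtype_apply, hμ, smul_smul, mul_comm,
          char_mul_inv, one_smul]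
      simp only [this, Finset.sum_const, Finset.card_univ]
      rw [← Nat.cast_smul_eq_nsmul ℂ, smul_smul, inv_mul_cancel₀ (by simp), one_smul]
    rw [h1, zero_mul] at h2
    rw [← h2] at htr
    simp at htr
  have hsum : ∑ j, D.d j * D.m N.subtype μ j = N.index := by
    have h1 := D.sum_d_mul_m N.subtype N.subtype_injective μ
    rw [← Nat.card_eq_fintype_card, ← Nat.card_eq_fintype_card, ← N.card_mul_index, mul_comm] at h1
    exact Nat.eq_of_mul_eq_mul_left Nat.card_pos h1
  have hsplit := Finset.add_sum_erase Finset.univ (fun j => D.d j * D.m N.subtype μ j)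
    (Finset.mem_univ i)
  rw [hsum] at hsplit
  simp only [hi] at hsplit
  have hidx : N.index = 704970 := by
    apply L.index_normalizer P
    have : 1 ≤ D.m N.subtype μ i := Nat.one_le_iff_ne_zero.2 hmi
    change _ ≤ N.index
    omega
  rw [hidx] at hsplit
  have hmi1 : D.m N.subtype μ i = 1 := by omega
  rw [hmi1] at hsplit
  have hrest : ∑ j ∈ Finset.univ.erase i, D.d j * D.m N.subtype μ j = 1 := by omega
  obtain ⟨j, hj, hj0⟩ := Finset.exists_ne_zero_of_sum_ne_zero (hrest ▸ one_ne_zero)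
  have hsplit2 := Finset.add_sum_erase (Finset.univ.erase i)
    (fun j => D.d j * D.m N.subtype μ j) hj
  rw [hrest] at hsplit2
  have hj1 : D.d j * D.m N.subtype μ j = 1 := by omega
  have hrest2 : ∑ k ∈ (Finset.univ.erase i).erase j, D.d k * D.m N.subtype μ k = 0 := by omega
  have hjd := huniq j (Nat.eq_one_of_mul_eq_one_right hj1)
  have hjm := Nat.eq_one_of_mul_eq_one_left hj1
  have hzero : ∀ k, k ≠ i → k ≠ j → D.m N.subtype μ k = 0 := by
    intro k hki hkj
    have := Finset.sum_eq_zero_iff.1 hrest2 k (by simp [hki, hkj])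
    exact (Nat.mul_eq_zero.1 this).resolve_left (D.pos k).ne'
  have hμ1 : μ = 1 := by
    ext b
    have h1 := congrArg Matrix.trace (mul_avg ((D.ρ j).comp N.subtype) μ b)
    rw [MonoidHom.comp_apply, hjd, htriv, one_mul, Matrix.trace_smul, ← hjd, mult_eq] at h1
    change (D.m N.subtype μ j : ℂ) = _ • (D.m N.subtype μ j : ℂ) at h1
    rw [hjm] at h1
    simpa using h1.symm
  have hsq : ∑ k, D.m N.subtype μ k * D.m N.subtype μ k = 2 := by
    rw [← Finset.add_sum_erase _ _ (Finset.mem_univ i), ← Finset.add_sum_erase _ _ hj, hmi1, hjm]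
    have : ∑ k ∈ (Finset.univ.erase i).erase j, D.m N.subtype μ k * D.m N.subtype μ k = 0 :=
      Finset.sum_eq_zero fun k hk => by
        simp only [Finset.mem_erase, Finset.mem_univ, and_true] at hk
        rw [hzero k hk.2 hk.1, mul_zero]
    omega
  have hcount := D.sum_m_mul_m N.subtype μ μ
  have hsq' : (∑ k, D.m N.subtype μ k * D.m N.subtype μ k : ℂ) = 2 := by exact_mod_cast hsq
  rw [hsq', hμ1] at hcount
  have hN0 : (Fintype.card N : ℂ) ≠ 0 := by simp
  have hfix : ∀ a : N, ∑ b : N, Nat.card {g // N.subtype a * g * N.subtype b = g} =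
      Fintype.card (MulAction.fixedBy (G ⧸ N) a) * Fintype.card N := by
    intro a
    rw [← Nat.card_eq_fintype_card, ← Nat.card_eq_fintype_card, ← Nat.card_sigma, ← Nat.card_prod]
    have hmem : ∀ g : G, (g : G ⧸ N) ∈ MulAction.fixedBy (G ⧸ N) a ↔ g⁻¹ * (a : G)⁻¹ * g ∈ N := by
      intro g
      rw [MulAction.mem_fixedBy, ← inv_mem_iff (H := N)]
      have : (a • (g : G ⧸ N)) = ((a * g : G) : G ⧸ N) := rfl
      rw [this, eq_comm, QuotientGroup.eq]
      simp [mul_assoc]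
    have hsolve : ∀ g b : G, a * g * b = g → g⁻¹ * (a : G)⁻¹ * g = b := by
      intro g b h
      rw [mul_assoc, inv_mul_eq_iff_eq_mul, inv_mul_eq_iff_eq_mul, ← mul_assoc]
      exact h.symm
    have e₁ : (Σ b : N, {g // N.subtype a * g * N.subtype b = g}) ≃
        (QuotientGroup.mk (s := N) ⁻¹' MulAction.fixedBy (G ⧸ N) a : Set G) :=
      { toFun := fun x => ⟨x.2.1, (hmem _).2 ((hsolve _ _ x.2.2).symm ▸ x.1.2)⟩
        invFun := fun g => ⟨⟨_, (hmem _).1 g.2⟩, ⟨g, by simp [mul_assoc]⟩⟩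
        left_inv := by
          rintro ⟨⟨b, hb⟩, ⟨g, hg⟩⟩
          obtain rfl := hsolve g b hg
          rfl
        right_inv := fun g => rfl }
    rw [Nat.card_congr (e₁.trans (QuotientGroup.preimageMkEquivSubgroupProdSet N _)), Nat.card_prod,
      mul_comm, Nat.card_prod]
  refine ⟨hidx, ?_⟩
  have hburn := MulAction.sum_card_fixedBy_eq_card_orbits_mul_card_group N (G ⧸ N)
  have h5 : (∑ a : N, Fintype.card (MulAction.fixedBy (G ⧸ N) a)) * Fintype.card N =
      2 * Fintype.card N * Fintype.card N := by
    rw [Finset.sum_mul, ← Finset.sum_congr rfl fun a _ => hfix a]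
    field_simp at hcount
    simp only [MonoidHom.one_apply, one_mul, mul_one] at hcount
    have h6 : ((2 * Fintype.card N ^ 2 : ℕ) : ℂ) = ((∑ a : N, ∑ b : N,
      Nat.card {g // N.subtype a * g * N.subtype b = g} : ℕ) : ℂ) := by
      push_cast
      rw [hcount]
    have h7 := Nat.cast_injective h6
    rw [← h7]
    ring
  rw [hburn] at h5
  have hpos : 0 < Fintype.card N := Fintype.card_pos
  rw [Nat.card_eq_fintype_card]
  exact Nat.eq_of_mul_eq_mul_right hpos (Nat.eq_of_mul_eq_mul_right hpos h5)

end

/-- A doubly transitive action in which the Sylow `89`-subgroup `P` fixes the point `pt` and is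
regular on the remaining points. -/
structure Frame (G Ω : Type*) [Group G] [MulAction G Ω] where
  /-- the Sylow subgroup -/
  P : Subgroup G
  /-- the point fixed by `P` -/
  pt : Ω
  /-- a second point -/
  o : Ω
  card : Nat.card G = ordU
  cardP : Nat.card P = 704969
  o_ne : o ≠ pt
  faithful : ∀ g : G, (∀ x : Ω, g • x = x) → g = 1
  smul_pt : ∀ p ∈ P, p • pt = pt
  conj_mem : ∀ g : G, g • pt = pt → ∀ p ∈ P, g * p * g⁻¹ ∈ P
  free : ∀ p ∈ P, p • o = o → p = 1
  trans : ∀ x, x ≠ pt → ∃ p ∈ P, p • o = x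
  swap : ∃ t : G, t • pt = o ∧ t • o = pt

section

variable {G : Type*} [Group G] [Finite G]

theorem LocalData.exists_frame (L : LocalData G) : ∃ P : Subgroup G,
    ∃ F : Frame G (G ⧸ Subgroup.normalizer (P : Set G)), F.P = P := by
  classical
  have := Fintype.ofFinite G
  let P : Sylow 89 G := default
  obtain ⟨hidx, horb⟩ := L.card_orbits P
  have hP : Nat.card (P : Subgroup G) = 704969 := L.card_sylow P
  have hPN : (P : Subgroup G) ≤ Subgroup.normalizer (P : Set G) := Subgroup.le_normalizer
  refine ⟨P, ?_⟩
  set N := Subgroup.normalizer (P : Set G) with hNdef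
  let pt : G ⧸ N := QuotientGroup.mk 1
  have hstab : ∀ g : G, g • pt = pt ↔ g ∈ N := by
    intro g
    change QuotientGroup.mk (g * 1) = (QuotientGroup.mk 1 : G ⧸ N) ↔ _
    rw [eq_comm, QuotientGroup.eq]
    simp
  have hcardN : Nat.card N = 704969 * 2640 := by
    have h1 := N.card_mul_index
    rw [hidx, L.card] at h1
    refine Nat.eq_of_mul_eq_mul_right (show 0 < 704970 by norm_num) (h1.trans ?_)
    rfl
  have hcardΩ : Nat.card (G ⧸ N) = 704970 := hidx
  have htr : ∀ x y : G ⧸ N, x ≠ pt → y ≠ pt → ∃ n ∈ N, n • x = y := by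
    intro x y hx hy
    obtain ⟨ω, -, hω⟩ := (Nat.card_eq_two_iff' (Quotient.mk
      (MulAction.orbitRel N (G ⧸ N)) pt)).1 horb
    have hne : ∀ z : G ⧸ N, z ≠ pt → Quotient.mk (MulAction.orbitRel N (G ⧸ N)) z ≠
        Quotient.mk (MulAction.orbitRel N (G ⧸ N)) pt := by
      intro z hz h
      obtain ⟨n, hn⟩ := Quotient.exact h
      exact hz (hn.symm.trans ((hstab n).2 n.2))
    have hxy := (hω _ (hne y hy)).trans (hω _ (hne x hx)).symm
    obtain ⟨n, hn⟩ := Quotient.exact hxy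
    exact ⟨n, n.2, hn⟩
  have hcard1 : Nat.card {x : G ⧸ N // x ≠ pt} = 704969 := by
    have h1 : ({pt} : Set (G ⧸ N)).ncard + ({pt}ᶜ : Set (G ⧸ N)).ncard = _ :=
      Set.ncard_add_ncard_compl _
    rw [Set.ncard_singleton, hcardΩ] at h1
    have h2 : Nat.card {x : G ⧸ N // x ≠ pt} = ({pt}ᶜ : Set (G ⧸ N)).ncard := rfl
    omega
  obtain ⟨⟨o, ho⟩⟩ : Nonempty {x : G ⧸ N // x ≠ pt} := by
    by_contra h
    rw [not_nonempty_iff] at h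
    rw [Nat.card_of_isEmpty] at hcard1
    omega
  have hstabo : Nat.card (MulAction.stabilizer N o) = 2640 := by
    have h1 := MulAction.card_orbit_mul_card_stabilizer_eq_card_group N o
    have h2 : MulAction.orbit N o = {x | x ≠ pt} := by
      ext x
      constructor
      · rintro ⟨n, rfl⟩ h
        apply ho
        have h3 : (n : G)⁻¹ • (n • o) = o := inv_smul_smul n o
        rw [← h3]
        change (n : G)⁻¹ • (n • o) = pt
        rw [show n • o = pt from h]
        exact (hstab _).2 (N.inv_mem n.2)
      · intro hx
        obtain ⟨n, hn, h⟩ := htr o x ho hx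
        exact ⟨⟨n, hn⟩, h⟩
    simp only [← Nat.card_eq_fintype_card] at h1
    rw [h2, hcardN] at h1
    have h3 : Nat.card ({x | x ≠ pt} : Set (G ⧸ N)) = 704969 := hcard1
    rw [h3] at h1
    exact Nat.eq_of_mul_eq_mul_left (by norm_num) h1
  have hfree : ∀ p ∈ (P : Subgroup G), p • o = o → p = 1 := by
    intro p hp hpo
    have h1 : orderOf p ∣ 704969 := by
      have := orderOf_dvd_natCard (⟨p, hp⟩ : (P : Subgroup G))
      rwa [hP, Subgroup.orderOf_mk] at this
    have h2 : orderOf p ∣ 2640 := by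
      have := orderOf_dvd_natCard (⟨⟨p, hPN hp⟩, hpo⟩ : MulAction.stabilizer N o)
      rwa [hstabo, ← Subgroup.orderOf_coe, ← Subgroup.orderOf_coe] at this
    have h3 := Nat.dvd_gcd h1 h2
    rw [show Nat.gcd 704969 2640 = 1 by norm_num] at h3
    exact orderOf_eq_one_iff.1 (Nat.dvd_one.1 h3)
  have htransP : ∀ x, x ≠ pt → ∃ p ∈ (P : Subgroup G), p • o = x := by
    intro x hx
    let φ : ↥(P : Subgroup G) → {x : G ⧸ N // x ≠ pt} := fun p => ⟨p.1 • o, fun h => by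
      have h3 : p.1⁻¹ • (p.1 • o) = o := inv_smul_smul p.1 o
      rw [h, (hstab _).2 (N.inv_mem (hPN p.2))] at h3
      exact ho h3.symm⟩
    have hinj : Function.Injective φ := by
      intro a b hab
      have h4 : a.1 • o = b.1 • o := congrArg Subtype.val hab
      have h5 := hfree (b⁻¹ * a).1 (b⁻¹ * a).2 (by
        rw [Subgroup.coe_mul, Subgroup.coe_inv, mul_smul, h4, inv_smul_smul])
      exact (inv_mul_eq_one.1 (Subtype.ext h5 : b⁻¹ * a = 1)).symm
    have hbij := (Nat.bijective_iff_injective_and_card φ).2 ⟨hinj, by rw [hP, hcard1]⟩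
    obtain ⟨p, hp⟩ := hbij.2 ⟨x, hx⟩
    exact ⟨p, p.2, congrArg Subtype.val hp⟩
  have hswap : ∃ t : G, t • pt = o ∧ t • o = pt := by
    obtain ⟨g, hg⟩ : ∃ g : G, g • pt = o := by
      induction o using QuotientGroup.induction_on with
      | H g => exact ⟨g, by change QuotientGroup.mk (g * 1) = _; rw [mul_one]⟩
    have h1 : g⁻¹ • pt ≠ pt := by
      intro h
      apply ho
      rw [← hg]
      conv_lhs => rw [← h]
      rw [smul_inv_smul]
    obtain ⟨n, hn, h⟩ := htr o _ ho h1
    refine ⟨g * n, ?_, ?_⟩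
    · rw [mul_smul, (hstab n).2 hn, hg]
    · rw [mul_smul, h, smul_inv_smul]
  have hconj : ∀ g : G, g • pt = pt → ∀ p ∈ (P : Subgroup G), g * p * g⁻¹ ∈ (P : Subgroup G) :=
    fun g hg p hp => (Subgroup.mem_normalizer_iff.1 ((hstab g).1 hg) p).1 hp
  refine ⟨⟨P, pt, o, L.card, hP, ho, ?_, fun p hp => (hstab p).2 (hPN hp), hconj, hfree, htransP,
    hswap⟩, rfl⟩
  let M : Subgroup G := (MulAction.toPermHom G (G ⧸ N)).ker
  have hM : ∀ g, g ∈ M ↔ ∀ x : G ⧸ N, g • x = x := by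
    intro g
    rw [MonoidHom.mem_ker, Equiv.ext_iff]
    rfl
  have hMdvd : Nat.card M ∣ 2640 := by
    rw [← hstabo]
    refine Subgroup.card_dvd_of_injective
      (⟨⟨fun m => ⟨⟨m.1, (hstab _).1 ((hM _).1 m.2 _)⟩, (hM _).1 m.2 _⟩, rfl⟩, fun _ _ => rfl⟩ :
        M →* MulAction.stabilizer N o) ?_
    intro a b hab
    exact Subtype.ext (congrArg (fun x : MulAction.stabilizer N o => ((x : N) : G)) hab)
  obtain ⟨s, hs⟩ := L.exists_373
  have hmod := L.modEq_of_normalizes hs M (by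
    rw [Subgroup.normalizer_eq_top]; trivial) (Nat.Coprime.coprime_dvd_left hMdvd (by norm_num))
  have hM1 : Nat.card M = 1 := by
    obtain ⟨j, hj⟩ : ∃ j, Nat.card M = 373 * j + 1 := ⟨Nat.card M / 373, by
      have : Nat.card M % 373 = 1 := hmod
      omega⟩
    have hle := Nat.le_of_dvd (by norm_num) hMdvd
    rw [hj] at hMdvd hle ⊢
    have hj8 : j < 8 := by omega
    interval_cases j <;> revert hMdvd <;> decide
  intro g hg
  have := Subgroup.card_eq_one.1 hM1
  have hgM := (hM g).2 hg
  rw [this] at hgM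
  exact hgM

end

section

variable {G : Type*} [Group G] [Fintype G] (D : IrrData G)

lemma IrrData.sum_sq_eq {A : Type*} [AddCommGroup A] [Fintype A] (f : Multiplicative A →* G)
    (i : Fin D.n) : ∃ m : AddChar A ℂ → ℕ, D.d i = ∑ ψ, m ψ ∧
      ∑ a : A, D.χ i (f (.ofAdd a)) * D.χ i (f (.ofAdd a))⁻¹ = Fintype.card A * ∑ ψ, m ψ ^ 2 := by
  classical
  have h := trace_eq_sum_mult ((D.ρ i).comp f)
  have hχ : ∀ a, D.χ i (f (.ofAdd a)) =
      ∑ ψ : AddChar A ℂ, mult ((D.ρ i).comp f) ψ.toMonoidHom * ψ a := h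
  refine ⟨fun ψ => mult ((D.ρ i).comp f) ψ.toMonoidHom, ?_, ?_⟩
  · have := hχ 0
    rw [ofAdd_zero, map_one, D.χ_one] at this
    simp only [AddChar.map_zero_eq_one, mul_one] at this
    exact_mod_cast this
  · have h2 : ∀ a, D.χ i (f (.ofAdd a))⁻¹ =
        ∑ ψ : AddChar A ℂ, mult ((D.ρ i).comp f) ψ.toMonoidHom * ψ (-a) := by
      intro a
      rw [← map_inv, ← ofAdd_neg, hχ]
    simp only [hχ, h2, Finset.sum_mul_sum]
    rw [Finset.sum_comm]
    push_cast
    rw [Finset.mul_sum]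
    refine Finset.sum_congr rfl fun ψ _ => ?_
    rw [Finset.sum_comm, Finset.sum_eq_single ψ]
    · have : ∀ a, (mult ((D.ρ i).comp f) ψ.toMonoidHom * ψ a *
          (mult ((D.ρ i).comp f) ψ.toMonoidHom * ψ (-a)) : ℂ) =
          mult ((D.ρ i).comp f) ψ.toMonoidHom ^ 2 := by
        intro a
        have : ψ a * ψ (-a) = 1 := by rw [← AddChar.map_add_eq_mul, add_neg_cancel,
          AddChar.map_zero_eq_one]
        linear_combination (mult ((D.ρ i).comp f) ψ.toMonoidHom : ℂ) ^ 2 * this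
      simp [this]
    · intro φ _ hφ
      have h3 : ∑ a, (ψ - φ) a = 0 := by
        rw [AddChar.sum_eq_ite, if_neg (sub_ne_zero.2 hφ.symm)]
      have : ∀ a, (mult ((D.ρ i).comp f) ψ.toMonoidHom * ψ a *
          (mult ((D.ρ i).comp f) φ.toMonoidHom * φ (-a)) : ℂ) =
          mult ((D.ρ i).comp f) ψ.toMonoidHom * mult ((D.ρ i).comp f) φ.toMonoidHom *
            (ψ - φ) a := by
        intro a
        rw [AddChar.sub_apply]
        ring
      simp only [this, ← Finset.mul_sum, h3, mul_zero]
    · simp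

lemma IrrData.card_mul_d_le (P : Subgroup G) [Fintype P] (hP : ∀ x ∈ P, ∀ y ∈ P, x * y = y * x)
    (i : Fin D.n) : (Fintype.card P * D.d i : ℝ) ≤ ∑ x : P, Complex.normSq (D.χ i x) := by
  let _ : CommGroup P := { (inferInstance : Group P) with
    mul_comm := fun x y => Subtype.ext (hP x x.2 y y.2) }
  obtain ⟨m, hm, hs⟩ := D.sum_sq_eq (A := Additive P)
    (P.subtype.comp (MulEquiv.multiplicativeAdditive P).toMonoidHom) i
  have h1 : ∑ x : P, Complex.normSq (D.χ i x) = Fintype.card P * ∑ ψ, (m ψ : ℝ) ^ 2 := by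
    apply Complex.ofReal_injective
    push_cast
    have h2 : ∑ x : P, ((Complex.normSq (D.χ i x) : ℝ) : ℂ) =
      ∑ x : P, D.χ i x * D.χ i (x : G)⁻¹ := by
      refine Finset.sum_congr rfl fun x _ => ?_
      rw [D.χ_inv, Complex.mul_conj]
    rw [h2]
    push_cast at hs
    rw [Fintype.card_congr (Additive.ofMul (α := P)), ← hs]
    exact Fintype.sum_equiv Additive.ofMul _ _ fun x => rfl
  rw [h1, hm]
  push_cast
  refine mul_le_mul_of_nonneg_left (Finset.sum_le_sum fun ψ _ => ?_) (by positivity)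
  exact_mod_cast Nat.le_self_pow two_ne_zero _

lemma IrrData.sum_normSq (i : Fin D.n) : ∑ g, Complex.normSq (D.χ i g) = Fintype.card G := by
  apply Complex.ofReal_injective
  have := D.row i
  push_cast
  rw [← this]
  refine Finset.sum_congr rfl fun x _ => ?_
  rw [D.χ_inv, Complex.mul_conj]

end

section

variable {G Ω : Type*} [Group G] [MulAction G Ω] (F : Frame G Ω)

lemma Frame.eq_pt {p : G} (hp : p ∈ F.P) (hp1 : p ≠ 1) {x : Ω} (hx : p • x = x) : x = F.pt := by
  by_contra h
  obtain ⟨r, hr, rfl⟩ := F.trans x h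
  apply hp1
  have := F.free (r⁻¹ * p * r) (F.P.mul_mem (F.P.mul_mem (F.P.inv_mem hr) hp) hr) (by
    rw [mul_smul, mul_smul, hx, inv_smul_smul])
  have h2 : p = r * (r⁻¹ * p * r) * r⁻¹ := by group
  rw [h2, this, mul_one, mul_inv_cancel]

lemma Frame.exists_smul_pt (x : Ω) : ∃ g : G, g • F.pt = x := by
  by_cases h : x = F.pt
  · exact ⟨1, by rw [h, one_smul]⟩
  · obtain ⟨p, -, rfl⟩ := F.trans x h
    obtain ⟨t, ht, -⟩ := F.swap
    exact ⟨p * t, by rw [mul_smul, ht]⟩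

lemma Frame.eq_of_smul_o {p r : G} (hp : p ∈ F.P) (hr : r ∈ F.P) (h : p • F.o = r • F.o) :
    p = r := by
  have := F.free (r⁻¹ * p) (F.P.mul_mem (F.P.inv_mem hr) hp) (by rw [mul_smul, h, inv_smul_smul])
  exact (inv_mul_eq_one.1 this).symm

lemma Frame.smul_o_ne {p : G} (hp : p ∈ F.P) : p • F.o ≠ F.pt := by
  intro h
  apply F.o_ne
  rw [← F.smul_pt p hp] at h
  exact smul_left_cancel _ h

/-- The points as `P` together with a point at infinity. -/
noncomputable def Frame.equivOption : Option F.P ≃ Ω :=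
  Equiv.ofBijective (fun x => x.elim F.pt fun p => (p : G) • F.o) (by
    constructor
    · rintro (_ | ⟨p, hp⟩) (_ | ⟨r, hr⟩) h
      · rfl
      · exact absurd h.symm (F.smul_o_ne hr)
      · exact absurd h (F.smul_o_ne hp)
      · exact congrArg some (Subtype.ext (F.eq_of_smul_o hp hr h))
    · intro x
      by_cases h : x = F.pt
      · exact ⟨none, h.symm⟩
      · obtain ⟨p, hp, h⟩ := F.trans x h
        exact ⟨some ⟨p, hp⟩, h⟩)

lemma Frame.finite_P (F : Frame G Ω) : Finite F.P :=
  Nat.finite_of_card_ne_zero (by rw [F.cardP]; norm_num)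

lemma Frame.card_points (F : Frame G Ω) : Nat.card Ω = 704970 := by
  have := F.finite_P
  rw [← Nat.card_congr F.equivOption, Finite.card_option, F.cardP]

lemma Frame.not_comm [Finite G] (F : Frame G Ω) (L : LocalData G) :
    ∃ x ∈ F.P, ∃ y ∈ F.P, x * y ≠ y * x := by
  classical
  by_contra! hcomm
  have := Fintype.ofFinite G
  have : Finite Ω := Nat.finite_of_card_ne_zero (by rw [F.card_points]; norm_num)
  have := Fintype.ofFinite Ω
  obtain ⟨D⟩ := exists_irrData G
  obtain ⟨-, i, -, -, -, hi, -⟩ := L.exists_degrees D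
  have h1 := D.card_mul_d_le F.P hcomm i
  have h2 := D.sum_normSq i
  rw [← Nat.card_eq_fintype_card, F.cardP, hi] at h1
  rw [← Nat.card_eq_fintype_card, F.card] at h2
  choose g hg using F.exists_smul_pt
  let φ : Ω × {x : F.P // x ≠ 1} → G := fun y => g y.1 * y.2.1 * (g y.1)⁻¹
  have hφ : Function.Injective φ := by
    rintro ⟨a, ⟨x, hx⟩, hx1⟩ ⟨b, ⟨y, hy⟩, hy1⟩ h
    have h3 : g a * x * (g a)⁻¹ = g b * y * (g b)⁻¹ := h
    have h4 : (g a * x * (g a)⁻¹) • a = a := by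
      rw [mul_smul, inv_smul_eq_iff.2 (hg a).symm, mul_smul, F.smul_pt x hx, hg]
    rw [h3, mul_smul, mul_smul, smul_eq_iff_eq_inv_smul] at h4
    have h5 := F.eq_pt hy (fun h => hy1 (Subtype.ext h)) h4
    rw [inv_smul_eq_iff, hg] at h5
    subst h5
    have h6 : x = y := mul_left_cancel (mul_right_cancel h3)
    subst h6
    rfl
  have hle : ∑ y, Complex.normSq (D.χ i (φ y)) ≤ ∑ g, Complex.normSq (D.χ i g) := by
    refine (Finset.sum_map Finset.univ ⟨φ, hφ⟩ fun g => Complex.normSq (D.χ i g)).symm.trans_le ?_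
    exact Finset.sum_le_sum_of_subset_of_nonneg (Finset.subset_univ _) fun _ _ _ =>
      Complex.normSq_nonneg _
  have h3 : ∀ y, D.χ i (φ y) = D.χ i y.2.1 := by
    intro y
    rw [D.χ_mul_comm, inv_mul_cancel_left]
  have h4 : ∑ y, Complex.normSq (D.χ i (φ y)) =
      704970 * ∑ x : {x : F.P // x ≠ 1}, Complex.normSq (D.χ i x.1) := by
    simp only [h3]
    rw [Fintype.sum_prod_type]
    dsimp only
    rw [Finset.sum_const, Finset.card_univ, ← Nat.card_eq_fintype_card,
      F.card_points, nsmul_eq_mul]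
    norm_num
  have h5 : ∑ x : F.P, Complex.normSq (D.χ i x) = 7832 ^ 2 +
      ∑ x : {x : F.P // x ≠ 1}, Complex.normSq (D.χ i x.1) := by
    have h6 := Fintype.sum_eq_add_sum_subtype_ne (fun x : F.P => Complex.normSq (D.χ i x)) 1
    rw [h6, OneMemClass.coe_one, D.χ_one, hi, ← Complex.ofReal_natCast, Complex.normSq_ofReal]
    norm_num
  rw [h4, h2] at hle
  rw [h5] at h1
  norm_num [ordU] at hle h1
  linarith

end

section

variable {P : Type*} [Group P]

lemma finite_of_card_eq (hP : Nat.card P = 704969) : Finite P :=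
  Nat.finite_of_card_ne_zero (by rw [hP]; norm_num)

lemma card_subgroup_cases (hP : Nat.card P = 704969) (H : Subgroup P) :
    Nat.card H = 1 ∨ Nat.card H = 89 ∨ Nat.card H = 89 ^ 2 ∨ Nat.card H = 89 ^ 3 := by
  have h := H.card_subgroup_dvd_card
  rw [hP, show (704969 : ℕ) = 89 ^ 3 by norm_num, Nat.dvd_prime_pow (by norm_num)] at h
  obtain ⟨k, hk, h⟩ := h
  interval_cases k <;> simp [h]

lemma card_center (hP : Nat.card P = 704969) (hnc : ∃ x y : P, x * y ≠ y * x) :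
    Nat.card (Subgroup.center P) = 89 := by
  have := finite_of_card_eq hP
  obtain ⟨x, y, hxy⟩ := hnc
  have hpg : IsPGroup 89 P := IsPGroup.of_card (n := 3) (by rw [hP]; norm_num)
  have : Nontrivial P := by
    rw [← Finite.one_lt_card_iff_nontrivial, hP]; norm_num
  have hnt := hpg.center_nontrivial
  have hidx := (Subgroup.center P).card_mul_index
  rw [hP] at hidx
  have key : ¬ IsCyclic (P ⧸ Subgroup.center P) := fun h =>
    hxy ((MonoidHom.isMulCommutative_of_isCyclic_of_ker_le_center
      (QuotientGroup.mk' (Subgroup.center P)) (by rw [QuotientGroup.ker_mk'])).is_comm.comm x y)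
  rcases card_subgroup_cases hP (Subgroup.center P) with h | h | h | h
  · rw [← Finite.one_lt_card_iff_nontrivial, h] at hnt
    omega
  · exact h
  · refine absurd (isCyclic_of_prime_card (p := 89) ?_) key
    rw [h] at hidx
    rw [← Subgroup.index_eq_card]
    omega
  · have h1 : Subgroup.center P = ⊤ := Subgroup.eq_top_of_card_eq _ (by rw [h, hP]; norm_num)
    exact absurd ((Subgroup.mem_center_iff.1 (h1 ▸ Subgroup.mem_top y)) x) hxy

variable (hP : Nat.card P = 704969) (hnc : ∃ x y : P, x * y ≠ y * x)

lemma quotient_comm (hP : Nat.card P = 704969) (hnc : ∃ x y : P, x * y ≠ y * x)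
    (x y : P ⧸ Subgroup.center P) : x * y = y * x := by
  have hidx := (Subgroup.center P).card_mul_index
  rw [hP, card_center hP hnc] at hidx
  refine (IsPGroup.isMulCommutative_of_card_eq_prime_sq (p := 89) ?_).is_comm.comm x y
  rw [← Subgroup.index_eq_card]
  omega

lemma exists_mul_comm_eq (hP : Nat.card P = 704969) (hnc : ∃ x y : P, x * y ≠ y * x) (x y : P) :
    ∃ c ∈ Subgroup.center P, x * y = y * x * c := by
  refine ⟨(y * x)⁻¹ * (x * y), ?_, by group⟩
  rw [← QuotientGroup.eq, QuotientGroup.mk_mul, QuotientGroup.mk_mul]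
  exact quotient_comm hP hnc _ _

lemma pow_mem_center (hP : Nat.card P = 704969) (hnc : ∃ x y : P, x * y ≠ y * x) (x : P) :
    x ^ 89 ∈ Subgroup.center P := by
  have := finite_of_card_eq hP
  have hidx := (Subgroup.center P).card_mul_index
  rw [hP, card_center hP hnc] at hidx
  have hc : Nat.card (P ⧸ Subgroup.center P) = 89 ^ 2 := by
    rw [← Subgroup.index_eq_card]
    omega
  rw [← QuotientGroup.eq_one_iff, QuotientGroup.mk_pow]
  have h1 := orderOf_dvd_natCard (x : P ⧸ Subgroup.center P)
  rw [hc, Nat.dvd_prime_pow (by norm_num)] at h1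
  obtain ⟨k, hk, h⟩ := h1
  by_cases hk2 : k = 2
  · exfalso
    obtain ⟨a, b, hab⟩ := hnc
    have : IsCyclic (P ⧸ Subgroup.center P) :=
      isCyclic_of_orderOf_eq_card (x : P ⧸ Subgroup.center P) (by rw [h, hc, hk2])
    exact hab ((MonoidHom.isMulCommutative_of_isCyclic_of_ker_le_center
      (QuotientGroup.mk' (Subgroup.center P)) (by rw [QuotientGroup.ker_mk'])).is_comm.comm a b)
  · apply orderOf_dvd_iff_pow_eq_one.1
    rw [h]
    exact pow_dvd_pow 89 (by omega : k ≤ 1)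

lemma center_pow (hP : Nat.card P = 704969) (hnc : ∃ x y : P, x * y ≠ y * x) {c : P}
    (hc : c ∈ Subgroup.center P) : c ^ 89 = 1 := by
  have h := pow_card_eq_one' (x := (⟨c, hc⟩ : Subgroup.center P))
  rw [card_center hP hnc] at h
  exact congrArg Subtype.val h

lemma eq_pow_mul_of_commute (hP : Nat.card P = 704969) (hnc : ∃ x y : P, x * y ≠ y * x) {a b : P}
    (ha : a ∉ Subgroup.center P) (hab : b * a = a * b) :
    ∃ k : ℤ, ∃ d ∈ Subgroup.center P, b = a ^ k * d := by
  have := finite_of_card_eq hP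
  set W := Subgroup.zpowers a ⊔ Subgroup.center P with hW
  set C := Subgroup.centralizer {a} with hC
  have hWC : W ≤ C := by
    refine sup_le ?_ (Subgroup.center_le_centralizer _)
    rw [Subgroup.zpowers_le, hC, Subgroup.mem_centralizer_singleton_iff]
  have haW : a ∈ W := Subgroup.mem_sup_left (Subgroup.mem_zpowers a)
  have h1 : Nat.card C ≠ 89 ^ 3 := by
    intro h
    have h2 : C = ⊤ := Subgroup.eq_top_of_card_eq _ (by rw [h, hP]; norm_num)
    apply ha
    rw [Subgroup.mem_center_iff]
    intro g
    have : g ∈ C := h2 ▸ Subgroup.mem_top g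
    rwa [hC, Subgroup.mem_centralizer_singleton_iff] at this
  have h2 : 89 < Nat.card W := by
    rw [← card_center hP hnc]
    refine lt_of_le_of_ne (Subgroup.card_le_of_le le_sup_right) fun h => ha ?_
    rw [Subgroup.eq_of_le_of_card_ge (le_sup_right : Subgroup.center P ≤ W) h.ge]
    exact haW
  have h3 : W = C := by
    refine Subgroup.eq_of_le_of_card_ge hWC ?_
    rcases card_subgroup_cases hP W with h | h | h | h <;>
      rcases card_subgroup_cases hP C with h' | h' | h' | h' <;> omega
  have hb : b ∈ W := by
    rw [h3, hC, Subgroup.mem_centralizer_singleton_iff]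
    exact hab
  obtain ⟨x, hx, d, hd, rfl⟩ := Subgroup.mem_sup_of_normal_right.1 hb
  obtain ⟨k, rfl⟩ := hx
  exact ⟨k, d, hd, rfl⟩

/-- A `89'`-automorphism trivial on the centre and modulo the centre is trivial. -/
lemma aut_eq_one (hP : Nat.card P = 704969) (hnc : ∃ x y : P, x * y ≠ y * x) {σ : MulAut P} {n : ℕ}
    (hn : Nat.Coprime n 89) (hσ : σ ^ n = 1) (hZ : ∀ c ∈ Subgroup.center P, σ c = c)
    (hV : ∀ x, ∃ d ∈ Subgroup.center P, σ x = x * d) : σ = 1 := by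
  ext x
  obtain ⟨d, hd, h⟩ := hV x
  have hk : ∀ k : ℕ, (σ ^ k) x = x * d ^ k := by
    intro k
    induction k with
    | zero => simp
    | succ k ih =>
      rw [pow_succ', MulAut.mul_apply, ih, map_mul, h, map_pow, hZ d hd, pow_succ', mul_assoc]
  have h1 := hk n
  rw [hσ, MulAut.one_apply, left_eq_mul] at h1
  have h2 : orderOf d ∣ Nat.gcd n 89 :=
    Nat.dvd_gcd (orderOf_dvd_of_pow_eq_one h1) (orderOf_dvd_of_pow_eq_one (center_pow hP hnc hd))
  rw [hn, Nat.dvd_one, orderOf_eq_one_iff] at h2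
  rw [h, h2, mul_one, MulAut.one_apply]

lemma eq_one_of_mul_self (hP : Nat.card P = 704969) {c : P} (h : c * c = 1) : c = 1 := by
  have h1 : orderOf c ∣ Nat.gcd 2 (Nat.card P) :=
    Nat.dvd_gcd (orderOf_dvd_of_pow_eq_one (by rw [pow_two, h])) (orderOf_dvd_natCard c)
  rw [hP] at h1
  simpa using h1

lemma mem_center_of_mul_self (hP : Nat.card P = 704969) {c : P}
    (h : c * c ∈ Subgroup.center P) : c ∈ Subgroup.center P := by
  have h1 : c ^ 704969 = 1 := by rw [← hP]; exact pow_card_eq_one'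
  have h2 : c = ((c * c) ^ 352484)⁻¹ := by
    rw [eq_comm, inv_eq_iff_mul_eq_one, ← pow_two, ← pow_mul, ← pow_succ, h1]
  rw [h2]
  exact inv_mem (pow_mem h _)

/-- An involution trivial on the centre inverts `P` modulo the centre. -/
lemma mul_mem_center (hP : Nat.card P = 704969) (hnc : ∃ x y : P, x * y ≠ y * x) {z : MulAut P}
    (hz1 : z ≠ 1) (hz : z ^ 2 = 1) (hZ : ∀ c ∈ Subgroup.center P, z c = c) (x : P) :
    x * z x ∈ Subgroup.center P := by
  have hzz : ∀ x, z (z x) = x := fun x => by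
    rw [← MulAut.mul_apply, ← pow_two, hz, MulAut.one_apply]
  by_contra hx
  obtain ⟨c, hc, hcx⟩ := exists_mul_comm_eq hP hnc (z x) x
  have ha : z (x * z x) = x * z x * c := by rw [map_mul, hzz, hcx]
  refine hz1 (aut_eq_one hP hnc (n := 2) (by norm_num) hz hZ fun y => ?_)
  set a := x * z x with hadef
  set b := y⁻¹ * z y with hb
  have hzb : z b = b⁻¹ := by
    rw [hb, map_mul, hzz, map_inv, mul_inv_rev, inv_inv]
  refine ⟨b, ?_, by rw [hb]; group⟩
  obtain ⟨f, hf, hab⟩ := exists_mul_comm_eq hP hnc a b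
  have hc' := Subgroup.mem_center_iff.1 hc
  have hf' := Subgroup.mem_center_iff.1 hf
  have h1 : a * b⁻¹ = b⁻¹ * a * f := by
    have h := congrArg z hab
    rw [map_mul z a, map_mul z (b * a), map_mul z b, ha, hzb, hZ f hf, mul_assoc a, ← hc',
      ← mul_assoc, ← mul_assoc,
      mul_assoc _ c f, ← hc', ← mul_assoc] at h
    rw [mul_right_cancel h]
  have hf1 : f = 1 := by
    apply eq_one_of_mul_self hP
    have h2 : a = b⁻¹ * a * b * f⁻¹ := by
      rw [mul_assoc b⁻¹, hab]; group
    have h3 : a = b⁻¹ * a * b * f := by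
      rw [mul_assoc _ b, hf', ← mul_assoc, ← h1]; group
    have h4 := h2.symm.trans h3
    rw [mul_right_inj] at h4
    nth_rewrite 1 [← h4]
    simp
  rw [hf1, mul_one] at hab
  obtain ⟨k, d, hd, hbk⟩ := eq_pow_mul_of_commute hP hnc hx hab.symm
  have h5 : z b = b * c ^ k := by
    have hac : Commute a c := hc' a
    rw [hbk, map_mul, hZ d hd, map_zpow, ha, hac.mul_zpow, mul_assoc, mul_assoc]
    congr 1
    exact Subgroup.mem_center_iff.1 hd _
  apply mem_center_of_mul_self hP
  rw [hzb] at h5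
  have h6 : b * b = (c ^ k)⁻¹ := by
    rw [eq_inv_iff_mul_eq_one, mul_assoc, ← h5, mul_inv_cancel]
  rw [h6]
  exact inv_mem (zpow_mem hc k)

/-- Every coset of the centre contains an element inverted by `z`. -/
lemma exists_inverted (hP : Nat.card P = 704969) (hnc : ∃ x y : P, x * y ≠ y * x) {z : MulAut P}
    (hz1 : z ≠ 1) (hz : z ^ 2 = 1) (hZ : ∀ c ∈ Subgroup.center P, z c = c) (x : P) :
    ∃ d ∈ Subgroup.center P, z (x * d) = (x * d)⁻¹ := by
  have h := mul_mem_center hP hnc hz1 hz hZ x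
  set c := x * z x with hc
  have h1 := center_pow hP hnc h
  have hd := pow_mem h 44
  refine ⟨c ^ 44, hd, ?_⟩
  have h2 : z x = x⁻¹ * c := by rw [hc]; group
  rw [map_mul, hZ _ hd, h2, mul_inv_rev, mul_assoc, ← Subgroup.mem_center_iff.1 (inv_mem hd)]
  congr 1
  rw [eq_inv_iff_mul_eq_one, ← pow_succ', ← pow_add, h1]

/-- The elements inverted by `z` have exponent `89`. -/
lemma pow_eq_one_of_inverted (hP : Nat.card P = 704969) (hnc : ∃ x y : P, x * y ≠ y * x)
    {z : MulAut P} (hZ : ∀ c ∈ Subgroup.center P, z c = c) {x : P} (hx : z x = x⁻¹) :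
    x ^ 89 = 1 := by
  apply eq_one_of_mul_self hP
  have h := hZ _ (pow_mem_center hP hnc x)
  rw [map_pow, hx, inv_pow] at h
  nth_rewrite 1 [← h]
  simp

end

/-- The field with `89` elements. -/
abbrev F89 := ZMod 89

/-- The field with `89 ^ 2` elements. -/
abbrev E89 := QuadraticAlgebra (ZMod 89) 3 0

instance fact_nonresidue : Fact (∀ r : ZMod 89, r ^ 2 ≠ 3 + 0 * r) := ⟨by decide +kernel⟩

attribute [simp] QuadraticAlgebra.re_one QuadraticAlgebra.im_one

/-- The alternating form on `E89`. -/
def sym (u u' : E89) : F89 := u.re * u'.im - u.im * u'.re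

instance finite_E89 : Finite E89 := Finite.of_equiv _ (QuadraticAlgebra.equivProd
  (3 : ZMod 89) 0).symm

section

variable {P : Type*} [Group P]

lemma zmod_pow_comm {x y e : P} (h : x * y = y * x * e) (hx : x * e = e * x) (k : ℕ) :
    x ^ k * y = y * x ^ k * e ^ k := by
  induction k with
  | zero => simp
  | succ k ih =>
    have h1 : e ^ k * x = x * e ^ k := (Commute.pow_left (show e * x = x * e from hx.symm) k)
    rw [pow_succ', mul_assoc, ih, ← mul_assoc, ← mul_assoc, h, mul_assoc (y * x),
      (Commute.pow_right (show e * x = x * e from hx.symm) k).eq, mul_assoc, mul_assoc,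
      mul_assoc, pow_succ']
    simp only [mul_assoc]

lemma zmod_pow_comm' {x y e : P} (h : x * y = y * x * e) (hx : x * e = e * x) (hy : y * e = e * y)
    (k l : ℕ) : x ^ k * y ^ l = y ^ l * x ^ k * e ^ (k * l) := by
  have h1 := zmod_pow_comm h hx k
  have h2 : y * x ^ k = x ^ k * y * (e ^ k)⁻¹ := by rw [h1]; group
  have h3 := zmod_pow_comm h2
    (Commute.inv_right (Commute.pow_right (show y * e = e * y from hy) k)) l
  rw [h3, pow_mul, inv_pow]
  group

/-- Heisenberg coordinates on `P`, with the involution `z` acting as `-1` on the first two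
coordinates. -/
theorem exists_heisenberg (hP : Nat.card P = 704969) (hnc : ∃ x y : P, x * y ≠ y * x)
    {z : MulAut P} (hz1 : z ≠ 1) (hz : z ^ 2 = 1) (hZ : ∀ c ∈ Subgroup.center P, z c = c) :
    ∃ Ψ : F89 → F89 → F89 → P,
      (∀ a b d a' b' d', Ψ a b d * Ψ a' b' d' = Ψ (a + a') (b + b') (d + d' + (a * b' - b * a'))) ∧
      (∀ a b d, z (Ψ a b d) = Ψ (-a) (-b) d) ∧
      (∀ a b d, Ψ a b d = 1 → a = 0 ∧ b = 0 ∧ d = 0) := by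
  obtain ⟨x, y, hx, hy, hxy⟩ : ∃ x y : P, z x = x⁻¹ ∧ z y = y⁻¹ ∧ x * y ≠ y * x := by
    obtain ⟨x, y, hxy⟩ := hnc
    obtain ⟨d, hd, hx⟩ := exists_inverted hP ⟨x, y, hxy⟩ hz1 hz hZ x
    obtain ⟨e, he, hy⟩ := exists_inverted hP ⟨x, y, hxy⟩ hz1 hz hZ y
    refine ⟨_, _, hx, hy, fun h => hxy ?_⟩
    have hd' := Subgroup.mem_center_iff.1 hd
    have he' := Subgroup.mem_center_iff.1 he
    rw [mul_assoc x, ← mul_assoc d, ← hd', mul_assoc y d, mul_assoc y e, ← mul_assoc e, ← he',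
      mul_assoc x e, ← he' d, ← mul_assoc, ← mul_assoc] at h
    rw [mul_assoc, mul_assoc] at h
    simp only [← mul_assoc] at h
    exact mul_right_cancel (mul_right_cancel h)
  obtain ⟨e, he, hxye⟩ := exists_mul_comm_eq hP hnc x y
  have he89 := center_pow hP hnc he
  have he1 : e ≠ 1 := fun h => hxy (by rw [hxye, h, mul_one])
  set c := e ^ 45 with hc
  have hcZ : c ∈ Subgroup.center P := pow_mem he 45
  have hcc := Subgroup.mem_center_iff.1 hcZ
  have hc2 : c ^ 2 = e := by rw [hc, ← pow_mul, pow_succ, he89, one_mul]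
  have hc89 := center_pow hP hnc hcZ
  have hc1 : c ≠ 1 := fun h => he1 (by rw [← hc2, h, one_pow])
  have hx89 := pow_eq_one_of_inverted hP hnc hZ hx
  have hy89 := pow_eq_one_of_inverted hP hnc hZ hy
  let X : F89 → P := fun a => zmodHom 89 x hx89 (.ofAdd a)
  let Y : F89 → P := fun a => zmodHom 89 y hy89 (.ofAdd a)
  let C : F89 → P := fun a => zmodHom 89 c hc89 (.ofAdd a)
  have hXn : ∀ n : ℕ, X n = x ^ n := zmodHom_natCast _
  have hYn : ∀ n : ℕ, Y n = y ^ n := zmodHom_natCast _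
  have hCn : ∀ n : ℕ, C n = c ^ n := zmodHom_natCast _
  have hXadd : ∀ a b, X (a + b) = X a * X b := fun a b => map_mul _ _ _
  have hYadd : ∀ a b, Y (a + b) = Y a * Y b := fun a b => map_mul _ _ _
  have hCadd : ∀ a b, C (a + b) = C a * C b := fun a b => map_mul _ _ _
  have hcast : ∀ a : F89, ∃ n : ℕ, (n : F89) = a := fun a => ⟨a.val, ZMod.natCast_zmod_val a⟩
  have hX0 : X 0 = 1 := map_one _
  have hY0 : Y 0 = 1 := map_one _
  have hC0 : C 0 = 1 := map_one _
  have hXneg : ∀ a, X (-a) = (X a)⁻¹ := fun a => map_inv _ _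
  have hYneg : ∀ a, Y (-a) = (Y a)⁻¹ := fun a => map_inv _ _
  have hCZ : ∀ a, C a ∈ Subgroup.center P := by
    intro a
    obtain ⟨n, rfl⟩ := hcast a
    rw [hCn]
    exact pow_mem hcZ n
  have hCc : ∀ a g, g * C a = C a * g := fun a => Subgroup.mem_center_iff.1 (hCZ a)
  have hXY : ∀ a b, X a * Y b = Y b * X a * C (2 * (a * b)) := by
    intro a b
    obtain ⟨n, rfl⟩ := hcast a
    obtain ⟨m, rfl⟩ := hcast b
    have := hCn (2 * (n * m))
    push_cast at this
    rw [hXn, hYn, this, pow_mul, hc2]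
    have he' := Subgroup.mem_center_iff.1 he
    exact zmod_pow_comm' hxye (he' x) (he' y) n m
  have hCinj : ∀ a, C a = 1 → a = 0 := by
    intro a h
    obtain ⟨n, rfl⟩ := hcast a
    rw [hCn] at h
    have h1 : orderOf c = 89 := orderOf_eq_prime hc89 hc1
    rw [ZMod.natCast_eq_zero_iff, ← h1]
    exact orderOf_dvd_of_pow_eq_one h
  refine ⟨fun a b d => X a * Y b * C (d - a * b), ?_, ?_, ?_⟩
  · intro a b d a' b' d'
    have h1 : Y b * X a' = X a' * Y b * C (-(2 * (a' * b))) := by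
      rw [hXY, mul_assoc, ← hCadd, add_neg_cancel, hC0, mul_one]
    calc X a * Y b * C (d - a * b) * (X a' * Y b' * C (d' - a' * b'))
        = X a * Y b * (X a' * Y b' * C (d' - a' * b')) * C (d - a * b) := by
          rw [mul_assoc, ← hCc, ← mul_assoc]
      _ = X a * (Y b * X a') * Y b' * (C (d' - a' * b') * C (d - a * b)) := by
          simp only [mul_assoc]
      _ = X a * X a' * (Y b * (Y b' * C (-(2 * (a' * b))))) *
        (C (d' - a' * b') * C (d - a * b)) := by
          rw [h1, hCc _ (Y b')]
          simp only [mul_assoc]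
      _ = X (a + a') * Y (b + b') * (C (-(2 * (a' * b))) * (C (d' - a' * b') * C (d - a * b))) := by
          rw [hXadd, hYadd]
          simp only [mul_assoc]
      _ = _ := by
          rw [← hCadd, ← hCadd]
          congr 2
          ring
  · intro a b d
    have hzX : z (X a) = X (-a) := by
      obtain ⟨n, rfl⟩ := hcast a
      rw [hXneg, hXn, map_pow, hx, inv_pow]
    have hzY : z (Y b) = Y (-b) := by
      obtain ⟨n, rfl⟩ := hcast b
      rw [hYneg, hYn, map_pow, hy, inv_pow]
    simp only [map_mul, hzX, hzY, hZ _ (hCZ _), neg_mul_neg]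
  · intro a b d h
    replace h : X a * Y b * C (d - a * b) = 1 := h
    have hb : b = 0 := by
      have h3 := hXY 1 b
      have h4 : Y b = (X a)⁻¹ * (C (d - a * b))⁻¹ := by
        rw [← mul_one (X a)⁻¹, ← h]
        group
      have h5 : X 1 * Y b = Y b * X 1 := by
        rw [h4, ← mul_assoc, ← hXneg, ← hXadd, add_comm, hXadd, mul_assoc, mul_assoc]
        congr 1
        exact ((Subgroup.mem_center_iff.1 (inv_mem (hCZ _))) _)
      rw [h5, left_eq_mul] at h3
      have h6 := hCinj _ h3
      rw [one_mul] at h6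
      exact (mul_eq_zero.1 h6).resolve_left (by decide)
    have ha : a = 0 := by
      subst hb
      rw [hY0, mul_one, mul_zero, sub_zero] at h
      have h3 := hXY a 1
      have h4 : X a = (C d)⁻¹ := by rw [eq_inv_iff_mul_eq_one, h]
      have h5 : X a * Y 1 = Y 1 * X a := by
        rw [h4]
        exact ((Subgroup.mem_center_iff.1 (inv_mem (hCZ _))) _).symm
      rw [h5, left_eq_mul] at h3
      have h6 := hCinj _ h3
      rw [mul_one] at h6
      exact (mul_eq_zero.1 h6).resolve_left (by decide)
    subst hb ha
    rw [hX0, hY0, one_mul, one_mul, mul_zero, sub_zero] at h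
    exact ⟨rfl, rfl, hCinj _ h⟩

end

lemma card_E89 : Nat.card E89 = 7921 := by
  rw [Nat.card_congr (QuadraticAlgebra.equivProd (3 : ZMod 89) 0), Nat.card_prod, Nat.card_zmod]

/-- Heisenberg coordinates on a group `P`. -/
structure Coord (P : Type*) [Group P] where
  /-- the element with given coordinates -/
  Φ : E89 → F89 → P
  mul : ∀ u a u' a', Φ u a * Φ u' a' = Φ (u + u') (a + a' + sym u u')
  eq_zero : ∀ u a, Φ u a = 1 → u = 0 ∧ a = 0

lemma sym_add (u v w : E89) : sym u (v + w) = sym u v + sym u w := by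
  simp only [sym, QuadraticAlgebra.re_add, QuadraticAlgebra.im_add]
  ring

lemma add_sym (u v w : E89) : sym (u + v) w = sym u w + sym v w := by
  simp only [sym, QuadraticAlgebra.re_add, QuadraticAlgebra.im_add]
  ring

lemma sym_smul (r : F89) (u v : E89) : sym (r • u) v = r * sym u v := by
  simp only [sym, QuadraticAlgebra.re_smul, QuadraticAlgebra.im_smul, smul_eq_mul]
  ring

lemma smul_sym (r : F89) (u v : E89) : sym u (r • v) = r * sym u v := by
  simp only [sym, QuadraticAlgebra.re_smul, QuadraticAlgebra.im_smul, smul_eq_mul]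
  ring

@[simp] lemma sym_self (u : E89) : sym u u = 0 := by
  simp only [sym]
  ring

@[simp] lemma sym_zero (u : E89) : sym u 0 = 0 := by simp [sym]

@[simp] lemma zero_sym (u : E89) : sym 0 u = 0 := by simp [sym]

@[simp] lemma sym_neg (u v : E89) : sym u (-v) = -sym u v := by
  simp only [sym, QuadraticAlgebra.re_neg, QuadraticAlgebra.im_neg]
  ring

@[simp] lemma neg_sym (u v : E89) : sym (-u) v = -sym u v := by
  simp only [sym, QuadraticAlgebra.re_neg, QuadraticAlgebra.im_neg]
  ring

lemma sym_comm (u v : E89) : sym u v = -sym v u := by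
  simp only [sym]
  ring

lemma eq_zero_of_sym {u : E89} (h : ∀ v, sym u v = 0) : u = 0 := by
  have h1 := h 1
  have h2 := h ⟨0, 1⟩
  ext
  · simpa [sym] using h2
  · simpa [sym] using h1

namespace Coord

variable {P : Type*} [Group P] (C : Coord P)

@[simp] lemma zero : C.Φ 0 0 = 1 := by
  have h := C.mul 0 0 0 0
  simpa using h

lemma inv (u : E89) (a : F89) : (C.Φ u a)⁻¹ = C.Φ (-u) (-a) := by
  rw [inv_eq_iff_mul_eq_one, C.mul]
  simp

lemma inj {u u' : E89} {a a' : F89} (h : C.Φ u a = C.Φ u' a') : u = u' ∧ a = a' := by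
  rw [← mul_inv_eq_one, C.inv, C.mul] at h
  obtain ⟨h1, h2⟩ := C.eq_zero _ _ h
  obtain rfl : u = u' := by rwa [← sub_eq_add_neg, sub_eq_zero] at h1
  refine ⟨rfl, ?_⟩
  rw [sym_neg, sym_self, neg_zero, add_zero] at h2
  rwa [← sub_eq_add_neg, sub_eq_zero] at h2

lemma surj (hP : Nat.card P = 704969) (p : P) : ∃ u a, C.Φ u a = p := by
  have := finite_of_card_eq hP
  have h : Function.Bijective fun x : E89 × F89 => C.Φ x.1 x.2 := by
    rw [Nat.bijective_iff_injective_and_card]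
    refine ⟨fun x y h => Prod.ext (C.inj h).1 (C.inj h).2, ?_⟩
    rw [Nat.card_prod, card_E89, Nat.card_zmod, hP]
  obtain ⟨x, hx⟩ := h.2 p
  exact ⟨_, _, hx⟩

lemma mem_center (hP : Nat.card P = 704969) {u : E89} {a : F89} :
    C.Φ u a ∈ Subgroup.center P ↔ u = 0 := by
  rw [Subgroup.mem_center_iff]
  constructor
  · intro h
    refine eq_zero_of_sym fun v => ?_
    have h1 := h (C.Φ v 0)
    rw [C.mul, C.mul] at h1
    have h2 := (C.inj h1).2
    rw [sym_comm v u] at h2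
    have h3 : 2 * sym u v = 0 := by linear_combination -h2
    exact (mul_eq_zero.1 h3).resolve_left (by decide)
  · rintro rfl p
    obtain ⟨v, b, rfl⟩ := C.surj hP p
    rw [C.mul, C.mul]
    simp [add_comm]

/-- An automorphism commuting with `z` acts linearly. -/
lemma exists_aut (hP : Nat.card P = 704969) {z σ : MulAut P}
    (hz : ∀ u a, z (C.Φ u a) = C.Φ (-u) a) (hσ : σ * z = z * σ) :
    ∃ (M : E89 →+ E89) (d : F89), (∀ u a, σ (C.Φ u a) = C.Φ (M u) (d * a)) ∧
      ∀ u u', sym (M u) (M u') = d * sym u u' := by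
  have h1 : ∀ u, ∃ v, σ (C.Φ u 0) = C.Φ v 0 := by
    intro u
    obtain ⟨v, b, hv⟩ := C.surj hP (σ (C.Φ u 0))
    refine ⟨v, ?_⟩
    have h2 : z (C.Φ v b) = (C.Φ v b)⁻¹ := by
      rw [hv, ← MulAut.mul_apply, ← hσ, MulAut.mul_apply, hz, ← map_inv, C.inv, neg_zero]
    rw [hz, C.inv] at h2
    have h3 := (C.inj h2).2
    have h4 : 2 * b = 0 := by linear_combination h3
    rw [← hv, (mul_eq_zero.1 h4).resolve_left (by decide)]
  have h2 : ∀ a, ∃ b, σ (C.Φ 0 a) = C.Φ 0 b := by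
    intro a
    obtain ⟨v, b, hv⟩ := C.surj hP (σ (C.Φ 0 a))
    have h3 : C.Φ v b ∈ Subgroup.center P := by
      rw [hv, Subgroup.mem_center_iff]
      intro g
      have h4 : C.Φ 0 a ∈ Subgroup.center P := (C.mem_center hP).2 rfl
      have h5 := congrArg σ ((Subgroup.mem_center_iff.1 h4) (σ.symm g))
      simpa using h5
    rw [C.mem_center hP] at h3
    exact ⟨b, by rw [← hv, h3]⟩
  choose M hM using h1
  choose D hD using h2
  have h3 : ∀ u a, σ (C.Φ u a) = C.Φ (M u) (D a) := by
    intro u a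
    have : C.Φ u a = C.Φ u 0 * C.Φ 0 a := by rw [C.mul]; simp
    rw [this, map_mul, hM, hD, C.mul]
    simp
  have hDadd : ∀ a b, D (a + b) = D a + D b := by
    intro a b
    have h4 : C.Φ 0 (a + b) = C.Φ 0 a * C.Φ 0 b := by rw [C.mul]; simp
    have h5 := congrArg σ h4
    rw [map_mul, hD, hD, hD, C.mul] at h5
    simpa using (C.inj h5).2
  have hDmul : ∀ a, D a = D 1 * a := by
    intro a
    have h := ZMod.map_smul (AddMonoidHom.mk' D hDadd) a 1
    simp only [smul_eq_mul, mul_one, AddMonoidHom.mk'_apply] at h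
    rw [h, mul_comm]
  have hD0 : D 0 = 0 := by rw [hDmul, mul_zero]
  have h6 : ∀ u u', M u + M u' = M (u + u') ∧ sym (M u) (M u') = D (sym u u') := by
    intro u u'
    have h7 := congrArg σ (C.mul u 0 u' 0)
    rw [map_mul, h3, h3, h3, C.mul, hD0] at h7
    simpa using C.inj h7
  refine ⟨AddMonoidHom.mk' M fun u u' => (h6 u u').1.symm, D 1, fun u a => ?_, fun u u' => ?_⟩
  · rw [h3, hDmul]; rfl
  · rw [← hDmul]; exact (h6 u u').2

/-- Change of coordinates. -/
def trans (L : E89 →+ E89) (δ : F89) (hδ : δ ≠ 0) (hL : ∀ u u', sym (L u) (L u') = δ * sym u u') :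
    Coord P where
  Φ u a := C.Φ (L u) (δ * a)
  mul u a u' a' := by
    rw [C.mul, hL, map_add]
    congr 1
    ring
  eq_zero u a h := by
    obtain ⟨h1, h2⟩ := C.eq_zero _ _ h
    refine ⟨eq_zero_of_sym fun v => ?_, (mul_eq_zero.1 h2).resolve_left hδ⟩
    have h3 := hL u v
    rw [h1, zero_sym] at h3
    exact (mul_eq_zero.1 h3.symm).resolve_left hδ

end Coord

/-- An element of order `5` in `E89`. -/
def zeta : E89 := ⟨49, 34⟩

lemma eq_smul_add_smul (u : E89) : u = u.re • 1 + u.im • (⟨0, 1⟩ : E89) := by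
  ext <;> simp

lemma exists_trace {M : E89 →+ E89} (hM : ∀ u u', sym (M u) (M u') = sym u u') :
    ∃ β : F89, ∀ u, M (M u) = β • M u - u := by
  set p := M 1 with hp
  set r := M ⟨0, 1⟩ with hr
  have hlin : ∀ u, M u = u.re • p + u.im • r := by
    intro u
    conv_lhs => rw [eq_smul_add_smul u]
    rw [map_add, ZMod.map_smul, ZMod.map_smul]
  have hdet := hM 1 ⟨0, 1⟩
  rw [← hp, ← hr] at hdet
  simp only [sym, QuadraticAlgebra.re_one, QuadraticAlgebra.im_one] at hdet
  refine ⟨p.re + r.im, fun u => ?_⟩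
  rw [hlin (M u), hlin u]
  ext
  · simp only [QuadraticAlgebra.re_add, QuadraticAlgebra.im_add, QuadraticAlgebra.re_smul,
      QuadraticAlgebra.im_smul, QuadraticAlgebra.re_sub, smul_eq_mul]
    linear_combination -u.re * hdet
  · simp only [QuadraticAlgebra.re_add, QuadraticAlgebra.im_add, QuadraticAlgebra.re_smul,
      QuadraticAlgebra.im_smul, QuadraticAlgebra.im_sub, smul_eq_mul]
    linear_combination -u.im * hdet

lemma trace_eq_of_order_five {M : E89 →+ E89} (hM : ∀ u u', sym (M u) (M u') = sym u u') {β : F89}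
    (hβ : ∀ u, M (M u) = β • M u - u) (h5 : ∀ u, M (M (M (M (M u)))) = u) (h1 : ∃ u, M u ≠ u) :
    β = 9 ∨ β = 79 := by
  have hMs : ∀ (r : F89) u, M (r • u) = r • M u := fun r u => ZMod.map_smul M r u
  have key : ∀ u, (β ^ 4 - 3 * β ^ 2 + 1) • M u = (β ^ 3 - 2 * β + 1) • u := by
    intro u
    have h := h5 u
    simp only [hβ, map_sub, hMs] at h
    rw [← sub_eq_zero] at h ⊢
    rw [← h]
    module
  by_cases h0 : β ^ 4 - 3 * β ^ 2 + 1 = 0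
  · have h2 := key 1
    rw [h0, zero_smul] at h2
    have h3 : β ^ 3 - 2 * β + 1 = 0 := by
      simpa using (congrArg QuadraticAlgebra.re h2).symm
    revert h0 h3
    clear * -
    revert β
    decide +kernel
  · exfalso
    obtain ⟨u, hu⟩ := h1
    set l := (β ^ 4 - 3 * β ^ 2 + 1)⁻¹ * (β ^ 3 - 2 * β + 1) with hl
    have hMl : ∀ u, M u = l • u := by
      intro u
      rw [hl, mul_smul, ← key, smul_smul, inv_mul_cancel₀ h0, one_smul]
    have h2 := hM 1 ⟨0, 1⟩
    rw [hMl, hMl, sym_smul, smul_sym] at h2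
    have h3 := congrArg QuadraticAlgebra.re (h5 1)
    simp only [hMl, QuadraticAlgebra.re_smul, QuadraticAlgebra.re_one, smul_eq_mul, mul_one] at h3
    have h4 : sym 1 ⟨0, 1⟩ = 1 := by simp [sym]
    rw [h4] at h2
    have h5 : l = 1 := by linear_combination h3 - (l ^ 3 + l) * h2
    exact hu (by rw [hMl, h5, one_smul])

/-- Coordinates in which an automorphism of order `5` acts as multiplication by `zeta`. -/
theorem exists_coord {P : Type*} [Group P] (hP : Nat.card P = 704969)
    (hnc : ∃ x y : P, x * y ≠ y * x) {z v : MulAut P} (hz1 : z ≠ 1) (hz : z ^ 2 = 1)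
    (hZ : ∀ c ∈ Subgroup.center P, z c = c) (hvz : v * z = z * v) (hv1 : v ≠ 1) (hv : v ^ 5 = 1)
    (hvZ : ∀ c ∈ Subgroup.center P, v c = c) :
    ∃ (v' : MulAut P) (C : Coord P), (v' = v ∨ v' = v ^ 2) ∧
      (∀ u a, z (C.Φ u a) = C.Φ (-u) a) ∧ ∀ u a, v' (C.Φ u a) = C.Φ (zeta * u) a := by
  obtain ⟨Ψ, h1, h2, h3⟩ := exists_heisenberg hP hnc hz1 hz hZ
  let C : Coord P :=
    { Φ := fun u a => Ψ u.re u.im a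
      mul := fun u a u' a' => by rw [h1]; rfl
      eq_zero := fun u a h => by
        obtain ⟨h4, h5, h6⟩ := h3 _ _ _ h
        exact ⟨QuadraticAlgebra.ext h4 h5, h6⟩ }
  have hCz : ∀ u a, z (C.Φ u a) = C.Φ (-u) a := fun u a => h2 _ _ _
  obtain ⟨M, d, hM, hMs⟩ := C.exists_aut hP hCz hvz
  obtain rfl : d = 1 := by
    have h4 := hvZ _ ((C.mem_center hP (u := 0) (a := 1)).2 rfl)
    rw [hM] at h4
    simpa using (C.inj h4).2
  simp only [one_mul] at hM hMs
  obtain ⟨β, hβ⟩ := exists_trace hMs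
  have hβ' : β = 9 ∨ β = 79 := by
    refine trace_eq_of_order_five hMs hβ (fun u => ?_) ?_
    · have h4 : (v ^ 5) (C.Φ u 0) = C.Φ u 0 := by rw [hv, MulAut.one_apply]
      simp only [pow_succ, pow_zero, one_mul, MulAut.mul_apply, hM] at h4
      exact (C.inj h4).1
    · by_contra h
      push Not at h
      apply hv1
      ext p
      obtain ⟨u, a, rfl⟩ := C.surj hP p
      rw [hM, h, MulAut.one_apply]
  obtain ⟨v', M', hv', hM', hMs', hβ''⟩ : ∃ (v' : MulAut P) (M' : E89 →+ E89),
    (v' = v ∨ v' = v ^ 2) ∧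
      (∀ u a, v' (C.Φ u a) = C.Φ (M' u) a) ∧ (∀ u u', sym (M' u) (M' u') = sym u u') ∧
      ∀ u, M' (M' u) = (9 : F89) • M' u - u := by
    rcases hβ' with rfl | rfl
    · exact ⟨v, M, .inl rfl, hM, hMs, hβ⟩
    · refine ⟨v ^ 2, M.comp M, .inr rfl, fun u a => ?_, fun u u' => ?_, fun u => ?_⟩
      · rw [pow_two, MulAut.mul_apply, hM, hM]; rfl
      · rw [AddMonoidHom.comp_apply, AddMonoidHom.comp_apply, hMs, hMs]
      · have hs : ∀ (r : F89) u, M (r • u) = r • M u := fun r u => ZMod.map_smul M r u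
        simp only [AddMonoidHom.comp_apply, hβ, map_sub, hs]
        have e : (9 : F89) = 79 * 79 - 2 := by decide
        rw [e]
        module
  set m := M' 1 with hm
  have him : m.im ≠ 0 := by
    intro h
    have h4 := hβ'' 1
    have h5 : m = m.re • 1 := by ext <;> simp [h]
    rw [← hm] at h4
    rw [h5, ZMod.map_smul, ← hm, h5] at h4
    have h6 := congrArg QuadraticAlgebra.re h4
    simp at h6
    revert h6
    clear * -
    generalize m.re = x
    revert x
    decide +kernel
  let L : E89 →+ E89 := AddMonoidHom.mk'
    (fun u => (u.re - 25 * u.im) • (1 : E89) + (55 * u.im) • m) (fun u u' => by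
      simp only [QuadraticAlgebra.re_add, QuadraticAlgebra.im_add]
      module)
  have hLe : ∀ u, L u = (u.re - 25 * u.im) • (1 : E89) + (55 * u.im) • m := fun u => rfl
  have hL : ∀ u u', sym (L u) (L u') = (55 * m.im) * sym u u' := by
    intro u u'
    simp only [hLe, sym, QuadraticAlgebra.re_add, QuadraticAlgebra.im_add, QuadraticAlgebra.re_smul,
      QuadraticAlgebra.im_smul, QuadraticAlgebra.re_one, QuadraticAlgebra.im_one, smul_eq_mul]
    ring
  refine ⟨v', C.trans L (55 * m.im) (mul_ne_zero (by decide) him) hL, hv', fun u a => ?_,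
    fun u a => ?_⟩
  · change z (C.Φ _ _) = C.Φ _ _
    rw [hCz, map_neg]
  · change v' (C.Φ _ _) = C.Φ _ _
    rw [hM']
    congr 1
    rw [hLe, hLe, map_add, ZMod.map_smul, ZMod.map_smul, ← hm, hm, hβ'', ← hm]
    simp only [QuadraticAlgebra.re_mul, QuadraticAlgebra.im_mul, zeta]
    have e : (89 : F89) = 0 := by decide
    ext
    · simp only [QuadraticAlgebra.re_add, QuadraticAlgebra.re_smul, QuadraticAlgebra.re_sub,
        QuadraticAlgebra.re_one, smul_eq_mul]
      linear_combination (-21 * u.re * m.re - 25 * u.im * m.re + 9 * u.re + 12 * u.im) * e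
    · simp only [QuadraticAlgebra.im_add, QuadraticAlgebra.im_smul, QuadraticAlgebra.im_sub,
        QuadraticAlgebra.im_one, smul_eq_mul]
      linear_combination (-21 * u.re * m.im - 25 * u.im * m.im) * e

section

variable {G Ω : Type*} [Group G] [MulAction G Ω]

namespace Frame

/-- The two-point stabiliser. -/
def K (F : Frame G Ω) : Subgroup G := MulAction.stabilizer G F.pt ⊓ MulAction.stabilizer G F.o

lemma mem_K (F : Frame G Ω) {g : G} : g ∈ F.K ↔ g • F.pt = F.pt ∧ g • F.o = F.o := Iff.rfl

lemma card_K [Finite G] (F : Frame G Ω) : Nat.card F.K = 2640 := by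
  have : MulAction.IsPretransitive G Ω := ⟨fun x y => by
    obtain ⟨g, rfl⟩ := F.exists_smul_pt x
    obtain ⟨h, rfl⟩ := F.exists_smul_pt y
    exact ⟨h * g⁻¹, by rw [mul_smul, inv_smul_smul]⟩⟩
  have h1 : Nat.card (MulAction.stabilizer G F.pt) = 704969 * 2640 := by
    have h := (MulAction.stabilizer G F.pt).card_mul_index
    rw [MulAction.index_stabilizer_of_transitive, F.card_points, F.card] at h
    refine Nat.eq_of_mul_eq_mul_right (show 0 < 704970 by norm_num) (h.trans ?_)
    rfl
  have h2 : F.P ≤ MulAction.stabilizer G F.pt := fun p hp => F.smul_pt p hp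
  have h3 : Function.Bijective fun x : F.P × F.K =>
      (⟨x.1 * x.2, mul_mem (h2 x.1.2) x.2.2.1⟩ : MulAction.stabilizer G F.pt) := by
    constructor
    · rintro ⟨⟨p, hp⟩, ⟨k, hk⟩⟩ ⟨⟨p', hp'⟩, ⟨k', hk'⟩⟩ h
      have h4 : p * k = p' * k' := congrArg Subtype.val h
      have h5 := congrArg (· • F.o) h4
      simp only [mul_smul, (F.mem_K.1 hk).2, (F.mem_K.1 hk').2] at h5
      obtain rfl := F.eq_of_smul_o hp hp' h5
      obtain rfl := mul_left_cancel h4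
      rfl
    · rintro ⟨g, hg⟩
      have h4 : g • F.o ≠ F.pt := by
        intro h
        rw [← (show g • F.pt = F.pt from hg)] at h
        exact F.o_ne (smul_left_cancel _ h)
      obtain ⟨p, hp, h5⟩ := F.trans _ h4
      refine ⟨⟨⟨p, hp⟩, ⟨p⁻¹ * g, Subgroup.mul_mem _ (Subgroup.inv_mem _ (h2 hp)) hg, ?_⟩⟩, ?_⟩
      · change (p⁻¹ * g) • F.o = F.o
        rw [mul_smul, ← h5, inv_smul_smul]
      · simp
  have h4 := Nat.card_congr (Equiv.ofBijective _ h3)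
  rw [Nat.card_prod, F.cardP, h1] at h4
  exact Nat.eq_of_mul_eq_mul_left (by norm_num) h4

lemma K_le_normalizer (F : Frame G Ω) : F.K ≤ Subgroup.normalizer (F.P : Set G) := by
  intro k hk
  rw [Subgroup.mem_normalizer_iff]
  intro p
  refine ⟨F.conj_mem k hk.1 p, fun h => ?_⟩
  have := F.conj_mem k⁻¹ (inv_mem hk).1 _ h
  simpa [mul_assoc] using this

/-- The action of the two-point stabiliser on `P` by conjugation. -/
def conj (F : Frame G Ω) : F.K →* MulAut F.P :=
  (F.P.normalizerMonoidHom).comp (Subgroup.inclusion F.K_le_normalizer)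

lemma conj_apply (F : Frame G Ω) (k : F.K) (p : F.P) : (F.conj k p : G) = k * p * (k : G)⁻¹ := rfl

lemma conj_injective (F : Frame G Ω) : Function.Injective F.conj := by
  rw [injective_iff_map_eq_one]
  rintro ⟨k, hk⟩ h
  apply Subtype.ext
  refine F.faithful k fun x => ?_
  by_cases hx : x = F.pt
  · rw [hx]; exact hk.1
  · obtain ⟨p, hp, rfl⟩ := F.trans x hx
    have h1 := F.conj_apply ⟨k, hk⟩ ⟨p, hp⟩
    rw [h, MulAut.one_apply] at h1
    have h2 : k * p = p * k := by
      rw [← mul_inv_eq_iff_eq_mul]; exact h1.symm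
    rw [← mul_smul, h2, mul_smul, (F.mem_K.1 hk).2]

/-- The elements of the two-point stabiliser centralising the centre of `P`. -/
def K0 (F : Frame G Ω) : Subgroup F.K where
  carrier := {k | ∀ c ∈ Subgroup.center F.P, F.conj k c = c}
  one_mem' := fun c _ => by rw [map_one, MulAut.one_apply]
  mul_mem' := fun {a b} ha hb c hc => by
    rw [map_mul, MulAut.mul_apply, hb c hc, ha c hc]
  inv_mem' := fun {a} ha c hc => by
    rw [map_inv]
    exact (MulEquiv.symm_apply_eq _).2 (ha c hc).symm

lemma dvd_card_K0 [Finite G] (F : Frame G Ω) (hnc : ∃ x y : F.P, x * y ≠ y * x) :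
    30 ∣ Nat.card F.K0 := by
  set Z := (Subgroup.center F.P).map F.P.subtype with hZ
  have hKZ : F.K ≤ Subgroup.normalizer (Z : Set G) := by
    have key : ∀ k ∈ F.K, ∀ c ∈ Z, k * c * k⁻¹ ∈ Z := by
      rintro k hk - ⟨c, hc, rfl⟩
      refine ⟨F.conj ⟨k, hk⟩ c, ?_, rfl⟩
      simp only [SetLike.mem_coe, Subgroup.mem_center_iff] at hc ⊢
      intro g
      have := congrArg (F.conj ⟨k, hk⟩) (hc ((F.conj ⟨k, hk⟩).symm g))
      simpa using this
    intro k hk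
    rw [Subgroup.mem_normalizer_iff]
    refine fun p => ⟨key k hk p, fun h => ?_⟩
    have := key k⁻¹ (inv_mem hk) _ h
    simpa [mul_assoc] using this
  have hcardZ : Nat.card Z = 89 := by
    rw [hZ, Subgroup.card_map_of_injective F.P.subtype_injective, card_center F.cardP hnc]
  let θ : F.K →* MulAut Z := (Z.normalizerMonoidHom).comp (Subgroup.inclusion hKZ)
  have hker : θ.ker = F.K0 := by
    ext k
    constructor
    · intro h c hc
      have h1 : θ k ⟨c, ⟨c, hc, rfl⟩⟩ = ⟨c, ⟨c, hc, rfl⟩⟩ := by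
        rw [MonoidHom.mem_ker.1 h, MulAut.one_apply]
      have h2 := congrArg (fun y : Z => (y : G)) h1
      exact Subtype.ext h2
    · intro h
      rw [MonoidHom.mem_ker]
      ext ⟨-, ⟨c, hc, rfl⟩⟩
      have h1 := congrArg (fun y : F.P => (y : G)) (h c hc)
      exact h1
  have h1 := θ.ker.card_mul_index
  rw [Subgroup.index_ker, hker, F.card_K] at h1
  have h2 := Subgroup.card_subgroup_dvd_card θ.range
  have : IsCyclic Z := isCyclic_of_prime_card (p := 89) hcardZ
  rw [IsCyclic.card_mulAut, hcardZ, Nat.totient_prime (by norm_num)] at h2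
  obtain ⟨m, hm⟩ := h2
  have h3 : 0 < Nat.card θ.range := Nat.card_pos
  refine ⟨m, Nat.eq_of_mul_eq_mul_right h3 ?_⟩
  rw [h1, mul_assoc, mul_comm m, ← hm]
  norm_num

end Frame

end

/-- A doubly transitive permutation group in explicit coordinates on the Heisenberg group. -/
structure Model (G Ω : Type*) [Group G] [MulAction G Ω] where
  /-- the point at infinity -/
  pt : Ω
  /-- the points different from `pt` -/
  pnt : E89 → F89 → Ω
  /-- the translations -/
  T : E89 → F89 → G
  card : Nat.card G = ordU
  faithful : ∀ g : G, (∀ x : Ω, g • x = x) → g = 1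
  ne : ∀ u a, pnt u a ≠ pt
  inj : ∀ u a u' a', pnt u a = pnt u' a' → u = u' ∧ a = a'
  surj : ∀ x, x ≠ pt → ∃ u a, pnt u a = x
  T_pt : ∀ u a, T u a • pt = pt
  T_pnt : ∀ u a u' a', T u a • pnt u' a' = pnt (u + u') (a + a' + sym u u')
  swap : ∃ t : G, t • pt = pnt 0 0 ∧ t • pnt 0 0 = pt
  card_K : Nat.card (MulAction.stabilizer G pt ⊓ MulAction.stabilizer G (pnt 0 0) :
    Subgroup G) = 2640
  exists_aut : ∀ k : G, k • pt = pt → k • pnt 0 0 = pnt 0 0 → ∃ (M : E89 →+ E89) (d : F89),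
    (∀ u a, k • pnt u a = pnt (M u) (d * a)) ∧ ∀ u u', sym (M u) (M u') = d * sym u u'
  /-- the central involution of the two-point stabiliser -/
  z : G
  z_pt : z • pt = pt
  z_pnt : ∀ u a, z • pnt u a = pnt (-u) a
  /-- an element of order five -/
  v : G
  v_pt : v • pt = pt
  v_pnt : ∀ u a, v • pnt u a = pnt (zeta * u) a

theorem Frame.exists_model {G Ω : Type*} [Group G] [MulAction G Ω] [Finite G] (F : Frame G Ω)
    (hnc : ∃ x y : F.P, x * y ≠ y * x) : ∃ M : Model G Ω, M.pt = F.pt := by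
  have hinj := F.conj_injective
  have h30 := F.dvd_card_K0 hnc
  obtain ⟨⟨z, hzK⟩, hz2⟩ := exists_prime_orderOf_dvd_card' (G := F.K0) 2
    (dvd_trans (by norm_num) h30)
  obtain ⟨⟨v, hvK⟩, hv5⟩ := exists_prime_orderOf_dvd_card' (G := F.K0) 5
    (dvd_trans (by norm_num) h30)
  rw [Subgroup.orderOf_mk] at hz2 hv5
  have hz2' : z ^ 2 = 1 := by rw [← hz2, pow_orderOf_eq_one]
  have hv5' : v ^ 5 = 1 := by rw [← hv5, pow_orderOf_eq_one]
  have hz1 : z ≠ 1 := by rintro rfl; simp at hz2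
  have hv1 : v ≠ 1 := by rintro rfl; simp at hv5
  have hne : ∀ k, k ≠ 1 → F.conj k ≠ 1 := fun k hk h => hk (hinj (h.trans (map_one _).symm))
  have huniq : ∀ z' ∈ F.K0, z' ≠ 1 → z' ^ 2 = 1 → z' = z := by
    intro z' hz'K hz'1 hz'2
    have h1 : F.conj (z' * z) = 1 := by
      refine aut_eq_one F.cardP hnc (n := Nat.card F.K) ?_ ?_ ?_ ?_
      · rw [F.card_K]; norm_num
      · rw [← map_pow, pow_card_eq_one', map_one]
      · exact F.K0.mul_mem hz'K hzK
      · intro x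
        have h1 := mul_mem_center F.cardP hnc (hne z hz1) (by rw [← map_pow, hz2', map_one]) hzK x
        have h2 := mul_mem_center F.cardP hnc (hne z' hz'1)
          (by rw [← map_pow, hz'2, map_one]) hz'K x
        set c := x * F.conj z x with hc
        set c' := x * F.conj z' x with hc'
        refine ⟨c'⁻¹ * c, mul_mem (inv_mem h2) h1, ?_⟩
        have e1 : F.conj z x = x⁻¹ * c := by rw [hc]; group
        have e2 : F.conj z' x = x⁻¹ * c' := by rw [hc']; group
        rw [map_mul, MulAut.mul_apply, e1, map_mul, hz'K c h1, map_inv, e2, mul_inv_rev, inv_inv,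
          ← Subgroup.mem_center_iff.1 (inv_mem h2), mul_assoc]
    have h2 : z' * z = 1 := hinj (h1.trans (map_one _).symm)
    rw [pow_two] at hz2'
    exact (eq_inv_of_mul_eq_one_left h2).trans (inv_eq_of_mul_eq_one_left hz2')
  have hcent : ∀ k, k * z = z * k := by
    intro k
    have h1 : k * z * k⁻¹ = z := by
      refine huniq _ ?_ ?_ ?_
      · intro c hc
        have hc' : (F.conj k).symm c ∈ Subgroup.center F.P := by
          rw [Subgroup.mem_center_iff] at hc ⊢
          intro g
          apply (F.conj k).injective
          simpa using hc (F.conj k g)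
        rw [map_mul, map_mul, map_inv, MulAut.mul_apply, MulAut.mul_apply]
        change F.conj k (F.conj z ((F.conj k).symm c)) = c
        rw [hzK _ hc', MulEquiv.apply_symm_apply]
      · intro h
        exact hz1 (conj_eq_one_iff.1 h)
      · rw [conj_pow, hz2', mul_one, mul_inv_cancel]
    exact mul_inv_eq_iff_eq_mul.1 h1
  obtain ⟨v', C, hv', hCz, hCv⟩ := exists_coord F.cardP hnc (hne z hz1)
    (by rw [← map_pow, hz2', map_one]) hzK (by rw [← map_mul, hcent, map_mul]) (hne v hv1)
    (by rw [← map_pow, hv5', map_one]) hvK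
  obtain ⟨w, rfl⟩ : ∃ w, v' = F.conj w := by
    rcases hv' with h | h
    · exact ⟨v, h⟩
    · exact ⟨v ^ 2, by rw [h, map_pow]⟩
  have hkT : ∀ (k : F.K) (p : F.P), (k : G) • (p : G) • F.o = (F.conj k p : G) • F.o := by
    intro k p
    rw [F.conj_apply, mul_smul, mul_smul]
    congr 2
    exact (inv_mem k.2).2.symm
  have h00 : ((C.Φ 0 0 : F.P) : G) • F.o = F.o := by simp
  exact ⟨{
    pt := F.pt
    pnt := fun u a => (C.Φ u a : G) • F.o
    T := fun u a => C.Φ u a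
    card := F.card
    faithful := F.faithful
    ne := fun u a => F.smul_o_ne (C.Φ u a).2
    inj := fun u a u' a' h => C.inj (Subtype.ext (F.eq_of_smul_o (C.Φ u a).2 (C.Φ u' a').2 h))
    surj := fun x hx => by
      obtain ⟨p, hp, rfl⟩ := F.trans x hx
      obtain ⟨u, a, h⟩ := C.surj F.cardP ⟨p, hp⟩
      exact ⟨u, a, by rw [h]⟩
    T_pt := fun u a => F.smul_pt _ (C.Φ u a).2
    T_pnt := fun u a u' a' => by rw [← mul_smul, ← Subgroup.coe_mul, C.mul]
    swap := by rw [h00]; exact F.swap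
    card_K := by rw [h00]; exact F.card_K
    exists_aut := fun k hk ho => by
      rw [h00] at ho
      obtain ⟨M, d, hM, hs⟩ := C.exists_aut F.cardP (σ := F.conj ⟨k, hk, ho⟩) hCz
        (by rw [← map_mul, hcent, map_mul])
      exact ⟨M, d, fun u a => by rw [← hM]; exact hkT ⟨k, hk, ho⟩ _, hs⟩
    z := z
    z_pt := z.2.1
    z_pnt := fun u a => by rw [hkT, hCz]
    v := w
    v_pt := w.2.1
    v_pnt := fun u a => by rw [hkT, hCv] }, rfl⟩

lemma sym_mul (κ u v : E89) : sym (κ * u) (κ * v) = κ.norm * sym u v := by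
  simp only [sym, QuadraticAlgebra.re_mul, QuadraticAlgebra.im_mul, QuadraticAlgebra.norm_def]
  ring

lemma zeta_ne_one : zeta ≠ 1 := fun h => absurd (congrArg QuadraticAlgebra.im h) (by decide)

lemma norm_zeta : zeta.norm = 1 := by
  rw [QuadraticAlgebra.norm_def]
  decide

lemma eq_smul_add_smul_zeta (u : E89) : u = (u.re - 25 * u.im) • 1 + (55 * u.im) • zeta := by
  have e : (89 : F89) = 0 := by decide
  ext
  · simp only [QuadraticAlgebra.re_add, QuadraticAlgebra.re_smul, QuadraticAlgebra.re_one, zeta,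
      smul_eq_mul]
    linear_combination -30 * u.im * e
  · simp only [QuadraticAlgebra.im_add, QuadraticAlgebra.im_smul, QuadraticAlgebra.im_one, zeta,
      smul_eq_mul]
    linear_combination -21 * u.im * e

lemma eq_mul_of_commute {M : E89 →+ E89} (hM : ∀ u, M (zeta * u) = zeta * M u) (u : E89) :
    M u = M 1 * u := by
  have h := hM 1
  rw [mul_one] at h
  conv_lhs => rw [eq_smul_add_smul_zeta u]
  conv_rhs => rw [eq_smul_add_smul_zeta u]
  rw [map_add, ZMod.map_smul, ZMod.map_smul, h, mul_add, mul_smul_comm, mul_smul_comm, mul_one,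
    mul_comm zeta]

section

variable {G Ω : Type*} [Group G] [MulAction G Ω]

namespace Model

lemma ext (m : Model G Ω) {g h : G} (h1 : g • m.pt = h • m.pt)
    (h2 : ∀ u a, g • m.pnt u a = h • m.pnt u a) : g = h := by
  rw [← inv_mul_eq_one]
  apply inv_eq_one.1
  rw [mul_inv_rev, inv_inv]
  refine m.faithful _ fun x => ?_
  rw [mul_smul, inv_smul_eq_iff]
  by_cases hx : x = m.pt
  · rw [hx, h1]
  · obtain ⟨u, a, rfl⟩ := m.surj x hx
    rw [h2]

variable (m : Model G Ω)

lemma T_mul (u : E89) (a : F89) (u' : E89) (a' : F89) :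
    m.T u a * m.T u' a' = m.T (u + u') (a + a' + sym u u') := by
  refine m.ext ?_ fun w b => ?_
  · rw [mul_smul, m.T_pt, m.T_pt, m.T_pt]
  · rw [mul_smul, m.T_pnt, m.T_pnt, m.T_pnt, add_sym, sym_add]
    congr 1 <;> abel

lemma T_zero : m.T 0 0 = 1 := by
  refine m.ext ?_ fun w b => ?_
  · rw [m.T_pt, one_smul]
  · rw [m.T_pnt, one_smul]; simp

lemma T_inv (u : E89) (a : F89) : (m.T u a)⁻¹ = m.T (-u) (-a) := by
  rw [inv_eq_iff_mul_eq_one, m.T_mul]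
  simp [m.T_zero]

lemma T_o (u : E89) (a : F89) : m.T u a • m.pnt 0 0 = m.pnt u a := by
  rw [m.T_pnt]; simp

/-- The two-point stabiliser. -/
def K : Subgroup G := MulAction.stabilizer G m.pt ⊓ MulAction.stabilizer G (m.pnt 0 0)

lemma mem_K {g : G} : g ∈ m.K ↔ g • m.pt = m.pt ∧ g • m.pnt 0 0 = m.pnt 0 0 := Iff.rfl

lemma z_mem : m.z ∈ m.K := ⟨m.z_pt, by
  change m.z • m.pnt 0 0 = m.pnt 0 0
  rw [m.z_pnt, neg_zero]⟩

lemma v_mem : m.v ∈ m.K := ⟨m.v_pt, by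
  change m.v • m.pnt 0 0 = m.pnt 0 0
  rw [m.v_pnt, mul_zero]⟩

lemma z_mul_z : m.z * m.z = 1 := by
  refine m.ext ?_ fun u a => ?_
  · rw [mul_smul, m.z_pt, m.z_pt, one_smul]
  · rw [mul_smul, m.z_pnt, m.z_pnt, neg_neg, one_smul]

lemma z_ne_one : m.z ≠ 1 := by
  intro h
  have h1 := m.z_pnt 1 0
  rw [h, one_smul] at h1
  exact absurd (congrArg QuadraticAlgebra.re (m.inj _ _ _ _ h1).1) (by decide)

lemma v_pow (n : ℕ) (u : E89) (a : F89) : m.v ^ n • m.pnt u a = m.pnt (zeta ^ n * u) a := by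
  induction n with
  | zero => simp
  | succ n ih => rw [pow_succ', mul_smul, ih, m.v_pnt, pow_succ', mul_assoc]

lemma zeta_pow_five : zeta ^ 5 = 1 := by
  simp only [pow_succ, pow_zero, one_mul]
  decide +kernel

lemma orderOf_v : orderOf m.v = 5 := by
  refine orderOf_eq_prime ?_ ?_
  · refine m.ext ?_ fun u a => ?_
    · rw [one_smul]
      exact (m.K.pow_mem m.v_mem 5).1
    · rw [v_pow, zeta_pow_five, one_mul, one_smul]
  · intro h
    have h1 := m.v_pnt 1 0
    rw [h, one_smul, mul_one] at h1
    exact zeta_ne_one (m.inj _ _ _ _ h1).1.symm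

lemma v_comm_T (a : F89) : m.v * m.T 0 a = m.T 0 a * m.v := by
  refine m.ext ?_ fun w b => ?_
  · rw [mul_smul, mul_smul, m.T_pt, m.v_pt, m.T_pt]
  · rw [mul_smul, mul_smul, m.T_pnt, m.v_pnt, m.v_pnt, m.T_pnt]
    simp

lemma z_comm_T (a : F89) : m.z * m.T 0 a = m.T 0 a * m.z := by
  refine m.ext ?_ fun w b => ?_
  · rw [mul_smul, mul_smul, m.T_pt, m.z_pt, m.T_pt]
  · rw [mul_smul, mul_smul, m.T_pnt, m.z_pnt, m.z_pnt, m.T_pnt]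
    simp

lemma z_comm_K {k : G} (hk : k ∈ m.K) : m.z * k = k * m.z := by
  obtain ⟨M, d, hM, -⟩ := m.exists_aut k hk.1 hk.2
  refine m.ext ?_ fun w b => ?_
  · rw [mul_smul, mul_smul, m.z_pt, (m.mem_K.1 hk).1, m.z_pt]
  · rw [mul_smul, mul_smul, hM, m.z_pnt, m.z_pnt, hM, map_neg]

lemma fix_z {x : Ω} (hx : m.z • x = x) : x = m.pt ∨ ∃ a, x = m.pnt 0 a := by
  by_cases h : x = m.pt
  · exact .inl h
  · obtain ⟨u, a, rfl⟩ := m.surj x h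
    rw [m.z_pnt] at hx
    have h1 := (m.inj _ _ _ _ hx).1
    have h2 : u = 0 := by
      have h3 : (2 : F89) • u = 0 := by
        rw [two_smul]
        nth_rewrite 1 [← h1]
        exact neg_add_cancel u
      exact (smul_eq_zero.1 h3).resolve_left (by decide)
    exact .inr ⟨a, by rw [h2]⟩

lemma fix_v {x : Ω} (hx : m.v • x = x) : x = m.pt ∨ ∃ a, x = m.pnt 0 a := by
  by_cases h : x = m.pt
  · exact .inl h
  · obtain ⟨u, a, rfl⟩ := m.surj x h
    rw [m.v_pnt] at hx
    have h1 := (m.inj _ _ _ _ hx).1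
    have h2 : (zeta - 1) * u = 0 := by rw [sub_mul, h1, one_mul, sub_self]
    rw [(mul_eq_zero.1 h2).resolve_left (sub_ne_zero.2 zeta_ne_one)]
    exact .inr ⟨a, rfl⟩

/-- The elements of the two-point stabiliser commuting with `v` act by multiplications. -/
lemma exists_mul {k : G} (hk : k ∈ m.K) (hkv : k * m.v = m.v * k) :
    ∃ κ : E89, κ ≠ 0 ∧ ∀ u a, k • m.pnt u a = m.pnt (κ * u) (κ.norm * a) := by
  obtain ⟨M, d, hM, hs⟩ := m.exists_aut k hk.1 hk.2
  have h1 : ∀ u, M (zeta * u) = zeta * M u := by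
    intro u
    have h := congrArg (· • m.pnt u 0) hkv
    simp only [mul_smul, hM, m.v_pnt] at h
    exact (m.inj _ _ _ _ h).1
  have h2 := eq_mul_of_commute h1
  have h3 : d = (M 1).norm := by
    have h := hs 1 ⟨0, 1⟩
    rw [h2 1, h2 ⟨0, 1⟩, sym_mul] at h
    simpa [sym] using h.symm
  refine ⟨M 1, fun h => ?_, fun u a => ?_⟩
  · have h4 := hM 1 0
    rw [h, mul_zero, ← (m.mem_K.1 hk).2] at h4
    have h5 := (m.inj _ _ _ _ (smul_left_cancel _ h4)).1
    exact one_ne_zero h5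
  · rw [hM, h2 u, h3]

lemma eq_z_of_commute_v {k : G} (hk : k ∈ m.K) (hkv : k * m.v = m.v * k) (hk1 : k ≠ 1)
    (hk2 : k * k = 1) : k = m.z := by
  obtain ⟨κ, -, hκ⟩ := m.exists_mul hk hkv
  have h1 : κ * κ = 1 := by
    have h := congrArg (· • m.pnt 1 0) hk2
    simp only [mul_smul, hκ, one_smul, mul_one] at h
    exact (m.inj _ _ _ _ h).1
  rcases mul_self_eq_one_iff.1 h1 with rfl | rfl
  · refine absurd (m.ext ?_ fun u a => ?_) hk1
    · rw [one_smul]; exact hk.1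
    · rw [hκ, one_smul]; simp
  · refine m.ext ?_ fun u a => ?_
    · rw [m.z_pt]; exact hk.1
    · rw [hκ, m.z_pnt]; simp

lemma conj_mem_K {t : G} (h1 : t • m.pt = m.pnt 0 0) (h2 : t • m.pnt 0 0 = m.pt) {k : G}
    (hk : k ∈ m.K) : t⁻¹ * k * t ∈ m.K := by
  rw [mem_K] at hk ⊢
  constructor
  · rw [mul_smul, mul_smul, h1, hk.2, inv_smul_eq_iff, h1]
  · rw [mul_smul, mul_smul, h2, hk.1, inv_smul_eq_iff, h2]

lemma z_comm_swap {t : G} (h1 : t • m.pt = m.pnt 0 0) (h2 : t • m.pnt 0 0 = m.pt) :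
    m.z * t = t * m.z := by
  have h1' : t⁻¹ • m.pt = m.pnt 0 0 := by rw [inv_smul_eq_iff, h2]
  have h2' : t⁻¹ • m.pnt 0 0 = m.pt := by rw [inv_smul_eq_iff, h1]
  have h3 : t⁻¹ * m.z * t = m.z := by
    refine m.eq_z_of_commute_v (m.conj_mem_K h1 h2 m.z_mem) ?_ ?_ ?_
    · have h4 := m.conj_mem_K h1' h2' m.v_mem
      rw [inv_inv] at h4
      have h5 := congrArg (fun g => t⁻¹ * g * t) (m.z_comm_K h4)
      simpa [mul_assoc] using h5
    · intro h
      apply m.z_ne_one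
      have h5 := congrArg (fun g => t * g * t⁻¹) h
      simpa [mul_assoc] using h5
    · have h5 : t⁻¹ * m.z * t * (t⁻¹ * m.z * t) = t⁻¹ * (m.z * m.z) * t := by group
      rw [h5, m.z_mul_z]
      simp
  rw [mul_assoc, inv_mul_eq_iff_eq_mul] at h3
  exact h3

/-- The coset representatives of the stabiliser of `pt` in the centraliser of `z`. -/
def rep (t : G) : Option F89 → G
  | none => 1
  | some a => m.T 0 a * t

lemma card_centralizer_z : Nat.card (Subgroup.centralizer {m.z}) = 90 * 89 * 2640 := by
  obtain ⟨t, h1, h2⟩ := m.swap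
  have hT : ∀ a, m.T 0 a ∈ Subgroup.centralizer {m.z} := fun a => by
    rw [Subgroup.mem_centralizer_singleton_iff, m.z_comm_T]
  have hK : ∀ k ∈ m.K, k ∈ Subgroup.centralizer {m.z} := fun k hk => by
    rw [Subgroup.mem_centralizer_singleton_iff, m.z_comm_K hk]
  have hr : ∀ x, m.rep t x ∈ Subgroup.centralizer {m.z} := by
    rintro (_ | a)
    · exact one_mem _
    · refine mul_mem (hT a) ?_
      rw [Subgroup.mem_centralizer_singleton_iff, m.z_comm_swap h1 h2]
  have hrpt : m.rep t none • m.pt = m.pt := one_smul _ _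
  have hrs : ∀ a, m.rep t (some a) • m.pt = m.pnt 0 a := by
    intro a
    rw [rep, mul_smul, h1, m.T_o]
  have hfix : ∀ g ∈ Subgroup.centralizer {m.z}, ∀ x : Ω, m.z • x = x → m.z • g • x = g • x := by
    intro g hg x hx
    rw [Subgroup.mem_centralizer_singleton_iff] at hg
    rw [← mul_smul, ← hg, mul_smul, hx]
  have hbij : Function.Bijective fun x : (Option F89 × F89) × m.K =>
      (⟨m.rep t x.1.1 * m.T 0 x.1.2 * x.2, mul_mem (mul_mem (hr _) (hT _)) (hK _ x.2.2)⟩ :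
        Subgroup.centralizer {m.z}) := by
    constructor
    · rintro ⟨⟨x, a⟩, ⟨k, hk⟩⟩ ⟨⟨x', a'⟩, ⟨k', hk'⟩⟩ h
      replace h : m.rep t x * m.T 0 a * k = m.rep t x' * m.T 0 a' * k' := congrArg Subtype.val h
      have h3 := congrArg (· • m.pt) h
      simp only [mul_smul, (m.mem_K.1 hk).1, (m.mem_K.1 hk').1, m.T_pt] at h3
      obtain rfl : x = x' := by
        rcases x with _ | x <;> rcases x' with _ | x'
        · rfl
        · rw [hrpt, hrs] at h3
          exact absurd h3.symm (m.ne _ _)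
        · rw [hrpt, hrs] at h3
          exact absurd h3 (m.ne _ _)
        · rw [hrs, hrs] at h3
          rw [(m.inj _ _ _ _ h3).2]
      rw [mul_assoc, mul_assoc] at h
      have h4 := mul_left_cancel h
      have h5 := congrArg (· • m.pnt 0 0) h4
      simp only [mul_smul, (m.mem_K.1 hk).2, (m.mem_K.1 hk').2, m.T_o] at h5
      obtain rfl := (m.inj _ _ _ _ h5).2
      obtain rfl := mul_left_cancel h4
      rfl
    · rintro ⟨g, hg⟩
      obtain ⟨x, hx⟩ : ∃ x, g • m.pt = m.rep t x • m.pt := by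
        rcases m.fix_z (hfix g hg _ m.z_pt) with h | ⟨a, h⟩
        · exact ⟨none, by rw [h, hrpt]⟩
        · exact ⟨some a, by rw [h, hrs]⟩
      have hgx : (m.rep t x)⁻¹ * g ∈ Subgroup.centralizer {m.z} := mul_mem (inv_mem (hr x)) hg
      have hgp : ((m.rep t x)⁻¹ * g) • m.pt = m.pt := by rw [mul_smul, hx, inv_smul_smul]
      have ho : m.z • m.pnt 0 0 = m.pnt 0 0 := m.z_mem.2
      obtain ⟨a, ha⟩ : ∃ a, ((m.rep t x)⁻¹ * g) • m.pnt 0 0 = m.pnt 0 a := by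
        refine (m.fix_z (hfix _ hgx _ ho)).resolve_left fun h => ?_
        rw [← hgp] at h
        exact m.ne _ _ (smul_left_cancel _ (h.trans (by rw [hgp])))
      refine ⟨⟨⟨x, a⟩, ⟨(m.T 0 a)⁻¹ * ((m.rep t x)⁻¹ * g), ?_⟩⟩, ?_⟩
      · rw [mem_K, mul_smul, mul_smul _ _ (m.pnt 0 0), hgp, ha, inv_smul_eq_iff, inv_smul_eq_iff,
          m.T_pt, m.T_o]
        exact ⟨rfl, rfl⟩
      · apply Subtype.ext
        change m.rep t x * m.T 0 a * ((m.T 0 a)⁻¹ * ((m.rep t x)⁻¹ * g)) = g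
        group
  rw [← Nat.card_congr (Equiv.ofBijective _ hbij), Nat.card_prod, Nat.card_prod, Finite.card_option,
    Nat.card_zmod]
  congr 1
  exact m.card_K

end Model

end

section

variable {G Ω : Type*} [Group G] [MulAction G Ω]

namespace Model

variable (m : Model G Ω)

lemma finite (m : Model G Ω) : Finite G :=
  Nat.finite_of_card_ne_zero (by rw [m.card]; norm_num [ordU])

lemma exists_T_mul_mem_K {g : G} (h1 : g • m.pt = m.pt) {b : F89}
    (h2 : g • m.pnt 0 0 = m.pnt 0 b) : (m.T 0 b)⁻¹ * g ∈ m.K := by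
  rw [mem_K, mul_smul, mul_smul, h1, h2, inv_smul_eq_iff, inv_smul_eq_iff, m.T_pt, m.T_o]
  exact ⟨rfl, rfl⟩

lemma commute_z {g : G} (h1 : m.z • g • m.pt = g • m.pt)
    (h2 : m.z • g • m.pnt 0 0 = g • m.pnt 0 0) : Commute g m.z := by
  have key : ∀ g : G, g • m.pt = m.pt → m.z • g • m.pnt 0 0 = g • m.pnt 0 0 →
      Commute g m.z := by
    intro g h1 h2
    rcases m.fix_z h2 with h | ⟨a, ha⟩
    · exact absurd (smul_left_cancel _ (h.trans h1.symm)) (m.ne _ _)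
    · have h3 : Commute ((m.T 0 a)⁻¹ * g) m.z := (m.z_comm_K (m.exists_T_mul_mem_K h1 ha)).symm
      have h4 : Commute (m.T 0 a) m.z := (m.z_comm_T a).symm
      simpa using h4.mul_left h3
  obtain ⟨t, ht1, ht2⟩ := m.swap
  rcases m.fix_z h1 with h | ⟨a, ha⟩
  · exact key g h h2
  · have hr : Commute (m.T 0 a * t) m.z := by
      have h4 : Commute (m.T 0 a) m.z := (m.z_comm_T a).symm
      exact h4.mul_left (m.z_comm_swap ht1 ht2).symm
    have h3 := key ((m.T 0 a * t)⁻¹ * g) ?_ ?_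
    · simpa [mul_assoc] using hr.mul_left h3
    · rw [mul_smul, ha, inv_smul_eq_iff, mul_smul, ht1, m.T_o]
    · rw [mul_smul, ← mul_smul, ← hr.inv_left.eq, mul_smul, h2]

lemma smul_fix_v {g : G} (hg : Commute g m.v) {x : Ω} (hx : m.v • x = x) :
    m.v • g • x = g • x := by
  rw [← mul_smul, ← hg.eq, mul_smul, hx]

lemma z_smul_of_fix_v {x : Ω} (hx : m.v • x = x) : m.z • x = x := by
  rcases m.fix_v hx with rfl | ⟨a, rfl⟩
  · exact m.z_pt
  · rw [m.z_pnt, neg_zero]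

lemma v_pnt_zero (a : F89) : m.v • m.pnt 0 a = m.pnt 0 a := by rw [m.v_pnt, mul_zero]

lemma commute_z_of_commute_v {g : G} (hg : Commute g m.v) : Commute g m.z :=
  m.commute_z (m.z_smul_of_fix_v (m.smul_fix_v hg m.v_pt))
    (m.z_smul_of_fix_v (m.smul_fix_v hg (m.v_pnt_zero 0)))

/-- Sylow subgroups of order five are conjugate in the two-point stabiliser. -/
lemma exists_conj_v {w : G} (hw : w ∈ m.K) (h5 : orderOf w = 5) :
    ∃ k ∈ m.K, m.v ∈ Subgroup.zpowers (k * w * k⁻¹) := by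
  have := m.finite
  have : Fact (Nat.Prime 5) := ⟨by norm_num⟩
  have hcard : Nat.card m.K = 2640 := m.card_K
  have hf : (Nat.card m.K).factorization 5 = 1 := by
    rw [hcard, show 2640 = 5 ^ 1 * 528 by norm_num]
    rw [Nat.factorization_mul (by norm_num) (by norm_num)]
    simp [Nat.factorization_eq_zero_of_not_dvd, Nat.Prime.factorization_self
      (show Nat.Prime 5 by norm_num)]
  have hP : Nat.card (Subgroup.zpowers (⟨w, hw⟩ : m.K)) = 5 ^ (Nat.card m.K).factorization 5 := by
    rw [hf, Nat.card_zpowers, Subgroup.orderOf_mk, h5, pow_one]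
  have hQ : Nat.card (Subgroup.zpowers (⟨m.v, m.v_mem⟩ : m.K)) =
      5 ^ (Nat.card m.K).factorization 5 := by
    rw [hf, Nat.card_zpowers, Subgroup.orderOf_mk, m.orderOf_v, pow_one]
  obtain ⟨⟨k, hk⟩, hkPQ⟩ := MulAction.exists_smul_eq m.K (Sylow.ofCard _ hP) (Sylow.ofCard _ hQ)
  refine ⟨k, hk, ?_⟩
  have h1 : (⟨m.v, m.v_mem⟩ : m.K) ∈ Sylow.ofCard _ hQ := Subgroup.mem_zpowers _
  rw [← hkPQ] at h1
  replace h1 := Subgroup.mem_pointwise_smul_iff_inv_smul_mem.1 h1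
  rw [← map_inv] at h1
  obtain ⟨n, hn⟩ := h1
  refine ⟨n, ?_⟩
  have h2 := congrArg Subtype.val hn
  simp only [Subgroup.coe_zpow] at h2
  change w ^ n = k⁻¹ * m.v * k⁻¹⁻¹ at h2
  change (k * w * k⁻¹) ^ n = m.v
  rw [conj_zpow, h2]
  group

/-- The involution `z` is the only one in the two-point stabiliser commuting with `v` up to
translation. -/
lemma eq_z_of_smul_pt {y : G} (hv : Commute y m.v) (h1 : y ≠ 1) (h2 : y * y = 1)
    (hpt : y • m.pt = m.pt) : y = m.z := by
  obtain ⟨b, hb⟩ : ∃ b, y • m.pnt 0 0 = m.pnt 0 b :=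
    (m.fix_v (m.smul_fix_v hv (m.v_pnt_zero 0))).resolve_left fun h =>
      m.ne _ _ (smul_left_cancel _ (h.trans hpt.symm))
  have hT : ∀ a, Commute (m.T 0 a) m.v := fun a => (m.v_comm_T a).symm
  have hk := m.exists_T_mul_mem_K hpt hb
  obtain ⟨κ, -, hκ⟩ := m.exists_mul hk ((hT b).inv_left.mul_left hv).eq
  have hy : ∀ a, y • m.pnt 0 a = m.pnt 0 (b + κ.norm * a) := by
    intro a
    have h3 := hκ 0 a
    rw [mul_smul, inv_smul_eq_iff, m.T_pnt] at h3
    simpa using h3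
  have h3 : b + κ.norm * b = 0 := by
    have h4 := hy b
    rw [← hb, ← mul_smul, h2, one_smul] at h4
    exact (m.inj _ _ _ _ h4).2.symm
  have h4 : y • m.pnt 0 (b * 45) = m.pnt 0 (b * 45) := by
    rw [hy]
    congr 1
    have e : (89 : F89) = 0 := by decide
    linear_combination 45 * h3 - b * e
  have h5 : (m.T 0 (b * 45))⁻¹ * y * m.T 0 (b * 45) = m.z := by
    refine m.eq_z_of_commute_v ?_ (((hT _).inv_left.mul_left hv).mul_left (hT _)).eq ?_ ?_
    · rw [mem_K, mul_smul, mul_smul, mul_smul, mul_smul, m.T_pt, m.T_o, hpt, h4, inv_smul_eq_iff,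
        inv_smul_eq_iff, m.T_pt, m.T_o]
      exact ⟨rfl, rfl⟩
    · intro h
      apply h1
      rw [mul_assoc, inv_mul_eq_iff_eq_mul, mul_one] at h
      exact mul_eq_right.1 h
    · calc _ = (m.T 0 (b * 45))⁻¹ * (y * y) * m.T 0 (b * 45) := by group
        _ = 1 := by rw [h2]; group
  rw [mul_assoc, inv_mul_eq_iff_eq_mul, ← m.z_comm_T] at h5
  exact mul_right_cancel h5

lemma exists_swap_v : ∃ t : G, t • m.pt = m.pnt 0 0 ∧ t • m.pnt 0 0 = m.pt ∧
    m.v ∈ Subgroup.zpowers (t * m.v * t⁻¹) := by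
  obtain ⟨t, h1, h2⟩ := m.swap
  have h1' : t⁻¹ • m.pt = m.pnt 0 0 := by rw [inv_smul_eq_iff, h2]
  have h2' : t⁻¹ • m.pnt 0 0 = m.pt := by rw [inv_smul_eq_iff, h1]
  have h3 := m.conj_mem_K h1' h2' m.v_mem
  rw [inv_inv] at h3
  obtain ⟨k, hk, hkv⟩ := m.exists_conj_v h3 (by
    rw [← MulAut.conj_apply, MulEquiv.orderOf_eq, m.orderOf_v])
  rw [mem_K] at hk
  refine ⟨k * t, by rw [mul_smul, h1, hk.2], by rw [mul_smul, h2, hk.1], ?_⟩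
  convert hkv using 2
  group

lemma eq_z_of_smul_pnt {y : G} (hv : Commute y m.v) (h1 : y ≠ 1) (h2 : y * y = 1) {a : F89}
    (ha : y • m.pnt 0 a = m.pnt 0 a) : y = m.z := by
  obtain ⟨t, ht1, ht2, htv⟩ := m.exists_swap_v
  have hT : Commute (m.T 0 a) m.v := (m.v_comm_T a).symm
  set x := t * (m.T 0 a)⁻¹ with hx
  have hxz : x * m.z * x⁻¹ = m.z := by
    have h3 : Commute (m.T 0 a) m.z := (m.z_comm_T a).symm
    have h4 : Commute t m.z := (m.z_comm_swap ht1 ht2).symm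
    have h6 : Commute x m.z := h4.mul_left h3.inv_left
    rw [h6.eq, mul_inv_cancel_right]
  have h3 : x * y * x⁻¹ = m.z := by
    refine m.eq_z_of_smul_pt ?_ ?_ ?_ ?_
    · obtain ⟨n, hn⟩ := htv
      rw [← hn]
      apply Commute.zpow_right
      have h4 : Commute ((m.T 0 a)⁻¹ * y * m.T 0 a) m.v := (hT.inv_left.mul_left hv).mul_left hT
      have h5 := congrArg (fun g => t * g * t⁻¹) h4.eq
      rw [commute_iff_eq, hx]
      simpa [mul_assoc] using h5
    · rwa [Ne, conj_eq_one_iff]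
    · calc _ = x * (y * y) * x⁻¹ := by group
        _ = 1 := by rw [h2]; group
    · have h4 : x⁻¹ • m.pt = m.pnt 0 a := by
        rw [inv_smul_eq_iff, hx, mul_smul, eq_comm, ← ht2]
        congr 1
        rw [inv_smul_eq_iff, m.T_o]
      rw [mul_smul, mul_smul, h4, ha, ← h4, smul_inv_smul]
  have h6 := h3.trans hxz.symm
  exact mul_left_cancel (mul_right_cancel h6)

lemma exists_conj_z : ∃ y : G, y ≠ m.z ∧ y ≠ 1 ∧ y * y = 1 ∧ Commute y m.v := by
  have := m.finite
  have : Fact (Nat.Prime 5) := ⟨by norm_num⟩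
  set H := Subgroup.centralizer {m.z} with hH
  have hcard : Nat.card (G ⧸ H) = 7921 * 7833 := by
    have h1 := Subgroup.card_eq_card_quotient_mul_card_subgroup H
    rw [m.card, hH, m.card_centralizer_z, ← hH, ordU] at h1
    omega
  have hp : IsPGroup 5 (Subgroup.zpowers m.v) := by
    refine IsPGroup.of_card (n := 1) ?_
    rw [Nat.card_zpowers, m.orderOf_v, pow_one]
  have h1 := hp.card_modEq_card_fixedPoints (G ⧸ H)
  rw [hcard] at h1
  have h2 : (1 : ℕ) < Nat.card (MulAction.fixedPoints (Subgroup.zpowers m.v) (G ⧸ H)) := by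
    unfold Nat.ModEq at h1
    omega
  have h0 : ((1 : G) : G ⧸ H) ∈ MulAction.fixedPoints (Subgroup.zpowers m.v) (G ⧸ H) := by
    rintro ⟨_, n, rfl⟩
    change ((m.v ^ n * 1 : G) : G ⧸ H) = _
    rw [eq_comm, QuotientGroup.eq, inv_one, one_mul, mul_one]
    refine Subgroup.zpow_mem _ ?_ _
    rw [hH, Subgroup.mem_centralizer_singleton_iff, m.z_comm_K m.v_mem]
  rw [Finite.one_lt_card_iff_nontrivial] at h2
  obtain ⟨⟨x, hx⟩, hx1⟩ := exists_ne (⟨_, h0⟩ : MulAction.fixedPoints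
    (Subgroup.zpowers m.v) (G ⧸ H))
  obtain ⟨g, rfl⟩ := QuotientGroup.mk_surjective x
  have h3 : ((g : G) : G ⧸ H) = ((m.v * g : G) : G ⧸ H) := (hx ⟨m.v, Subgroup.mem_zpowers _⟩).symm
  rw [QuotientGroup.eq, hH, Subgroup.mem_centralizer_singleton_iff] at h3
  refine ⟨g * m.z * g⁻¹, ?_, ?_, ?_, ?_⟩
  · intro h
    apply hx1
    apply Subtype.ext
    change ((g : G) : G ⧸ H) = _
    rw [eq_comm, QuotientGroup.eq, inv_one, one_mul, hH, Subgroup.mem_centralizer_singleton_iff]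
    rwa [mul_inv_eq_iff_eq_mul] at h
  · rw [Ne, conj_eq_one_iff]
    exact m.z_ne_one
  · calc _ = g * (m.z * m.z) * g⁻¹ := by group
      _ = 1 := by rw [m.z_mul_z]; group
  · have h5 := congrArg (fun y => g * y * g⁻¹) h3
    rw [commute_iff_eq]
    simpa [mul_assoc] using h5.symm

/-- An involution interchanging the two base points and commuting with `v`. -/
theorem exists_s : ∃ s : G, s * s = 1 ∧ s • m.pt = m.pnt 0 0 ∧ s • m.pnt 0 0 = m.pt ∧
    Commute s m.v ∧ Commute s m.z ∧ ∀ a, s • m.pnt 0 a ≠ m.pnt 0 a := by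
  obtain ⟨y, hyz, hy1, hy2, hyv⟩ := m.exists_conj_z
  have hpt : y • m.pt ≠ m.pt := fun h => hyz (m.eq_z_of_smul_pt hyv hy1 hy2 h)
  obtain ⟨a, ha⟩ := (m.fix_v (m.smul_fix_v hyv m.v_pt)).resolve_left hpt
  have hT : Commute (m.T 0 a) m.v := (m.v_comm_T a).symm
  set s := (m.T 0 a)⁻¹ * y * m.T 0 a with hs
  have hs1 : s • m.pt = m.pnt 0 0 := by
    rw [hs, mul_smul, mul_smul, m.T_pt, ha, inv_smul_eq_iff, m.T_o]
  have hs2 : s * s = 1 := by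
    calc _ = (m.T 0 a)⁻¹ * (y * y) * m.T 0 a := by rw [hs]; group
      _ = 1 := by rw [hy2]; group
  have hsv : Commute s m.v := (hT.inv_left.mul_left hyv).mul_left hT
  refine ⟨s, hs2, hs1, ?_, hsv, m.commute_z_of_commute_v hsv, fun b hb => ?_⟩
  · rw [← hs1, ← mul_smul, hs2, one_smul]
  · have h1 := m.eq_z_of_smul_pnt hsv (fun h => ?_) hs2 hb
    · rw [h1, m.z_pt] at hs1
      exact m.ne _ _ hs1.symm
    · rw [h, one_smul] at hs1
      exact m.ne _ _ hs1.symm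

end Model

end

/-- The norm map on units. -/
def normU : E89ˣ →* F89ˣ := Units.map (QuadraticAlgebra.norm : E89 →* F89)

lemma coe_normU (x : E89ˣ) : (normU x : F89) = (x : E89).norm := rfl

lemma card_F89_units : Nat.card F89ˣ = 88 := by
  rw [Nat.card_units, Nat.card_zmod]

lemma card_E89_units : Nat.card E89ˣ = 7920 := by
  rw [Nat.card_units, card_E89]

lemma normU_surjective : Function.Surjective normU := by
  intro c
  have h : ∀ c : F89, ∃ a b : F89, a * a - 3 * (b * b) = c := by decide +kernel
  obtain ⟨a, b, hab⟩ := h c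
  have h1 : (⟨a, b⟩ : E89).norm = c := by
    rw [QuadraticAlgebra.norm_def, ← hab]
    ring
  have h2 : (⟨a, b⟩ : E89) ≠ 0 := by
    intro h3
    rw [h3, QuadraticAlgebra.norm_zero] at h1
    exact c.ne_zero h1.symm
  exact ⟨Units.mk0 _ h2, Units.ext h1⟩

lemma card_ker_normU : Nat.card normU.ker = 90 := by
  have h1 := normU.ker.card_mul_index
  rw [Subgroup.index_ker, MonoidHom.range_eq_top.2 normU_surjective, Subgroup.card_top,
    card_F89_units, card_E89_units] at h1
  omega

lemma card_inf_ker_mul (A : Subgroup E89ˣ) :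
    Nat.card (normU.ker ⊓ A : Subgroup E89ˣ) * Nat.card (A.map normU) = Nat.card A := by
  have h1 := (normU.ker.subgroupOf A).card_mul_index
  rw [← h1, ← Subgroup.relIndex_ker, Subgroup.relIndex, ← Subgroup.inf_subgroupOf_right,
    Nat.card_congr (Subgroup.subgroupOfEquivOfLe (inf_le_right : normU.ker ⊓ A ≤ A)).toEquiv]

lemma eq_zeta {κ : E89} (h1 : κ.norm = 1) (h2 : 2 * κ.re = 9) : κ = zeta ∨ κ = star zeta := by
  have e : (89 : F89) = 0 := by decide
  have h3 : κ.re = 49 := by linear_combination 45 * h2 - (κ.re - 4) * e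
  rw [QuadraticAlgebra.norm_def, h3] at h1
  have h4 : ∀ b : F89, 49 * 49 - 3 * (b * b) = 1 → b = 34 ∨ b = -34 := by decide +kernel
  rcases h4 κ.im (by linear_combination h1) with h | h
  · exact .inl (by ext; exacts [h3, h])
  · refine .inr (QuadraticAlgebra.ext ?_ ?_)
    · rw [h3]; decide
    · rw [h]; decide

section

variable {G Ω : Type*} [Group G] [MulAction G Ω]

namespace Model

variable (m : Model G Ω)

/-- `k` acts as multiplication by `κ`. -/
def Acts (k : G) (κ : E89) : Prop :=
  k • m.pt = m.pt ∧ ∀ u a, k • m.pnt u a = m.pnt (κ * u) (κ.norm * a)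

variable {m}

lemma Acts.mem_K {k : G} {κ : E89} (h : m.Acts k κ) : k ∈ m.K :=
  m.mem_K.2 ⟨h.1, by rw [h.2]; simp⟩

lemma Acts.commute {k : G} {κ : E89} (h : m.Acts k κ) : Commute k m.v := by
  refine m.ext ?_ fun u a => ?_
  · rw [mul_smul, mul_smul, h.1, m.v_pt, h.1]
  · rw [mul_smul, mul_smul, m.v_pnt, h.2, h.2, m.v_pnt, mul_left_comm]

lemma Acts.mul {k l : G} {κ μ : E89} (h : m.Acts k κ) (h' : m.Acts l μ) :
    m.Acts (k * l) (κ * μ) :=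
  ⟨by rw [mul_smul, h'.1, h.1], fun u a => by
    rw [mul_smul, h'.2, h.2, mul_assoc, map_mul, mul_assoc]⟩

lemma acts_one : m.Acts 1 1 := ⟨one_smul _ _, fun u a => by simp⟩

lemma Acts.inv {k : G} {κ : E89} (h : m.Acts k κ) (h0 : κ ≠ 0) : m.Acts k⁻¹ κ⁻¹ := by
  refine ⟨by rw [inv_smul_eq_iff, h.1], fun u a => ?_⟩
  rw [inv_smul_eq_iff, h.2, ← mul_assoc, ← mul_assoc, ← map_mul, mul_inv_cancel₀ h0, map_one,
    one_mul, one_mul]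

lemma Acts.unique {k l : G} {κ : E89} (h : m.Acts k κ) (h' : m.Acts l κ) : k = l :=
  m.ext (by rw [h.1, h'.1]) fun u a => by rw [h.2, h'.2]

lemma Acts.unique' {k : G} {κ μ : E89} (h : m.Acts k κ) (h' : m.Acts k μ) : κ = μ := by
  have h1 := (h.2 1 0).symm.trans (h'.2 1 0)
  simpa using (m.inj _ _ _ _ h1).1

lemma acts_v : m.Acts m.v zeta := ⟨m.v_pt, fun u a => by rw [m.v_pnt, norm_zeta, one_mul]⟩

lemma acts_z : m.Acts m.z (-1) := ⟨m.z_pt, fun u a => by rw [m.z_pnt]; simp⟩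

lemma exists_acts {k : G} (hk : k ∈ m.K) (hv : Commute k m.v) : ∃ κ : E89ˣ, m.Acts k κ := by
  obtain ⟨κ, h0, h⟩ := m.exists_mul hk hv.eq
  exact ⟨Units.mk0 κ h0, hk.1, h⟩

variable (m)

/-- The group of multipliers. -/
def A : Subgroup E89ˣ where
  carrier := {κ | ∃ k, m.Acts k κ}
  mul_mem' := by
    rintro κ μ ⟨k, hk⟩ ⟨l, hl⟩
    exact ⟨k * l, hk.mul hl⟩
  one_mem' := ⟨1, acts_one⟩
  inv_mem' := by
    rintro κ ⟨k, hk⟩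
    refine ⟨k⁻¹, ?_⟩
    have := hk.inv κ.ne_zero
    rwa [← Units.val_inv_eq_inv_val] at this

lemma mem_A {κ : E89ˣ} : κ ∈ m.A ↔ ∃ k, m.Acts k κ := Iff.rfl

/-- The centraliser of `v` in the two-point stabiliser. -/
def C : Subgroup m.K := Subgroup.centralizer {⟨m.v, m.v_mem⟩}

lemma mem_C {k : m.K} : k ∈ m.C ↔ Commute (k : G) m.v := by
  rw [C, Subgroup.mem_centralizer_singleton_iff]
  exact Subtype.ext_iff

lemma card_A : Nat.card m.A = Nat.card m.C := by
  choose f hf using fun x : m.A => m.mem_A.1 x.2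
  refine Nat.card_congr (Equiv.ofBijective
    (fun x => (⟨⟨f x, (hf x).mem_K⟩, m.mem_C.2 (hf x).commute⟩ : m.C)) ⟨?_, ?_⟩)
  · intro x y h
    have h1 : f x = f y := congrArg (fun k : m.C => ((k : m.K) : G)) h
    have h2 := hf x
    rw [h1] at h2
    exact Subtype.ext (Units.ext (h2.unique' (hf y)))
  · rintro ⟨⟨k, hk⟩, hkv⟩
    obtain ⟨κ, hκ⟩ := exists_acts hk (m.mem_C.1 hkv)
    exact ⟨⟨κ, k, hκ⟩, Subtype.ext (Subtype.ext ((hf ⟨κ, k, hκ⟩).unique hκ))⟩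

lemma ten_dvd : 10 ∣ Nat.card (normU.ker ⊓ m.A : Subgroup E89ˣ) := by
  have h2 : orderOf (-1 : E89ˣ) = 2 := by
    refine orderOf_eq_prime (by simp) fun h => ?_
    have h1 := congrArg (fun x : E89ˣ => (x : E89).re) h
    exact absurd h1 (by decide)
  have hz0 : zeta ≠ 0 := fun h => absurd (congrArg QuadraticAlgebra.im h) (by decide)
  have : Fact (Nat.Prime 5) := ⟨by norm_num⟩
  have h5 : orderOf (Units.mk0 zeta hz0) = 5 := by
    refine orderOf_eq_prime (Units.ext zeta_pow_five) fun h => ?_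
    exact zeta_ne_one (congrArg Units.val h)
  have m2 : (-1 : E89ˣ) ∈ normU.ker ⊓ m.A := by
    refine ⟨Units.ext ?_, m.z, acts_z⟩
    rw [coe_normU, QuadraticAlgebra.norm_def]
    decide
  have m5 : Units.mk0 zeta hz0 ∈ normU.ker ⊓ m.A := ⟨Units.ext norm_zeta, m.v, acts_v⟩
  refine Nat.Coprime.mul_dvd_of_dvd_of_dvd (m := 2) (n := 5) (by norm_num) ?_ ?_
  · rw [← h2, ← Subgroup.orderOf_mk _ m2]
    exact orderOf_dvd_natCard _
  · rw [← h5, ← Subgroup.orderOf_mk _ m5]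
    exact orderOf_dvd_natCard _

/-- A conjugate of `v` commuting with `v` is `v` or its inverse. -/
lemma conj_v {g w : G} (hg : g ∈ m.K) (hw : w ∈ m.K) (hwv : Commute w m.v)
    (h : m.v * g = g * w) : w = m.v ∨ w = m.v⁻¹ := by
  obtain ⟨M, d, hM, hs⟩ := m.exists_aut g hg.1 hg.2
  obtain ⟨κ, hκ⟩ := exists_acts hw hwv
  have hM' : ∀ u, M (κ * u) = zeta * M u := by
    intro u
    have h1 := congrArg (· • m.pnt u 0) h
    simp only [mul_smul, hM, m.v_pnt, hκ.2] at h1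
    exact (m.inj _ _ _ _ h1).1.symm
  have hd : d ≠ 0 := by
    rintro rfl
    have h1 := (hM 0 1).trans (by rw [zero_mul, map_zero])
    rw [← (m.mem_K.1 hg).2] at h1
    exact absurd (m.inj _ _ _ _ (smul_left_cancel _ h1)).2 (by decide)
  have hn : (κ : E89).norm = 1 := by
    have h1 := hs (κ * 1) (κ * ⟨0, 1⟩)
    rw [hM', hM', sym_mul, sym_mul, hs, norm_zeta, one_mul] at h1
    have h2 : sym (1 : E89) ⟨0, 1⟩ = 1 := by decide
    rw [h2, mul_one] at h1
    rw [mul_one] at h1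
    exact mul_left_cancel₀ hd (h1.symm.trans (mul_one d).symm)
  have hne : M 1 ≠ 0 := by
    intro h0
    have h1 := hs 1 ⟨0, 1⟩
    rw [h0, zero_sym] at h1
    exact hd (by simpa [sym] using h1.symm)
  have htr : ∀ x : E89, x * x = (2 * x.re) • x - x.norm • 1 := by
    intro x
    rw [QuadraticAlgebra.norm_def]
    ext <;> simp <;> ring
  have h1 : (2 * (κ : E89).re) • zeta = (2 * zeta.re) • zeta := by
    have h2 : M (κ * (κ * 1)) = M ((2 * (κ : E89).re) • (κ * 1) - (1 : F89) • 1) := by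
      rw [← mul_assoc, htr, mul_one, hn, mul_one]
    rw [hM', map_sub, ZMod.map_smul, ZMod.map_smul, hM', ← mul_assoc, htr zeta, norm_zeta] at h2
    have h3 : ((2 * (κ : E89).re) • zeta - (2 * zeta.re) • zeta) * M 1 = 0 := by
      rw [sub_mul, smul_mul_assoc, smul_mul_assoc]
      rw [sub_mul, smul_mul_assoc, one_smul, one_smul, one_mul] at h2
      rw [sub_left_inj] at h2
      rw [h2, sub_self]
    exact sub_eq_zero.1 ((mul_eq_zero.1 h3).resolve_right hne)
  have h2 : 2 * (κ : E89).re = 9 := by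
    have h3 := congrArg QuadraticAlgebra.im h1
    simp only [QuadraticAlgebra.im_smul, smul_eq_mul] at h3
    rw [mul_left_inj' (by decide)] at h3
    rw [h3]
    decide
  rcases eq_zeta hn h2 with h3 | h3
  · rw [h3] at hκ
    exact .inl (hκ.unique acts_v)
  · have h4 : zeta * κ = 1 := by
      rw [h3]
      ext <;> decide
    refine .inr (eq_inv_of_mul_eq_one_right ?_)
    have h5 := acts_v.mul hκ
    rw [h4] at h5
    exact h5.unique acts_one

lemma index_C_mod : m.C.index % 5 = 1 ∨ m.C.index % 5 = 2 := by
  have := m.finite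
  have : Fact (Nat.Prime 5) := ⟨by norm_num⟩
  set v : m.K := ⟨m.v, m.v_mem⟩ with hv
  have hp : IsPGroup 5 (Subgroup.zpowers v) := by
    refine IsPGroup.of_card (n := 1) ?_
    rw [Nat.card_zpowers, Subgroup.orderOf_mk, m.orderOf_v, pow_one]
  have h1 := hp.card_modEq_card_fixedPoints (m.K ⧸ m.C)
  change m.C.index ≡ _ [MOD 5] at h1
  have hmem : ∀ k : m.K, k ∈ m.C ↔ k * v = v * k := fun k =>
    Subgroup.mem_centralizer_singleton_iff
  set X := MulAction.fixedPoints (Subgroup.zpowers v) (m.K ⧸ m.C)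
  have h0 : ((1 : m.K) : m.K ⧸ m.C) ∈ X := by
    rintro ⟨_, n, rfl⟩
    change ((v ^ n * 1 : m.K) : m.K ⧸ m.C) = _
    rw [eq_comm, QuotientGroup.eq, inv_one, one_mul, mul_one]
    exact Subgroup.zpow_mem _ ((hmem _).2 rfl) _
  have h2 : 0 < Nat.card X := by
    have : Nonempty X := ⟨_, h0⟩
    exact Nat.card_pos
  have h3 : Nat.card X ≤ 2 := by
    have hX : ∀ x : X, ∃ g : m.K, (g : m.K ⧸ m.C) = x ∧ (g * v * g⁻¹ = v ∨ g * v * g⁻¹ = v⁻¹) := by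
      rintro ⟨x, hx⟩
      obtain ⟨g, rfl⟩ := QuotientGroup.mk_surjective x
      refine ⟨g, rfl, ?_⟩
      have h3 : ((g : m.K) : m.K ⧸ m.C) = ((v * g : m.K) : m.K ⧸ m.C) :=
        (hx ⟨v, Subgroup.mem_zpowers _⟩).symm
      rw [QuotientGroup.eq, m.mem_C] at h3
      rcases m.conj_v g.2 (g⁻¹ * (v * g)).2 h3 (by simp [hv]) with h4 | h4
      · have h5 : g⁻¹ * (v * g) = v := Subtype.ext h4
        rw [inv_mul_eq_iff_eq_mul] at h5
        exact .inl (mul_inv_eq_iff_eq_mul.2 h5.symm)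
      · have h5 : v = (g⁻¹ * (v * g))⁻¹ := by
          rw [show g⁻¹ * (v * g) = v⁻¹ from Subtype.ext h4, inv_inv]
        right
        nth_rewrite 1 [h5]
        group
    choose f hf1 hf2 using hX
    have hinj : Function.Injective fun x : X => (⟨f x * v * (f x)⁻¹, hf2 x⟩ :
        ({v, v⁻¹} : Set m.K)) := by
      intro x y h
      apply Subtype.ext
      rw [← hf1, ← hf1, QuotientGroup.eq, hmem]
      have h4 : f x * v * (f x)⁻¹ = f y * v * (f y)⁻¹ := congrArg Subtype.val h
      calc (f x)⁻¹ * f y * v = (f x)⁻¹ * (f y * v * (f y)⁻¹) * f y := by group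
        _ = v * ((f x)⁻¹ * f y) := by rw [← h4]; group
    have h4 := Nat.card_le_card_of_injective _ hinj
    refine h4.trans ?_
    rw [Nat.card_coe_set_eq]
    exact (Set.ncard_insert_le _ _).trans (by rw [Set.ncard_singleton])
  unfold Nat.ModEq at h1
  omega

end Model

end

lemma even_arith {e j i : ℕ} (he : e ∣ 88) (hj : j ∣ 90) (h10 : 10 ∣ j) (h : j * e * i = 2640)
    (hi : i % 5 = 1 ∨ i % 5 = 2) : 2 ∣ e ∧ (e = 88 → j * e = 2640) := by
  have he' : e ∈ Nat.divisors 88 := Nat.mem_divisors.2 ⟨he, by norm_num⟩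
  have hj' : j ∈ Nat.divisors 90 := Nat.mem_divisors.2 ⟨hj, by norm_num⟩
  rw [show Nat.divisors 88 = {1, 2, 4, 8, 11, 22, 44, 88} by decide +kernel] at he'
  rw [show Nat.divisors 90 = {1, 2, 3, 5, 6, 9, 10, 15, 18, 30, 45, 90} by decide +kernel] at hj'
  simp only [Finset.mem_insert, Finset.mem_singleton] at he' hj'
  have hj'' : j = 10 ∨ j = 30 ∨ j = 90 := by omega
  rcases hj'' with rfl | rfl | rfl <;>
    rcases he' with rfl | rfl | rfl | rfl | rfl | rfl | rfl | rfl <;> omega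

lemma card_le_two_mul_ncard_range {α β : Type*} [Finite α] (f : α → β)
    (h : ∀ a b c, f a = f b → f a = f c → a ≠ b → a ≠ c → b ≠ c → False) :
    Nat.card α ≤ 2 * (Set.range f).ncard := by
  classical
  cases nonempty_fintype α
  rw [Nat.card_eq_fintype_card, ← Finset.card_univ, ← Set.image_univ, ← Finset.coe_univ,
    ← Finset.coe_image, Set.ncard_coe_finset]
  refine Finset.card_le_mul_card_image Finset.univ 2 fun ε _ => ?_
  by_contra! hlt
  obtain ⟨a, ha, b, hb, c, hc, hab, hac, hbc⟩ := Finset.two_lt_card.1 hlt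
  simp only [Finset.mem_filter, Finset.mem_univ, true_and] at ha hb hc
  exact h a b c (ha.trans hb.symm) (ha.trans hc.symm) hab hac hbc

lemma eq_top_of_range_subset {α : Type*} {f : α → F89ˣ} (h : 44 ≤ (Set.range f).ncard)
    (h1 : (1 : F89ˣ) ∉ Set.range f) {B : Subgroup F89ˣ} (hB : ∀ a, f a ∈ B) : B = ⊤ := by
  have h3 : 45 ≤ Nat.card B := by
    have h4 : insert 1 (Set.range f) ⊆ (B : Set F89ˣ) := by
      rintro x (rfl | ⟨a, rfl⟩)
      · exact one_mem B
      · exact hB a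
    have h5 := Set.ncard_le_ncard h4 (Set.toFinite _)
    rw [Set.ncard_insert_of_notMem h1 (Set.toFinite _)] at h5
    change _ ≤ Nat.card B at h5
    omega
  apply Subgroup.eq_top_of_card_eq
  obtain ⟨n, hn⟩ := Subgroup.card_subgroup_dvd_card B
  rw [card_F89_units] at hn ⊢
  rcases n with _ | _ | n
  · omega
  · omega
  · nlinarith

/-- A model together with an involution interchanging the two base points. -/
structure SModel (G Ω : Type*) [Group G] [MulAction G Ω] extends Model G Ω where
  /-- the involution -/
  s : G
  s_mul_s : s * s = 1
  s_pt : s • pt = pnt 0 0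
  s_o : s • pnt 0 0 = pt
  s_v : Commute s v
  s_ne : ∀ a, s • pnt 0 a ≠ pnt 0 a

section

variable {G Ω : Type*} [Group G] [MulAction G Ω]

namespace Model

variable (m : Model G Ω)

theorem exists_sModel : ∃ M : SModel G Ω, M.toModel = m := by
  obtain ⟨s, h1, h2, h3, h4, -, h5⟩ := m.exists_s
  exact ⟨⟨m, s, h1, h2, h3, h4, h5⟩, rfl⟩

lemma card_C_mul_index : Nat.card m.A * m.C.index = 2640 := by
  rw [card_A, Subgroup.card_mul_index]
  exact m.card_K

lemma arith_A : 2 ∣ Nat.card (m.A.map normU) ∧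
    (Nat.card (m.A.map normU) = 88 → Nat.card m.A = 2640) := by
  rw [← card_inf_ker_mul]
  refine even_arith ?_ ?_ m.ten_dvd ?_ m.index_C_mod
  · rw [← card_F89_units]
    exact Subgroup.card_subgroup_dvd_card _
  · rw [← card_ker_normU]
    exact Subgroup.card_dvd_of_le inf_le_left
  · rw [card_inf_ker_mul, card_C_mul_index]

/-- Some element of the two-point stabiliser commuting with `v` has multiplier of norm `-1`. -/
lemma exists_norm_eq_neg_one : ∃ k κ, m.Acts k κ ∧ κ.norm = -1 := by
  have : Fact (Nat.Prime 2) := ⟨by norm_num⟩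
  obtain ⟨⟨x, hxA⟩, hx⟩ := exists_prime_orderOf_dvd_card' 2 m.arith_A.1
  rw [Subgroup.orderOf_mk] at hx
  obtain ⟨κ, ⟨k, hk⟩, rfl⟩ := hxA
  refine ⟨k, κ, hk, ?_⟩
  have h1 : (normU κ : F89) * normU κ = 1 := by
    rw [← Units.val_mul, ← pow_two, ← hx, pow_orderOf_eq_one, Units.val_one]
  refine (mul_self_eq_one_iff.1 h1).resolve_left fun h => ?_
  rw [Units.val_eq_one.1 h, orderOf_one] at hx
  norm_num at hx

/-- An element commuting with `v` and fixing three points fixed by `v` fixes all of them. -/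
lemma smul_pt_of_three {y : G} (hv : Commute y m.v) {s : G} (hs1 : s • m.pt = m.pnt 0 0)
    (hs2 : s • m.pnt 0 0 = m.pt) (hsv : Commute s m.v) {a b c : F89} (hab : a ≠ b) (hac : a ≠ c)
    (hbc : b ≠ c) (ha : y • m.pnt 0 a = m.pnt 0 a) (hb : y • m.pnt 0 b = m.pnt 0 b)
    (hc : y • m.pnt 0 c = m.pnt 0 c) : y • m.pt = m.pt := by
  have key : ∀ {g : G}, Commute g m.v → g • m.pt = m.pt → ∃ b ε : F89, ∀ a,
      g • m.pnt 0 a = m.pnt 0 (b + ε * a) := by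
    intro g hg hpt
    obtain ⟨b, hb⟩ : ∃ b, g • m.pnt 0 0 = m.pnt 0 b :=
      (m.fix_v (m.smul_fix_v hg (m.v_pnt_zero 0))).resolve_left fun h =>
        m.ne _ _ (smul_left_cancel _ (h.trans hpt.symm))
    obtain ⟨κ, -, hκ⟩ := m.exists_mul (m.exists_T_mul_mem_K hpt hb)
      (Commute.mul_left (Commute.inv_left (m.v_comm_T b).symm) hg).eq
    refine ⟨b, κ.norm, fun a => ?_⟩
    have h3 := hκ 0 a
    rw [mul_smul, inv_smul_eq_iff, m.T_pnt] at h3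
    simpa using h3
  have hTa : ∀ x, (m.T 0 a)⁻¹ • m.pnt 0 x = m.pnt 0 (x - a) := by
    intro x
    rw [m.T_inv, m.T_pnt]
    simp [sub_eq_neg_add]
  have hT : Commute (m.T 0 a) m.v := (m.v_comm_T a).symm
  set g := s * (m.T 0 a)⁻¹ with hg
  have hgv : Commute g m.v := hsv.mul_left hT.inv_left
  have hga : g • m.pnt 0 a = m.pt := by rw [hg, mul_smul, hTa, sub_self, hs2]
  have hgx : ∀ x, x ≠ a → ∃ x', g • m.pnt 0 x = m.pnt 0 x' := by
    intro x hx
    refine (m.fix_v (m.smul_fix_v hgv (m.v_pnt_zero x))).resolve_left fun h => ?_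
    rw [← hga] at h
    exact hx (m.inj _ _ _ _ (smul_left_cancel _ h)).2
  have hfix : ∀ {x : Ω}, y • x = x → (g * y * g⁻¹) • g • x = g • x := by
    intro x hx
    rw [mul_smul, mul_smul, inv_smul_smul, hx]
  obtain ⟨β, ε, h1⟩ := key ((hgv.mul_left hv).mul_left hgv.inv_left) (hga ▸ hfix ha)
  obtain ⟨b', hb'⟩ := hgx b hab.symm
  obtain ⟨c', hc'⟩ := hgx c hac.symm
  have hbc' : b' ≠ c' := by
    rintro rfl
    exact hbc (m.inj _ _ _ _ (smul_left_cancel _ (hb'.trans hc'.symm))).2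
  have h2 := hfix hb
  have h3 := hfix hc
  rw [hb', h1] at h2
  rw [hc', h1] at h3
  have h2' := (m.inj _ _ _ _ h2).2
  have h3' := (m.inj _ _ _ _ h3).2
  have hε : ε = 1 := by
    have h4 : (ε - 1) * (b' - c') = 0 := by linear_combination h2' - h3'
    exact sub_eq_zero.1 ((mul_eq_zero.1 h4).resolve_right (sub_ne_zero.2 hbc'))
  have hβ : β = 0 := by rw [hε] at h2'; linear_combination h2'
  have h5 : g • m.pt = m.pnt 0 0 := by rw [hg, mul_smul, inv_smul_eq_iff.2 (m.T_pt _ _).symm, hs1]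
  have h6 := h1 0
  rw [hε, hβ, ← h5, mul_smul, mul_smul, inv_smul_smul] at h6
  simp only [mul_zero, add_zero, ← h5] at h6
  exact smul_left_cancel _ h6

end Model

namespace SModel

variable (m : SModel G Ω)

lemma s_smul_s (x : Ω) : m.s • m.s • x = x := by rw [← mul_smul, m.s_mul_s, one_smul]

lemma exists_sigma : ∃ σ : F89 → F89, ∀ a, a ≠ 0 → σ a ≠ 0 ∧ m.s • m.pnt 0 a = m.pnt 0 (σ a) := by
  have h : ∀ a : F89, ∃ b, a ≠ 0 → b ≠ 0 ∧ m.s • m.pnt 0 a = m.pnt 0 b := by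
    intro a
    by_cases ha : a = 0
    · exact ⟨0, fun h => absurd ha h⟩
    · obtain ⟨b, hb⟩ : ∃ b, m.s • m.pnt 0 a = m.pnt 0 b := by
        refine (m.fix_v (m.smul_fix_v m.s_v (m.v_pnt_zero a))).resolve_left fun h => ?_
        rw [← m.s_o] at h
        exact ha (m.inj _ _ _ _ (smul_left_cancel _ h)).2
      refine ⟨b, fun _ => ⟨?_, hb⟩⟩
      rintro rfl
      rw [← m.s_pt] at hb
      exact m.ne _ _ (smul_left_cancel _ hb)
  choose σ hσ using h
  exact ⟨σ, hσ⟩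

/-- On the points fixed by `v` the involution is inversion up to a factor, and every unit is the
norm of a multiplier. -/
theorem exists_c : ∃ c : F89, (∀ a, a ≠ 0 → m.s • m.pnt 0 a = m.pnt 0 (c / a)) ∧
    m.A.map normU = ⊤ := by
  obtain ⟨σ, hσ⟩ := m.exists_sigma
  have hσσ : ∀ a, a ≠ 0 → σ (σ a) = a := by
    intro a ha
    have h1 := (hσ _ (hσ a ha).1).2
    rw [← (hσ a ha).2, m.s_smul_s] at h1
    exact (m.inj _ _ _ _ h1).2.symm
  obtain ⟨i, κi, hi, hκi⟩ := m.exists_norm_eq_neg_one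
  have hT : ∀ a, Commute (m.T 0 a) m.v := fun a => (m.v_comm_T a).symm
  have hT' : ∀ a x, m.T 0 a • m.pnt 0 x = m.pnt 0 (a + x) := by
    intro a x
    rw [m.T_pnt]
    simp
  have key : ∀ α : F89ˣ, ∃ κ : E89ˣ, ∃ k, m.Acts k κ ∧ κ.1.norm * σ α = α ∧
      ∀ a, a ≠ 0 → κ.1.norm * σ (κ.1.norm * σ a) = a := by
    intro α
    have hα : (α : F89) ≠ 0 := α.ne_zero
    have hα' : -(α : F89) ≠ 0 := neg_ne_zero.2 hα
    set b := σ (-α) * 45 with hb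
    have hb2 : b + b = σ (-α) := by
      have e : (89 : F89) = 0 := by decide
      rw [hb]
      linear_combination σ (-α) * e
    set x := m.T 0 α * m.s * m.T 0 b with hx
    set J := x * i * x⁻¹ with hJ
    have hxv : Commute x m.v := ((hT _).mul_left m.s_v).mul_left (hT _)
    have hJv : Commute J m.v := (hxv.mul_left hi.commute).mul_left hxv.inv_left
    have hxpt : x • m.pt = m.pnt 0 α := by
      rw [hx, mul_smul, mul_smul, m.T_pt, m.s_pt, hT', add_zero]
    have hxb : x • m.pnt 0 b = m.pnt 0 0 := by
      rw [hx, mul_smul, mul_smul, hT', hb2, ← (hσ _ hα').2, m.s_smul_s, hT', add_neg_cancel]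
    have hxb' : x • m.pnt 0 (-b) = m.pt := by
      rw [hx, mul_smul, mul_smul, hT', add_neg_cancel, m.s_o, m.T_pt]
    have hi' : ∀ a, i • m.pnt 0 a = m.pnt 0 (-a) := by
      intro a
      rw [hi.2, hκi]
      simp
    have hJα : J • m.pnt 0 α = m.pnt 0 α := by
      rw [← hxpt, hJ, mul_smul, mul_smul, inv_smul_smul, hi.1]
    have hJo : J • m.pnt 0 0 = m.pt := by
      rw [← hxb, hJ, mul_smul, mul_smul, inv_smul_smul, hi', hxb']
    have hJpt : J • m.pt = m.pnt 0 0 := by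
      rw [← hxb', hJ, mul_smul, mul_smul, inv_smul_smul, hi', neg_neg, hxb]
    have hJJ : ∀ a, J • J • m.pnt 0 a = m.pnt 0 a := by
      intro a
      rcases m.fix_v (m.smul_fix_v hxv.inv_left (m.v_pnt_zero a)) with h | ⟨b', h⟩
      · rw [inv_smul_eq_iff] at h
        rw [h, hJ, ← mul_smul, ← mul_smul,
          show x * i * x⁻¹ * (x * i * x⁻¹) * x = x * i * i by group, mul_smul, mul_smul, hi.1, hi.1]
      · rw [inv_smul_eq_iff] at h
        rw [h, hJ, ← mul_smul, ← mul_smul,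
          show x * i * x⁻¹ * (x * i * x⁻¹) * x = x * i * i by group, mul_smul, mul_smul, hi', hi',
          neg_neg]
    obtain ⟨κ, hκ⟩ := Model.exists_acts (m := m.toModel) (k := J * m.s)
      (m.mem_K.2 ⟨by rw [mul_smul, m.s_pt, hJo], by rw [mul_smul, m.s_o, hJpt]⟩)
        (hJv.mul_left m.s_v)
    have hJs : ∀ a, a ≠ 0 → J • m.pnt 0 a = m.pnt 0 (κ.1.norm * σ a) := by
      intro a ha
      have h1 := hκ.2 0 (σ a)
      rw [mul_smul, (hσ _ (hσ a ha).1).2, hσσ a ha, mul_zero] at h1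
      exact h1
    have hn : κ.1.norm ≠ 0 := (normU κ).ne_zero
    refine ⟨κ, _, hκ, ?_, fun a ha => ?_⟩
    · rw [hJs _ hα] at hJα
      exact (m.inj _ _ _ _ hJα).2
    · have h1 := hJJ a
      rw [hJs a ha, hJs _ (mul_ne_zero hn (hσ a ha).1)] at h1
      exact (m.inj _ _ _ _ h1).2
  choose κ k hk h1 h2 using key
  set f : F89ˣ → F89ˣ := fun α => normU (κ α) with hf
  have hcard : 44 ≤ (Set.range f).ncard := by
    have h3 := card_le_two_mul_ncard_range f fun a b c hab hac hab' hac' hbc' => ?_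
    · rw [card_F89_units] at h3
      omega
    have hy : ∀ x : F89ˣ, f a = f x → (k a * m.s) • m.pnt 0 (x : F89) = m.pnt 0 (x : F89) := by
      intro x hx
      rw [mul_smul, (hσ _ x.ne_zero).2, (hk a).2, mul_zero]
      congr 1
      have h3 : (κ a).1.norm = (κ x).1.norm := congrArg Units.val hx
      rw [h3, h1]
    have h3 := m.smul_pt_of_three ((hk a).commute.mul_left m.s_v) m.s_pt m.s_o m.s_v
      (fun h => hab' (Units.ext h)) (fun h => hac' (Units.ext h)) (fun h => hbc' (Units.ext h))
      (hy a rfl) (hy b hab) (hy c hac)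
    rw [mul_smul, m.s_pt, (m.mem_K.1 (hk a).mem_K).2] at h3
    exact m.ne _ _ h3
  have hf1 : (1 : F89ˣ) ∉ Set.range f := by
    rintro ⟨α, h3⟩
    have h4 := h1 α
    have h5 : (κ α).1.norm = 1 := congrArg Units.val h3
    rw [h5, one_mul] at h4
    have h6 := (hσ α α.ne_zero).2
    rw [h4] at h6
    exact m.s_ne _ h6
  have hσ1 := hσ 1 one_ne_zero
  let B : Subgroup F89ˣ :=
    { carrier := {ε | ∀ a : F89, a ≠ 0 → (ε : F89) * σ (ε * σ a) = a}
      one_mem' := fun a ha => by rw [Units.val_one, one_mul, one_mul, hσσ a ha]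
      mul_mem' := by
        intro x y hx hy a ha
        have h3 := hy a ha
        have h4 : (y * σ a : F89) ≠ 0 := mul_ne_zero y.ne_zero (hσ a ha).1
        have h5 := hx _ (hσ _ h4).1
        rw [hσσ _ h4] at h5
        rw [Units.val_mul, mul_assoc (x : F89) y (σ a), mul_comm (x : F89) y, mul_assoc, h5, h3]
      inv_mem' := by
        intro x hx a ha
        have hs0 := (hσ a ha).1
        have h4 : ((x⁻¹ : F89ˣ) * σ a : F89) ≠ 0 := mul_ne_zero (Units.ne_zero _) hs0
        have h3 := hx _ (hσ _ h4).1
        rw [hσσ _ h4, Units.mul_inv_cancel_left, hσσ a ha] at h3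
        rw [← h3, Units.inv_mul_cancel_left] }
  have hB : B = ⊤ := eq_top_of_range_subset hcard hf1 fun α a ha => h2 α a ha
  refine ⟨σ 1, fun a ha => ?_, eq_top_of_range_subset hcard hf1 fun α => ⟨κ α, ⟨_, hk α⟩, rfl⟩⟩
  rw [(hσ a ha).2]
  congr 1
  have h3 : (Units.mk0 a ha * (Units.mk0 _ hσ1.1)⁻¹) ∈ B := hB ▸ Subgroup.mem_top _
  have h4 := h3 1 one_ne_zero
  rw [Units.val_mul, Units.val_inv_eq_inv_val, Units.val_mk0, Units.val_mk0,
    inv_mul_cancel_right₀ hσ1.1] at h4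
  have h5 : a * σ a = σ 1 := by
    have h6 := congrArg (σ 1 * ·) h4
    simp only [mul_one] at h6
    rw [← h6]
    field_simp
    rw [mul_div_cancel_right₀ _ hσ1.1]
  rw [← h5, mul_div_cancel_left₀ _ ha]

end SModel

end

lemma pow_ninety {x : E89} (hx : x.norm = 1) : x ^ 90 = 1 := by
  have h0 : x ≠ 0 := by
    rintro rfl
    rw [QuadraticAlgebra.norm_zero] at hx
    exact zero_ne_one hx
  have h1 : (⟨Units.mk0 x h0, Units.ext hx⟩ : normU.ker) ^ 90 = 1 := by
    rw [← card_ker_normU, pow_card_eq_one']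
  exact congrArg (fun y : normU.ker => ((y : E89ˣ) : E89)) h1

lemma F89_pow {a : F89} (ha : a ≠ 0) : a ^ 88 = 1 := ZMod.pow_card_sub_one_eq_one ha

lemma mul_star_eq (x : E89) : x * star x = algebraMap F89 E89 x.norm :=
  (QuadraticAlgebra.algebraMap_norm_eq_mul_star x).symm

lemma norm_star (x : E89) : (star x).norm = x.norm := by
  simp only [QuadraticAlgebra.norm_def, QuadraticAlgebra.re_star, QuadraticAlgebra.im_star]
  ring

section

variable {G Ω : Type*} [Group G] [MulAction G Ω]

namespace SModel

variable (m : SModel G Ω)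

lemma norm_surj {a : F89} (ha : a ≠ 0) : ∃ k κ, m.Acts k κ ∧ κ.norm = a := by
  obtain ⟨c, -, h⟩ := m.exists_c
  have h1 : Units.mk0 a ha ∈ m.A.map normU := h ▸ Subgroup.mem_top _
  obtain ⟨κ, ⟨k, hk⟩, h2⟩ := h1
  exact ⟨k, κ, hk, congrArg Units.val h2⟩

lemma card_A_eq : Nat.card m.A = 2640 := by
  obtain ⟨c, -, h⟩ := m.exists_c
  refine m.arith_A.2 ?_
  rw [h, Subgroup.card_top, card_F89_units]

lemma exists_acts {k : G} (hk : k ∈ m.K) : ∃ κ : E89ˣ, m.Acts k κ := by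
  have h1 := m.card_C_mul_index
  rw [m.card_A_eq] at h1
  have h2 : m.C = ⊤ := Subgroup.index_eq_one.1 (by omega)
  exact Model.exists_acts hk ((m.mem_C (k := ⟨k, hk⟩)).1 (h2 ▸ Subgroup.mem_top _))

lemma mem_A_iff {κ : E89ˣ} : κ ∈ m.A ↔ κ ^ 2640 = 1 := by
  have hA : ∀ κ ∈ m.A, κ ^ 2640 = 1 := by
    intro κ hκ
    have h1 : (⟨κ, hκ⟩ : m.A) ^ 2640 = 1 := by rw [← m.card_A_eq, pow_card_eq_one']
    exact congrArg Subtype.val h1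
  refine ⟨hA κ, fun h => ?_⟩
  classical
  cases nonempty_fintype E89ˣ
  have h1 : (m.A : Set E89ˣ) = {x | x ^ 2640 = 1} := by
    refine Set.eq_of_subset_of_ncard_le hA ?_ (Set.toFinite _)
    change _ ≤ Nat.card m.A
    rw [m.card_A_eq]
    have h2 := IsCyclic.card_pow_eq_one_le (α := E89ˣ) (n := 2640) (by norm_num)
    rw [← Set.ncard_coe_finset] at h2
    simpa using h2
  have h2 : κ ∈ {x : E89ˣ | x ^ 2640 = 1} := h
  rw [← h1] at h2
  exact h2

lemma exists_acts_of_pow {κ : E89} (h : κ ^ 2640 = 1) : ∃ k, m.Acts k κ := by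
  have h0 : κ ≠ 0 := by
    rintro rfl
    rw [zero_pow (by norm_num)] at h
    exact zero_ne_one h
  exact m.mem_A_iff.2 (show Units.mk0 κ h0 ^ 2640 = 1 from Units.ext h)

variable {m}

lemma acts_ne_zero {k : G} {κ : E89} (h : m.Acts k κ) : κ ≠ 0 := by
  obtain ⟨κ', h'⟩ := m.exists_acts h.mem_K
  rw [h.unique' h']
  exact κ'.ne_zero

lemma acts_norm_ne_zero {k : G} {κ : E89} (h : m.Acts k κ) : κ.norm ≠ 0 := fun h0 =>
  acts_ne_zero h (QuadraticAlgebra.norm_eq_zero_iff_eq_zero.1 h0)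

lemma pow_eq_one {k : G} {κ : E89} (h : m.Acts k κ) : κ ^ 2640 = 1 :=
  congrArg Units.val (m.mem_A_iff.1
    (show Units.mk0 κ (acts_ne_zero h) ∈ m.A from ⟨k, h⟩))

lemma acts_pow {k : G} {κ : E89} (h : m.Acts k κ) (n : ℕ) : m.Acts (k ^ n) (κ ^ n) := by
  induction n with
  | zero => rw [pow_zero, pow_zero]; exact Model.acts_one
  | succ n ih => rw [pow_succ, pow_succ]; exact ih.mul h

lemma acts_comm {k l : G} {κ μ : E89} (h : m.Acts k κ) (h' : m.Acts l μ) : k * l = l * k :=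
  (h.mul h').unique (mul_comm μ κ ▸ h'.mul h)

lemma conj_s_mul (k l : G) : m.s * (k * l) * m.s = m.s * k * m.s * (m.s * l * m.s) := by
  have : m.s * k * m.s * (m.s * l * m.s) = m.s * k * (m.s * m.s) * l * m.s := by group
  rw [this, m.s_mul_s]
  group

lemma s_inv : m.s⁻¹ = m.s := inv_eq_of_mul_eq_one_right m.s_mul_s

lemma conj_s_s (k : G) : m.s * (m.s * k * m.s) * m.s = k := by
  have : m.s * (m.s * k * m.s) * m.s = (m.s * m.s) * k * (m.s * m.s) := by group
  rw [this, m.s_mul_s]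
  group

/-- Conjugation of a translation along the centre by an element of the two-point stabiliser. -/
lemma acts_T {k : G} {κ : E89} (h : m.Acts k κ) (a : F89) :
    k * m.T 0 a = m.T 0 (κ.norm * a) * k := by
  refine m.ext ?_ fun u b => ?_
  · rw [mul_smul, mul_smul, m.T_pt, h.1, m.T_pt]
  · rw [mul_smul, mul_smul, m.T_pnt, h.2, h.2, m.T_pnt]
    simp [mul_add]

lemma exists_conj {c : F89} (hc : ∀ a, a ≠ 0 → m.s • m.pnt 0 a = m.pnt 0 (c / a)) {k : G} {κ : E89}
    (h : m.Acts k κ) : ∃ κ', m.Acts (m.s * k * m.s) κ' ∧ κ'.norm * κ.norm = 1 := by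
  obtain ⟨κ', h'⟩ := m.exists_acts (k := m.s * k * m.s) (m.mem_K.2
    ⟨by rw [mul_smul, mul_smul, m.s_pt, (m.mem_K.1 h.mem_K).2, m.s_o],
      by rw [mul_smul, mul_smul, m.s_o, h.1, m.s_pt]⟩)
  refine ⟨κ', h', ?_⟩
  have hc0 : c ≠ 0 := by
    rintro rfl
    have h1 := hc 1 one_ne_zero
    rw [zero_div, ← m.s_pt] at h1
    exact m.ne _ _ (smul_left_cancel _ h1)
  have h1 := h'.2 0 1
  have hn := acts_norm_ne_zero h
  rw [mul_smul, mul_smul, hc 1 one_ne_zero, h.2, mul_zero,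
    hc _ (mul_ne_zero hn (div_ne_zero hc0 one_ne_zero))] at h1
  rw [← mul_one κ'.1.norm, ← (m.inj _ _ _ _ h1).2]
  field_simp

end SModel

end

lemma sq_or (a : F89) : ∃ r, a = r * r ∨ a = 3 * (r * r) := by
  revert a
  decide +kernel

lemma eq_zero_of_sq_eq_three {a r : F89} (h : a * a = 3 * (r * r)) : r = 0 := by
  by_contra h0
  have h1 : (a / r) * (a / r) = 3 := by
    rw [div_mul_div_comm, h, mul_div_assoc, div_self (mul_ne_zero h0 h0), mul_one]
  have h2 : ∀ x : F89, x * x ≠ 3 := by decide +kernel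
  exact h2 _ h1

section

variable {G Ω : Type*} [Group G] [MulAction G Ω]

/-- A model with a swapping involution acting on the fixed points of `z` as `a ↦ c / a`. -/
structure CModel (G Ω : Type*) [Group G] [MulAction G Ω] extends SModel G Ω where
  /-- the parameter of the involution -/
  c : F89
  s_pnt : ∀ a, a ≠ 0 → s • pnt 0 a = pnt 0 (c / a)

namespace CModel

variable {m : CModel G Ω}

lemma c_nonsquare (a : F89) : m.c ≠ a * a := by
  intro h
  rcases eq_or_ne a 0 with rfl | h0
  · have h1 := m.s_pnt 1 one_ne_zero
    rw [h, zero_mul, zero_div, ← m.s_pt] at h1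
    exact m.ne _ _ (smul_left_cancel _ h1)
  · apply m.s_ne a
    rw [m.s_pnt a h0, h, mul_div_assoc, div_self h0, mul_one]

lemma c_ne_zero : m.c ≠ 0 := fun h => m.c_nonsquare 0 (by rw [h, mul_zero])

lemma T_pnt_zero (m : CModel G Ω) (b a : F89) : m.T 0 b • m.pnt 0 a = m.pnt 0 (b + a) := by
  rw [m.T_pnt, add_zero, zero_sym, add_zero]

variable (m) in
lemma exists_rel {b : F89} (hb : b ≠ 0) : ∃ k β, m.Acts k β ∧ β.norm = -(m.c / (b * b)) ∧
    m.s * m.T 0 b * m.s = m.T 0 (m.c / b) * k * m.s * m.T 0 (m.c / b) := by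
  have hc := m.c_ne_zero
  have hcb : m.c / b ≠ 0 := div_ne_zero hc hb
  obtain ⟨k, hk⟩ : ∃ k, k = m.T 0 (-(m.c / b)) * m.s * m.T 0 b * m.s * m.T 0 (-(m.c / b)) * m.s :=
    ⟨_, rfl⟩
  have hT : m.T 0 (-(m.c / b)) = (m.T 0 (m.c / b))⁻¹ := by rw [m.T_inv, neg_zero]
  have hK : k ∈ m.K := by
    rw [m.mem_K, hk]
    simp only [mul_smul]
    constructor
    · rw [m.s_pt, m.T_o, m.s_pnt _ (neg_ne_zero.2 hcb), m.T_pnt, div_neg, div_div_cancel₀ hc]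
      simp only [add_zero, add_neg_cancel, sym_zero]
      rw [m.s_o, m.T_pt]
    · rw [m.s_o, m.T_pt, m.s_pt, m.T_o, m.s_pnt _ hb, m.T_pnt]
      simp
  obtain ⟨β, hβ⟩ := m.exists_acts hK
  refine ⟨k, β, hβ, ?_, ?_⟩
  · have h1 := hβ.2 0 (-b)
    have h3 : -(m.c / b) + m.c / -b = -(2 * m.c / b) := by rw [div_neg]; ring
    have h4 : b + m.c / -(2 * m.c / b) = b / 2 := by
      have : (2 : F89) ≠ 0 := by decide
      field_simp
      ring
    rw [hk] at h1
    simp only [mul_smul] at h1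
    rw [m.s_pnt _ (neg_ne_zero.2 hb), m.T_pnt_zero, h3, m.s_pnt, m.T_pnt_zero, h4, m.s_pnt,
      m.T_pnt_zero] at h1
    · have h2 := (m.inj _ _ _ _ h1).2
      have h5 : (β : E89).norm = -(-(m.c / b) + m.c / (b / 2)) / b := by rw [h2]; field_simp
      rw [h5]
      field_simp
      ring
    · exact div_ne_zero hb (by decide)
    · exact neg_ne_zero.2 (div_ne_zero (mul_ne_zero (by decide) hc) hb)
  · have h1 : m.T 0 (m.c / b) * k * m.s * m.T 0 (m.c / b) =
        m.s * m.T 0 b * m.s * (m.T 0 (m.c / b))⁻¹ * (m.s * m.s) * m.T 0 (m.c / b) := by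
      rw [hk, hT]; group
    rw [h1, m.s_mul_s]
    group

lemma comm_s {k : G} {κ : E89} (h : m.Acts k κ) (h1 : κ.norm = 1) : m.s * k * m.s = k := by
  obtain ⟨κ', h', hn⟩ := SModel.exists_conj m.s_pnt h
  rw [h1, mul_one] at hn
  have hT : ∀ a, k * m.T 0 a = m.T 0 a * k := fun a => by
    rw [SModel.acts_T h, h1, one_mul]
  have hT' : ∀ a, k * (m.s * m.T 0 a * m.s) = m.s * m.T 0 a * m.s * k := fun a => by
    have h2 := SModel.acts_T h' a
    rw [hn, one_mul] at h2
    have h3 := congrArg (fun g => m.s * g * m.s) h2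
    rw [SModel.conj_s_mul (m.s * k * m.s), SModel.conj_s_mul (m.T 0 a), SModel.conj_s_s] at h3
    exact h3
  obtain ⟨l, β, hl, -, hr⟩ := m.exists_rel one_ne_zero
  have h2 : m.s = l⁻¹ * ((m.T 0 (m.c / 1))⁻¹ * (m.s * m.T 0 1 * m.s) * (m.T 0 (m.c / 1))⁻¹) := by
    rw [hr]; group
  have h3 : Commute k m.s := by
    rw [h2]
    exact (show Commute k l from SModel.acts_comm h hl).inv_right.mul_right
      (((show Commute k _ from hT _).inv_right.mul_right (hT' 1)).mul_right
        (show Commute k _ from hT _).inv_right)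
  rw [← h3.eq, mul_assoc, m.s_mul_s, mul_one]

lemma conj_sign {k : G} {κ κ' : E89} (h : m.Acts k κ) (h' : m.Acts (m.s * k * m.s) κ') :
    κ' * star κ = 1 ∨ κ' * star κ = -1 := by
  obtain ⟨κ₁, h₁, hn⟩ := SModel.exists_conj m.s_pnt h
  obtain rfl := h₁.unique' h'
  have hN := SModel.acts_norm_ne_zero h
  have h1 : (κ₁ * star κ) ^ 90 = 1 := pow_ninety (by rw [map_mul, norm_star, hn])
  have h2 : (m.s * k * m.s) ^ 88 = k ^ 88 := by
    rw [← comm_s (SModel.acts_pow h 88) (by rw [map_pow, F89_pow hN])]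
    have := conj_pow (a := m.s) (b := k) (i := 88)
    rwa [SModel.s_inv] at this
  have h3 : κ₁ ^ 88 = κ ^ 88 := by
    have h4 := SModel.acts_pow h' 88
    rw [h2] at h4
    exact h4.unique' (SModel.acts_pow h 88)
  have h5 : (κ₁ * star κ) ^ 88 = 1 := by
    rw [mul_pow, h3, ← mul_pow, mul_star_eq, ← map_pow, F89_pow hN, map_one]
  rw [show 90 = 88 + 2 from rfl, pow_add, h5, one_mul] at h1
  exact mul_self_eq_one_iff.1 (by rw [← sq, h1])

/-- The multipliers `κ` such that conjugation by `s` yields the inverse of the conjugate. -/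
def Good (m : CModel G Ω) (k : G) (κ : E89) : Prop :=
  m.Acts k κ ∧ m.Acts (m.s * k * m.s) (star κ)⁻¹

lemma Good.mul {k l : G} {κ μ : E89} (h : m.Good k κ) (h' : m.Good l μ) :
    m.Good (k * l) (κ * μ) := by
  refine ⟨h.1.mul h'.1, ?_⟩
  rw [SModel.conj_s_mul, star_mul', mul_inv]
  exact h.2.mul h'.2

lemma good_of_mul_eq_one {k : G} {κ κ' : E89} (h : m.Acts k κ) (h' : m.Acts (m.s * k * m.s) κ')
    (h1 : κ' * star κ = 1) : m.Good k κ := by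
  refine ⟨h, ?_⟩
  rwa [← eq_inv_of_mul_eq_one_left h1]

lemma good_mul_self {k : G} {κ : E89} (h : m.Acts k κ) : m.Good (k * k) (κ * κ) := by
  obtain ⟨κ', h', -⟩ := SModel.exists_conj m.s_pnt h
  refine good_of_mul_eq_one (h.mul h) (by rw [SModel.conj_s_mul]; exact h'.mul h') ?_
  rw [star_mul', mul_mul_mul_comm]
  rcases conj_sign h h' with h1 | h1 <;> rw [h1] <;> ring

lemma good_of_norm {k : G} {κ : E89} (h : m.Acts k κ) (h1 : κ.norm = 1) : m.Good k κ :=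
  good_of_mul_eq_one h (by rwa [comm_s h h1]) (by rw [mul_star_eq, h1, map_one])

lemma Good.inv {k : G} {κ : E89} (h : m.Good k κ) : m.Good k⁻¹ κ⁻¹ := by
  have h0 := SModel.acts_ne_zero h.1
  refine ⟨h.1.inv h0, ?_⟩
  have h1 := h.2.inv (inv_ne_zero (star_ne_zero.2 h0))
  rw [star_inv₀]
  rwa [mul_inv_rev, mul_inv_rev, SModel.s_inv, ← mul_assoc] at h1

variable (m) in
/-- The relation determining the cocycle of `s`. -/
def Rel (b : F89) (x : G) : Prop :=
  m.s * m.T 0 b * m.s = m.T 0 (m.c / b) * x * m.s * m.T 0 (m.c / b)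

lemma Rel.mul {b : F89} {k x l : G} {κ β : E89} (hk : m.Acts k κ)
    (hx : m.Acts x β) (hr : m.Rel b x) (hl : m.Rel (κ.norm * b) l) :
    l * k = x * (m.s * k * m.s) := by
  obtain ⟨κ', hk', hn⟩ := SModel.exists_conj m.s_pnt hk
  have h1 : m.s * m.T 0 (κ.norm * b) * m.s * (m.s * k * m.s) =
      m.s * k * m.s * (m.s * m.T 0 b * m.s) := by
    rw [← SModel.conj_s_mul, ← SModel.conj_s_mul, SModel.acts_T hk]
  have h2 : m.s * k * m.s * m.T 0 (m.c / b) = m.T 0 (m.c / (κ.norm * b)) * (m.s * k * m.s) := by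
    rw [SModel.acts_T hk']
    congr 2
    rw [eq_div_of_mul_eq (SModel.acts_norm_ne_zero hk) hn]
    field_simp
  rw [hr, hl] at h1
  have h3 : m.T 0 (m.c / (κ.norm * b)) * l * m.s * m.T 0 (m.c / (κ.norm * b)) * (m.s * k * m.s) =
      m.T 0 (m.c / (κ.norm * b)) * (l * (m.s * m.s) * k) * (m.s * m.T 0 (m.c / b)) := by
    rw [mul_assoc, ← h2]; group
  have h4 : m.s * k * m.s * (m.T 0 (m.c / b) * x * m.s * m.T 0 (m.c / b)) =
      m.T 0 (m.c / (κ.norm * b)) * (m.s * k * m.s * x) * (m.s * m.T 0 (m.c / b)) := by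
    rw [← mul_assoc (m.T 0 (m.c / (κ.norm * b))), ← h2]; group
  rw [h3, h4, m.s_mul_s, mul_one] at h1
  rw [mul_left_cancel (mul_right_cancel h1), SModel.acts_comm hk' hx]

lemma Rel.good {b : F89} (hb : b ≠ 0) {x : G} {β : E89} (hx : m.Acts x β)
    (hn : β.norm = -(m.c / (b * b))) (hr : m.Rel b x) : m.Good x β ∧ star β = -β := by
  have hβ := SModel.acts_ne_zero hx
  obtain ⟨k, κ, hk, hκ⟩ := m.norm_surj (a := 34) (by decide)
  have hN : (κ * κ).norm = -1 := by rw [map_mul, hκ]; decide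
  have hg := good_mul_self hk
  obtain ⟨l, γ, hl, -, hrl⟩ := m.exists_rel (neg_ne_zero.2 hb)
  replace hrl : m.Rel (-b) l := hrl
  have h1 := Rel.mul (hk.mul hk) hx hr (l := l) (by rwa [hN, neg_one_mul])
  have h2 : γ = -β := by
    have h3 := (hl.mul hg.1).unique' (h1 ▸ hx.mul hg.2)
    rw [eq_mul_inv_iff_mul_eq₀ (star_ne_zero.2 (SModel.acts_ne_zero hg.1)), mul_assoc,
      mul_star_eq, hN, map_neg, map_one, mul_neg_one] at h3
    rw [← h3, neg_neg]
  have h3 : l = m.s * x⁻¹ * m.s := by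
    have h4 : m.s * m.T 0 (-b) * m.s = (m.s * m.T 0 b * m.s)⁻¹ := by
      rw [mul_inv_rev, mul_inv_rev, SModel.s_inv, m.T_inv, neg_zero, mul_assoc]
    have h5 : m.T 0 (m.c / -b) = (m.T 0 (m.c / b))⁻¹ := by rw [m.T_inv, neg_zero, div_neg]
    rw [hrl, hr, h5] at h4
    have h6 : l = m.T 0 (m.c / b) * ((m.T 0 (m.c / b))⁻¹ * l * m.s * (m.T 0 (m.c / b))⁻¹) *
        m.T 0 (m.c / b) * m.s⁻¹ := by group
    rw [h6, h4]
    nth_rewrite 4 [← SModel.s_inv]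
    nth_rewrite 3 [← SModel.s_inv]
    group
  have h4 : m.Acts (m.s * x * m.s) (-β)⁻¹ := by
    have h5 := hl.inv (SModel.acts_ne_zero hl)
    rw [h2, h3] at h5
    simpa [mul_assoc, SModel.s_inv] using h5
  rcases conj_sign hx h4 with h | h
  · refine ⟨good_of_mul_eq_one hx h4 h, ?_⟩
    rw [inv_mul_eq_one₀ (neg_ne_zero.2 hβ)] at h
    exact h.symm
  · exfalso
    have h5 : star β = β := by
      rw [inv_mul_eq_iff_eq_mul₀ (neg_ne_zero.2 hβ)] at h
      rw [h, neg_mul_neg, mul_one]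
    have h6 := congrArg QuadraticAlgebra.im h5
    rw [QuadraticAlgebra.im_star] at h6
    have h7 : β.im = 0 := by
      have h8 : (2 : F89) * β.im = 0 := by linear_combination -h6
      exact (mul_eq_zero.1 h8).resolve_left (by decide)
    rw [QuadraticAlgebra.norm_def, h7] at hn
    apply m.c_nonsquare (34 * β.re * b)
    have h9 : m.c = -(β.re * β.re) * (b * b) := by
      field_simp at hn
      linear_combination hn
    have e : (89 : F89) = 0 := by decide
    rw [h9]
    linear_combination -13 * β.re * β.re * b * b * e

theorem good (m : CModel G Ω) {k : G} {κ : E89} (h : m.Acts k κ) : m.Good k κ := by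
  have hn := SModel.acts_norm_ne_zero h
  suffices h1 : ∃ l μ, m.Good l μ ∧ μ.norm = κ.norm by
    obtain ⟨l, μ, hl, hμ⟩ := h1
    have h3 : (κ * μ⁻¹).norm = 1 := by
      rw [map_mul, ← hμ, ← map_mul, mul_inv_cancel₀ (SModel.acts_ne_zero hl.1), map_one]
    have h2 := (good_of_norm (h.mul hl.inv.1) h3).mul hl
    rwa [inv_mul_cancel_right, inv_mul_cancel_right₀ (SModel.acts_ne_zero hl.1)] at h2
  obtain ⟨r, hr | hr⟩ := sq_or κ.norm
  · obtain ⟨l, μ, hl, hμ⟩ := m.norm_surj (a := r) (fun h0 => hn (by rw [hr, h0, mul_zero]))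
    exact ⟨_, _, good_mul_self hl, by rw [map_mul, hμ, hr]⟩
  · obtain ⟨r', hr' | hr'⟩ := sq_or m.c
    · exact absurd hr' (m.c_nonsquare _)
    have h0 : r ≠ 0 := fun h0 => hn (by rw [hr, h0, mul_zero, mul_zero])
    have h0' : r' ≠ 0 := fun h0 => m.c_ne_zero (by rw [hr', h0, mul_zero, mul_zero])
    have h34 : (34 : F89) ≠ 0 := by decide
    have hb : 34 * r' / r ≠ 0 := div_ne_zero (mul_ne_zero h34 h0') h0
    obtain ⟨x, β, hx, hβ, hrel⟩ := m.exists_rel hb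
    refine ⟨x, β, (Rel.good hb hx hβ hrel).1, ?_⟩
    have e : (89 : F89) = 0 := by decide
    rw [hβ, hr, hr']
    field_simp
    linear_combination -39 * e

/-- The involution is determined by a single parameter. -/
theorem exists_varpi (m : CModel G Ω) : ∃ t : F89, t ≠ 0 ∧ m.c = 3 * (t * t) ∧
    ∀ b, b ≠ 0 → ∃ x, m.Acts x ⟨0, t / b⟩ ∧ m.Rel b x := by
  obtain ⟨x, β, hx, hβ, hrel⟩ := m.exists_rel one_ne_zero
  have h1 := (Rel.good one_ne_zero hx hβ hrel).2
  have hre : β.re = 0 := by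
    have h2 := congrArg QuadraticAlgebra.re h1
    rw [QuadraticAlgebra.re_star, QuadraticAlgebra.re_neg] at h2
    have h8 : (2 : F89) * β.re = 0 := by linear_combination h2
    exact (mul_eq_zero.1 h8).resolve_left (by decide)
  have hc : m.c = 3 * (β.im * β.im) := by
    rw [QuadraticAlgebra.norm_def, hre] at hβ
    linear_combination hβ
  refine ⟨β.im, fun h => m.c_ne_zero (by rw [hc, h, mul_zero, mul_zero]), hc, fun b hb => ?_⟩
  obtain ⟨l, γ, hl, -, hrl⟩ := m.exists_rel hb
  obtain ⟨k, κ, hk, rfl⟩ := m.norm_surj hb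
  have h3 := Rel.mul hk hx hrel (l := l) (by rwa [mul_one])
  refine ⟨l, ?_, hrl⟩
  have h4 := (hl.mul hk).unique' (h3 ▸ hx.mul (m.good hk).2)
  rw [eq_mul_inv_iff_mul_eq₀ (star_ne_zero.2 (SModel.acts_ne_zero hk)), mul_assoc,
    mul_star_eq, ← eq_mul_inv_iff_mul_eq₀ (by simpa using hb)] at h4
  convert hl using 1
  rw [h4, ← map_inv₀]
  ext
  · simp [hre]
  · simp [div_eq_mul_inv]
    left
    field_simp

end CModel

end

/-- A model together with a normalised involution interchanging the two base points. -/
structure NModel (G Ω : Type*) [Group G] [MulAction G Ω] extends Model G Ω where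
  /-- the involution -/
  s : G
  s_mul_s : s * s = 1
  s_pt : s • pt = pnt 0 0
  s_o : s • pnt 0 0 = pt
  s_pnt : ∀ a, a ≠ 0 → s • pnt 0 a = pnt 0 (3 / a)
  exists_acts : ∀ k, k • pt = pt → k • pnt 0 0 = pnt 0 0 →
    ∃ κ : E89, κ ^ 2640 = 1 ∧ toModel.Acts k κ
  exists_acts_of_pow : ∀ κ : E89, κ ^ 2640 = 1 → ∃ k, toModel.Acts k κ
  conj : ∀ k κ, toModel.Acts k κ → toModel.Acts (s * k * s) (star κ)⁻¹
  rel : ∀ b, b ≠ 0 → ∃ x, toModel.Acts x ⟨0, b⁻¹⟩ ∧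
    s * T 0 b * s = T 0 (3 / b) * x * s * T 0 (3 / b)

section

variable {G Ω : Type*} [Group G] [MulAction G Ω]

theorem CModel.exists_nModel (m : CModel G Ω) : ∃ M : NModel G Ω, M.toModel = m.toModel := by
  obtain ⟨t, ht, hc, hrel⟩ := m.exists_varpi
  obtain ⟨k, κ, hk, hκ⟩ := m.norm_surj ht
  have hk1 := hk.inv (SModel.acts_ne_zero hk)
  have hκ1 : (κ⁻¹).norm = t⁻¹ := by
    refine eq_inv_of_mul_eq_one_left ?_
    rw [← hκ, ← map_mul, inv_mul_cancel₀ (SModel.acts_ne_zero hk), map_one]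
  have ho : k • m.pnt 0 0 = m.pnt 0 0 := hk.mem_K.2
  refine ⟨⟨m.toModel, k⁻¹ * m.s * k, ?_, ?_, ?_, ?_, ?_, fun κ =>
    m.exists_acts_of_pow, ?_, ?_⟩, rfl⟩
  · have : k⁻¹ * m.s * k * (k⁻¹ * m.s * k) = k⁻¹ * (m.s * m.s) * k := by group
    rw [this, m.s_mul_s]
    group
  · rw [mul_smul, mul_smul, hk.1, m.s_pt, hk1.mem_K.2]
  · rw [mul_smul, mul_smul, ho, m.s_o, hk1.1]
  · intro a ha
    rw [mul_smul, mul_smul, hk.2, mul_zero, hκ, m.s_pnt _ (mul_ne_zero ht ha), hk1.2, mul_zero,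
      hκ1, hc]
    congr 1
    field_simp
  · intro l h1 h2
    obtain ⟨μ, h⟩ := m.exists_acts (k := l) ⟨h1, h2⟩
    exact ⟨μ, SModel.pow_eq_one h, h⟩
  · intro l μ h
    have h1 := (m.good h).2
    have h2 : k⁻¹ * m.s * k * l * (k⁻¹ * m.s * k) = k⁻¹ * (m.s * (k * l * k⁻¹) * m.s) * k := by
      group
    rw [h2, SModel.acts_comm hk h, mul_inv_cancel_right, mul_assoc, SModel.acts_comm h1 hk,
      inv_mul_cancel_left]
    exact h1
  · intro b hb
    obtain ⟨x, hx, hr⟩ := hrel (t * b) (mul_ne_zero ht hb)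
    refine ⟨x, ?_, ?_⟩
    · convert hx using 2
      field_simp
    · have h1 := SModel.acts_T hk1 (m.c / (t * b))
      have h2 := SModel.acts_T hk b
      have h3 := SModel.acts_T hk (3 / b)
      have h4 : m.c / (t * b) = κ.norm * (3 / b) := by
        rw [hc, hκ]
        field_simp
      have h5 : k⁻¹ * m.s * k * m.T 0 b * (k⁻¹ * m.s * k) =
          k⁻¹ * (m.s * (k * m.T 0 b * k⁻¹) * m.s) * k := by group
      rw [h5, h2, mul_inv_cancel_right, hκ, hr, h4, ← mul_assoc, ← mul_assoc, ← mul_assoc]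
      rw [h4, hκ1, hκ, inv_mul_cancel_left₀ ht, ← hκ] at h1
      rw [h1, mul_assoc _ (m.T 0 _) k, ← h3, mul_assoc (m.T 0 _) k⁻¹ x, SModel.acts_comm hk1 hx]
      group

end

lemma conj_mul_mul {G : Type*} [Group G] {z : G} (hz : z * z = 1) (p q r : G) :
    z * (p * q * r) * z = z * p * z * (z * q * z) * (z * r * z) := by
  have : z * p * z * (z * q * z) * (z * r * z) = z * p * (z * z) * q * (z * z) * r * z := by group
  rw [this, hz]
  group

section

variable {G Ω : Type*} [Group G] [MulAction G Ω]

namespace NModel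

variable {m : NModel G Ω}

lemma z_comm_s (m : NModel G Ω) : m.z * m.s = m.s * m.z := m.z_comm_swap m.s_pt m.s_o

lemma z_T (m : NModel G Ω) (u : E89) (a : F89) : m.z * m.T u a * m.z = m.T (-u) a := by
  refine m.ext ?_ fun u' a' => ?_
  · rw [mul_smul, mul_smul, m.z_pt, m.T_pt, m.z_pt, m.T_pt]
  · rw [mul_smul, mul_smul, m.z_pnt, m.T_pnt, m.z_pnt, m.T_pnt, sym_neg, neg_sym, neg_add, neg_neg]

lemma s_inv (m : NModel G Ω) : m.s⁻¹ = m.s := inv_eq_of_mul_eq_one_right m.s_mul_s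

lemma acts_T {k : G} {κ : E89} (h : m.Acts k κ) (u : E89) (a : F89) :
    k * m.T u a = m.T (κ * u) (κ.norm * a) * k := by
  refine m.ext ?_ fun w b => ?_
  · rw [mul_smul, mul_smul, m.T_pt, h.1, m.T_pt]
  · rw [mul_smul, mul_smul, m.T_pnt, h.2, h.2, m.T_pnt, sym_mul]
    congr 1 <;> ring

lemma acts_ne_zero {k : G} {κ : E89} (h : m.Acts k κ) : κ ≠ 0 := by
  obtain ⟨μ, h1, h2⟩ := m.exists_acts k h.1 h.mem_K.2
  rintro rfl
  rw [← h.unique' h2, zero_pow (by norm_num)] at h1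
  exact zero_ne_one h1

lemma exists_decomp (m : NModel G Ω) {w : E89} (hw : w ≠ 0) :
    ∃ (k : G) (κ : E89) (u : E89) (a : F89),
    m.Acts k κ ∧ star κ = κ ∧ m.s * m.T w 0 * m.s = m.T u a * (m.s * k) * m.T u (-a) := by
  obtain ⟨g, hg⟩ : ∃ g, g = m.s * m.T w 0 * m.s := ⟨_, rfl⟩
  have hz : m.z * g * m.z = g⁻¹ := by
    have h1 : m.z * g * m.z = m.s * (m.z * m.T w 0 * m.z) * m.s := by
      rw [hg]
      simp only [← mul_assoc]
      rw [m.z_comm_s]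
      simp only [mul_assoc]
      rw [m.z_comm_s]
    rw [h1, z_T, hg, mul_inv_rev, mul_inv_rev, m.s_inv, m.T_inv, neg_zero, mul_assoc]
  have hpt : g • m.pt ≠ m.pt := by
    rw [hg, mul_smul, mul_smul, m.s_pt, m.T_o]
    intro h
    rw [← m.s_o] at h
    exact hw (m.inj _ _ _ _ (smul_left_cancel _ h)).1
  obtain ⟨u, a, hua⟩ := m.surj _ hpt
  have hinv : g⁻¹ • m.pt = m.pnt (-u) a := by
    rw [← hz, mul_smul, mul_smul, m.z_pt, ← hua, m.z_pnt]
  have hT : m.T u (-a) = (m.T (-u) a)⁻¹ := by rw [m.T_inv, neg_neg]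
  obtain ⟨k, hk⟩ : ∃ k, k = m.s * ((m.T u a)⁻¹ * g * m.T (-u) a) := ⟨_, rfl⟩
  have hgk : g = m.T u a * (m.s * k) * m.T u (-a) := by
    rw [hk, hT, ← mul_assoc m.s, m.s_mul_s]
    group
  obtain ⟨κ, -, hκ⟩ := m.exists_acts k
    (by simp only [hk, mul_smul]; rw [m.T_pt, ← hua, ← m.T_o u a, inv_smul_smul, m.s_o])
    (by simp only [hk, mul_smul]; rw [m.T_o, ← hinv, smul_inv_smul,
      inv_smul_eq_iff.2 (m.T_pt _ _).symm, m.s_pt])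
  refine ⟨k, κ, u, a, hκ, ?_, hg ▸ hgk⟩
  have h1 : m.s * k * (m.s * k) = 1 := by
    have hzk : m.z * (m.s * k) * m.z = m.s * k := by
      rw [← mul_assoc, m.z_comm_s, mul_assoc, mul_assoc, ← m.z_comm_K hκ.mem_K,
        ← mul_assoc m.z, m.z_mul_z, one_mul]
    rw [hgk, conj_mul_mul m.z_mul_z, z_T, z_T, hzk, mul_inv_rev, mul_inv_rev, m.T_inv, m.T_inv,
      neg_neg, mul_assoc] at hz
    have h3 := mul_right_cancel (mul_left_cancel hz)
    nth_rewrite 1 [h3]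
    exact inv_mul_cancel _
  have h2 := m.conj k κ hκ
  rw [eq_inv_of_mul_eq_one_left (a := m.s * k * m.s) (b := k) (by rw [mul_assoc, h1])] at h2
  exact inv_injective (h2.unique' (hκ.inv (acts_ne_zero hκ)))

/-- The involutions obtained from `s` by scalars. -/
structure Inv (m : NModel G Ω) (e : G) (θ : F89) : Prop where
  ne : θ ≠ 0
  mul_self : e * e = 1
  pt : e • m.pt = m.pnt 0 0
  o : e • m.pnt 0 0 = m.pt
  pnt : ∀ a, a ≠ 0 → e • m.pnt 0 a = m.pnt 0 (3 * θ ^ 2 / a)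
  comm_z : m.z * e = e * m.z
  rel : ∀ b, b ≠ 0 → ∃ x, m.Acts x ⟨0, θ / b⟩ ∧
    e * m.T 0 b * e = m.T 0 (3 * θ ^ 2 / b) * x * e * m.T 0 (3 * θ ^ 2 / b)

lemma norm_coe (θ : F89) : (algebraMap F89 E89 θ).norm = θ ^ 2 := by
  rw [QuadraticAlgebra.norm_def]
  simp [sq]

lemma s_conj {k : G} {κ : E89} (hk : m.Acts k κ) (hκ : star κ = κ) : m.s * k * m.s = k⁻¹ := by
  have h := m.conj k κ hk
  rw [hκ] at h
  exact h.unique (hk.inv (acts_ne_zero hk))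

lemma inv_of_acts {k : G} {θ : F89} (hk : m.Acts k (algebraMap F89 E89 θ)) :
    m.Inv (k * m.s) θ := by
  have h0 := acts_ne_zero hk
  have hθ : θ ≠ 0 := fun h => h0 (by rw [h, map_zero])
  have hs := s_conj hk (by ext <;> simp)
  refine ⟨hθ, ?_, ?_, ?_, fun a ha => ?_, ?_, fun b hb => ?_⟩
  · rw [mul_assoc, ← mul_assoc m.s, hs, mul_inv_cancel]
  · rw [mul_smul, m.s_pt, hk.mem_K.2]
  · rw [mul_smul, m.s_o, hk.1]
  · rw [mul_smul, m.s_pnt a ha, hk.2, mul_zero, norm_coe]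
    congr 1
    field_simp
  · rw [← mul_assoc, m.z_comm_K hk.mem_K, mul_assoc, z_comm_s, mul_assoc]
  · obtain ⟨x, hx, hr⟩ := m.rel b hb
    refine ⟨k * x, ?_, ?_⟩
    · convert hk.mul hx using 1
      ext <;> simp [div_eq_mul_inv]
    · have hT : m.T 0 (3 * θ ^ 2 / b) = k * m.T 0 (3 / b) * k⁻¹ := by
        rw [acts_T hk, mul_zero, norm_coe, mul_inv_cancel_right]
        congr 1
        ring
      have hs' : m.s * k⁻¹ = k * m.s := by
        rw [← hs, ← mul_assoc, ← mul_assoc, m.s_mul_s, one_mul]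
      have hs'' : k * m.s = m.s * k⁻¹ := hs'.symm
      have h1 : k * m.s * m.T 0 b * (k * m.s) = k * (m.s * m.T 0 b * m.s) * k⁻¹ := by
        nth_rewrite 2 [hs'']
        group
      have h2 : k * m.T 0 (3 / b) * k⁻¹ * (k * x) * (k * m.s) * (k * m.T 0 (3 / b) * k⁻¹) =
          k * m.T 0 (3 / b) * x * (k * m.s) * (k * m.T 0 (3 / b) * k⁻¹) := by group
      rw [h1, hr, hT, h2, hs'']
      group

lemma exists_inv (m : NModel G Ω) {w : E89} (hw : w ≠ 0) :
    ∃ (k : G) (θ : F89) (v : E89) (b : F89), m.Acts k (algebraMap F89 E89 θ) ∧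
      k * m.s * m.T w 0 * (k * m.s) = m.T v b * (k * m.s) * m.T v (-b) := by
  obtain ⟨k, κ, u, a, hk, hκ, h⟩ := m.exists_decomp hw
  have hs'' : k * m.s = m.s * k⁻¹ := by
    rw [← s_conj hk hκ, ← mul_assoc, ← mul_assoc, m.s_mul_s, one_mul]
  have h1 : κ = algebraMap F89 E89 κ.re := by
    have h2 := congrArg QuadraticAlgebra.im hκ
    rw [QuadraticAlgebra.im_star] at h2
    have h8 : (2 : F89) * κ.im = 0 := by linear_combination -h2
    ext
    · simp
    · simpa using (mul_eq_zero.1 h8).resolve_left (by decide)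
  refine ⟨k, κ.re, κ * u, κ.norm * a, h1 ▸ hk, ?_⟩
  rw [← mul_neg, eq_mul_inv_of_mul_eq (acts_T hk u a).symm,
    eq_mul_inv_of_mul_eq (acts_T hk u (-a)).symm]
  have h2 : k * m.s * m.T w 0 * (k * m.s) = k * (m.s * m.T w 0 * m.s) * k⁻¹ := by
    nth_rewrite 2 [hs'']
    group
  rw [h2, h]
  group

end NModel

end

/-- Multiplication by `√3`. -/
def rt : E89 := ⟨0, 1⟩

lemma rt_mul_rt : rt * rt = algebraMap F89 E89 3 := by
  ext <;> simp [rt]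

section

variable {G Ω : Type*} [Group G] [MulAction G Ω]

namespace NModel

variable {m : NModel G Ω}

/-- The values of an involution on a line, for an element inverted by the central involution. -/
structure Line (m : NModel G Ω) (e : G) (θ : F89) (w v : E89) (b : F89) (V : F89 → E89)
    (B : F89 → F89) : Prop where
  ne : v ≠ 0
  e_w : e • m.pnt w 0 = m.pnt v b
  e_v : ∀ a, e • m.pnt v (a - b) = m.pnt (V a) (B a)
  V_zero : V 0 = -v
  B_zero : B 0 = -b
  rec_V : ∀ a, (a / (3 * θ)) • (rt * V (a + 2 * b)) = v + V a
  rec_B : ∀ a, a ≠ 0 → a - a ^ 2 / (3 * θ ^ 2) * B (a + 2 * b) - sym v (V a) = b + B a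
  refl_V : ∀ a, a ≠ 0 → V a = -((θ / a) • (rt * V (3 * θ ^ 2 / a)))

lemma Inv.exists_pnt {e : G} {θ : F89} (h : m.Inv e θ) {v : E89} (hv : v ≠ 0) (a : F89) :
    ∃ V B, e • m.pnt v a = m.pnt V B := by
  obtain ⟨V, B, hVB⟩ := m.surj (e • m.pnt v a) (by
    rw [← h.o]
    exact fun h1 => hv (m.inj _ _ _ _ (smul_left_cancel _ h1)).1)
  exact ⟨V, B, hVB.symm⟩

lemma Inv.smul_smul {e : G} {θ : F89} (h : m.Inv e θ) (x : Ω) : e • e • x = x := by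
  rw [← mul_smul, h.mul_self, one_smul]

lemma Inv.neg {e : G} {θ : F89} (h : m.Inv e θ) {v V : E89} {a B : F89}
    (h1 : e • m.pnt v a = m.pnt V B) : e • m.pnt (-v) a = m.pnt (-V) B := by
  rw [← m.z_pnt, ← mul_smul, ← h.comm_z, mul_smul, h1, m.z_pnt]

theorem Inv.exists_line {e : G} {θ : F89} (h : m.Inv e θ) {w v : E89} {b : F89} (hw : w ≠ 0)
    (he : e * m.T w 0 * e = m.T v b * e * m.T v (-b)) :
    ∃ V B, m.Line e θ w v b V B := by
  have ew : e • m.pnt w 0 = m.pnt v b := by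
    have h1 := congrArg (· • m.pt) he
    simp only [mul_smul] at h1
    rw [h.pt, m.T_o, m.T_pt, h.pt, m.T_o] at h1
    exact h1
  have hv : v ≠ 0 := by
    rintro rfl
    have h1 : e • m.pnt 0 b = m.pnt w 0 := by rw [← ew, h.smul_smul]
    rcases eq_or_ne b 0 with rfl | hb
    · rw [h.o] at h1
      exact m.ne _ _ h1.symm
    · rw [h.pnt b hb] at h1
      exact hw (m.inj _ _ _ _ h1).1.symm
  have eq_e : ∀ x y, x = e • y ↔ e • x = y := fun x y =>
    ⟨fun h1 => by rw [h1, h.smul_smul], fun h1 => by rw [← h1, h.smul_smul]⟩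
  choose V B hVB using fun a => h.exists_pnt hv (a - b)
  have e0 : e • m.pnt v (-b) = m.pnt (-v) (-b) := by
    have h1 : e * m.T v (-b) * e = (m.T v b)⁻¹ * e * m.T w 0 := by
      have h2 : (m.T v b)⁻¹ * (e * m.T w 0 * e) * e = e * m.T v (-b) * e := by rw [he]; group
      rw [← h2, mul_assoc, mul_assoc _ e e, h.mul_self, mul_one, mul_assoc]
    have h2 := congrArg (· • m.pt) h1
    simp only [mul_smul] at h2
    rw [h.pt, m.T_pt, h.pt, m.T_o, m.T_inv, m.T_o] at h2
    exact h2
  have h0 := m.inj _ _ _ _ ((hVB 0).symm.trans (by rw [zero_sub, e0]))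
  have hn : 3 * θ ^ 2 ≠ 0 := mul_ne_zero (by decide) (pow_ne_zero 2 h.ne)
  have key : ∀ a, a ≠ 0 → v - (a / (3 * θ)) • (rt * V (a + 2 * b)) = - V a ∧
      -b + (a - a ^ 2 / (3 * θ ^ 2) * B (a + 2 * b)) -
        sym v ((a / (3 * θ)) • (rt * V (a + 2 * b))) = B a := by
    intro a ha
    obtain ⟨x, hx, hr⟩ := h.rel (3 * θ ^ 2 / a) (div_ne_zero hn ha)
    rw [div_div_cancel₀ hn] at hr
    obtain ⟨μ, hμ⟩ : ∃ μ : E89, μ = ⟨0, θ / (3 * θ ^ 2 / a)⟩ := ⟨_, rfl⟩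
    rw [← hμ] at hx
    have hμ1 : ∀ y, μ * y = (a / (3 * θ)) • (rt * y) := by
      have := h.ne
      intro y
      rw [hμ]
      ext
      · simp [rt]
        field_simp
      · simp [rt]
        field_simp
        exact .inl trivial
    have hμ2 : μ.norm = -(a ^ 2 / (3 * θ ^ 2)) := by
      have := h.ne
      rw [hμ, QuadraticAlgebra.norm_def]
      field_simp
      simp
    have hcomm : e * m.T w 0 * e * (e * m.T 0 (3 * θ ^ 2 / a) * e) =
        e * m.T 0 (3 * θ ^ 2 / a) * e * (e * m.T w 0 * e) := by
      have h1 : ∀ p q, e * p * e * (e * q * e) = e * (p * q) * e := fun p q => by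
        have : e * p * e * (e * q * e) = e * p * (e * e) * q * e := by group
        rw [this, h.mul_self]
        group
      rw [h1, h1, m.T_mul, m.T_mul]
      simp
    rw [he, hr] at hcomm
    have h1 := congrArg (· • m.pnt (-v) b) hcomm
    simp only [mul_smul] at h1
    have h2 : e • m.pnt (-v) (a + b) = m.pnt (-V (a + 2 * b)) (B (a + 2 * b)) := by
      have h3 := h.neg (hVB (a + 2 * b))
      rwa [show a + 2 * b - b = a + b by ring] at h3
    have h4 : m.T v (-b) • m.pnt (-v) b = m.pnt 0 0 := by
      rw [m.T_pnt, sym_neg, sym_self]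
      simp
    rw [h4, h.o, m.T_pt, m.T_pt, h.pt, hx.mem_K.2, m.T_o, m.T_pnt, zero_add, zero_sym, add_zero, h2,
      hx.2, m.T_pnt, zero_add, zero_sym, add_zero, m.T_pnt, ← eq_inv_smul_iff, m.T_inv, m.T_pnt,
      ← eq_e, add_zero, sym_zero, add_zero, neg_add_eq_sub b a, h.neg (hVB a)] at h1
    obtain ⟨h5, h6⟩ := m.inj _ _ _ _ h1
    rw [mul_neg, hμ1] at h5 h6
    rw [hμ2, sym_neg] at h6
    refine ⟨by rw [← h5, sub_eq_add_neg], ?_⟩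
    rw [← h6]
    ring
  refine ⟨V, B, hv, ew, hVB, h0.1, h0.2, fun a => ?_, fun a ha => ?_, fun a ha => ?_⟩
  · rcases eq_or_ne a 0 with rfl | ha
    · rw [h0.1, zero_div, zero_smul, add_neg_cancel]
    · have := (key a ha).1
      linear_combination -this
  · obtain ⟨h1, h2⟩ := key a ha
    rw [show (a / (3 * θ)) • (rt * V (a + 2 * b)) = v + V a by linear_combination -h1, sym_add,
      sym_self] at h2
    linear_combination h2
  · obtain ⟨x, hx, hr⟩ := h.rel a ha
    have h1 := congrArg (· • m.pnt (-v) (-b)) hr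
    simp only [mul_smul] at h1
    rw [h.neg e0, neg_neg, m.T_pnt, zero_add, zero_sym, add_zero, ← sub_eq_add_neg, hVB,
      m.T_pnt, zero_add, zero_sym, add_zero, ← sub_eq_add_neg, h.neg (hVB _), hx.2, m.T_pnt] at h1
    have h2 := (m.inj _ _ _ _ h1).1
    rw [h2, zero_add, mul_neg, ← smul_mul_assoc]
    congr 2
    ext <;> simp [rt]

end NModel

end

/-- The sequence of values forced by the recursion on a line with a nonzero second coordinate. -/
def lineSeq (r : F89) : ℕ → F89 × F89
  | 0 => (-1, 0)
  | k + 1 => (-1 - ((k + 1 : ℕ) : F89) * r * (3 * (lineSeq r k).2),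
      -(((k + 1 : ℕ) : F89) * r * (lineSeq r k).1))

lemma lineSeq_ne (r : F89) (hr : r ≠ 0) : ∃ k ∈ List.range 25, ∃ j ∈ List.range 25,
    3 * r * r * (j * k) = 1 ∧ 3 * r * k * (lineSeq r k).2 ≠ (lineSeq r j).1 := by
  revert r
  decide +kernel

section

variable {G Ω : Type*} [Group G] [MulAction G Ω]

namespace NModel

variable {m : NModel G Ω}

lemma Line.b_eq_zero {e : G} {θ : F89} (hθ : θ ≠ 0) {w v : E89} {b : F89} {V : F89 → E89}
    {B : F89 → F89} (h : m.Line e θ w v b V B) : b = 0 := by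
  by_contra hb
  have h2 : (2 : F89) ≠ 0 := by decide
  have h3 : (3 : F89) ≠ 0 := by decide
  obtain ⟨r, hr⟩ : ∃ r, r = 2 * b / (3 * θ) := ⟨_, rfl⟩
  have hseq : ∀ k : ℕ, V (-(k * (2 * b))) = (⟨(lineSeq r k).1, (lineSeq r k).2⟩ : E89) * v := by
    intro k
    induction k with
    | zero =>
      rw [Nat.cast_zero, zero_mul, neg_zero, h.V_zero]
      ext <;> simp [lineSeq]
    | succ k ih =>
      have h4 := h.rec_V (-((k + 1 : ℕ) * (2 * b)))
      rw [show -(((k + 1 : ℕ) : F89) * (2 * b)) + 2 * b = -(k * (2 * b)) by push_cast; ring, ih]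
        at h4
      rw [eq_sub_of_add_eq' h4.symm]
      have h5 : -(((k + 1 : ℕ) : F89) * (2 * b)) / (3 * θ) = -((k + 1 : ℕ) * r) := by
        rw [hr]; ring
      rw [h5]
      ext
      · simp [lineSeq, rt]
        ring
      · simp [lineSeq, rt]
        ring
  have hr0 : r ≠ 0 := by
    rw [hr]
    exact div_ne_zero (mul_ne_zero h2 hb) (mul_ne_zero h3 hθ)
  obtain ⟨k, -, j, -, hjk, hne⟩ := lineSeq_ne r hr0
  have hk : (k : F89) ≠ 0 := fun h0 => by
    rw [h0, mul_zero, mul_zero] at hjk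
    exact zero_ne_one hjk
  have h4 := h.refl_V (-(k * (2 * b))) (neg_ne_zero.2 (mul_ne_zero hk (mul_ne_zero h2 hb)))
  have h5 : 3 * θ ^ 2 / -(k * (2 * b)) = -(j * (2 * b)) := by
    rw [div_eq_iff (neg_ne_zero.2 (mul_ne_zero hk (mul_ne_zero h2 hb)))]
    rw [hr] at hjk
    field_simp at hjk
    linear_combination -hjk
  rw [h5, hseq, hseq] at h4
  have h6 : θ / -(k * (2 * b)) = -(1 / (3 * r * k)) := by
    rw [hr]
    field_simp
  rw [h6, neg_smul, neg_neg, ← mul_assoc, ← smul_mul_assoc] at h4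
  have h7 := congrArg QuadraticAlgebra.im (mul_right_cancel₀ h.ne h4)
  apply hne
  simp [rt] at h7
  rw [h7]
  field_simp

end NModel

end

lemma sym_mul_right (u x : E89) : sym u (x * u) = x.im * u.norm := by
  simp only [sym, QuadraticAlgebra.re_mul, QuadraticAlgebra.im_mul, QuadraticAlgebra.norm_def]
  ring

/-- The first coordinate of the involution `s`. -/
def sFst (u : E89) (a : F89) : E89 := rt * u * (⟨a, 15 * u.norm⟩ : E89)⁻¹

/-- The second coordinate of the involution `s`. -/
def sSnd (u : E89) (a : F89) : F89 := 3 * a / (a ^ 2 - 675 * u.norm ^ 2)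

section

variable {G Ω : Type*} [Group G] [MulAction G Ω]

namespace NModel

variable {m : NModel G Ω}

lemma sub_ne_zero_of_ne {a θ : F89} (hθ : θ ≠ 0) : a ^ 2 - 3 * θ ^ 2 ≠ 0 := fun h =>
  hθ (eq_zero_of_sq_eq_three (a := a) (by linear_combination h))

lemma exists_s_pnt (m : NModel G Ω) {u : E89} (hu : u ≠ 0) : ∃ θ : F89, θ ≠ 0 ∧
    ∀ a, ∃ u' a', m.s • m.pnt u a = m.pnt u' a' ∧ (⟨a, -θ⟩ : E89) * u' = rt * u ∧
      (3 * θ ^ 2 + a ^ 2) * (a' * (a ^ 2 - 3 * θ ^ 2)) =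
        3 * a * (a ^ 2 - 3 * θ ^ 2 - θ * u.norm) := by
  obtain ⟨k, θ, v, b, hk, he⟩ := m.exists_inv (neg_ne_zero.2 hu)
  have hi := inv_of_acts hk
  obtain ⟨V, B, hl⟩ := hi.exists_line (neg_ne_zero.2 hu) he
  have hθ := hi.ne
  obtain rfl := hl.b_eq_zero hθ
  obtain rfl : v = u := by
    have h1 := hl.e_v 0
    rw [hl.V_zero, sub_zero, ← hl.e_w, hi.smul_smul] at h1
    exact neg_injective (m.inj _ _ _ _ h1).1.symm
  have h3 : (3 : F89) ≠ 0 := by decide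
  refine ⟨θ, hθ, fun a => ?_⟩
  have hδ := sub_ne_zero_of_ne (a := a) hθ
  have hV : V a = ⟨3 * θ ^ 2 / (a ^ 2 - 3 * θ ^ 2), θ * a / (a ^ 2 - 3 * θ ^ 2)⟩ * v := by
    have h1 := hl.rec_V a
    rw [mul_zero, add_zero] at h1
    have h2 : (⟨-1, a / (3 * θ)⟩ : E89) * V a = v := by
      rw [eq_sub_of_add_eq h1.symm]
      ext
      · simp [rt]; ring
      · simp [rt]; ring
    conv_rhs => rw [← h2]
    rw [← mul_assoc]
    conv_lhs => rw [← one_mul (V a)]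
    congr 1
    ext
    · simp
      field_simp
      ring
    · simp
      field_simp
      ring
  refine ⟨θ⁻¹ • V a, B a / θ ^ 2, ?_, ?_, ?_⟩
  · have h1 := hl.e_v a
    rw [sub_zero, mul_smul, ← eq_inv_smul_iff, (hk.inv (acts_ne_zero hk)).2, ← map_inv₀,
      norm_coe] at h1
    rw [h1, Algebra.smul_def]
    congr 1
    field_simp
  · rw [hV]
    rw [← smul_mul_assoc, ← mul_assoc]
    congr 1
    ext
    · simp [rt]
      field_simp
      ring
    · simp only [rt, QuadraticAlgebra.im_mul, QuadraticAlgebra.im_smul, QuadraticAlgebra.re_smul,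
        smul_eq_mul]
      have h1 : a ^ 2 / (a ^ 2 - 3 * θ ^ 2) - 3 * θ ^ 2 / (a ^ 2 - 3 * θ ^ 2) = 1 := by
        rw [← sub_div, div_self hδ]
      field_simp
      linear_combination h1
  · rcases eq_or_ne a 0 with rfl | ha
    · rw [hl.B_zero]; simp
    · have h1 := hl.rec_B a ha
      rw [hV, sym_mul_right, mul_zero, add_zero, zero_add] at h1
      field_simp at h1 ⊢
      linear_combination -h1

theorem s_smul (m : NModel G Ω) {u : E89} {a : F89} (h0 : u ≠ 0 ∨ a ≠ 0) :
    m.s • m.pnt u a = m.pnt (sFst u a) (sSnd u a) := by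
  rcases eq_or_ne u 0 with rfl | hu
  · have ha := h0.resolve_left (not_not.2 rfl)
    rw [m.s_pnt a ha]
    simp only [sFst, sSnd, mul_zero, zero_mul, QuadraticAlgebra.norm_zero]
    congr 1
    field_simp
    simp
  obtain ⟨θ, hθ, h⟩ := m.exists_s_pnt hu
  have hrt : rt ≠ 0 := fun h => absurd (congrArg QuadraticAlgebra.im h) (by decide)
  have main : ∀ a, ∃ u' a', m.s • m.pnt u a = m.pnt u' a' ∧
      (⟨a, -θ⟩ : E89) * u' = rt * u ∧ a' * (a ^ 2 - 3 * θ ^ 2) = 3 * a ∧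
      (3 * θ ^ 2 + a ^ 2) * (a' * (a ^ 2 - 3 * θ ^ 2)) =
        3 * a * (a ^ 2 - 3 * θ ^ 2 - θ * u.norm) := by
    intro a
    obtain ⟨u', a', h1, h2, h4⟩ := h a
    refine ⟨u', a', h1, h2, ?_, h4⟩
    have hu' : u' ≠ 0 := by
      rintro rfl
      rw [mul_zero] at h2
      exact mul_ne_zero hrt hu h2.symm
    obtain ⟨θ', -, h'⟩ := m.exists_s_pnt hu'
    obtain ⟨u'', a'', h5, h6, -⟩ := h' a'
    rw [← h1, ← mul_smul, m.s_mul_s, one_smul] at h5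
    obtain ⟨rfl, rfl⟩ := m.inj _ _ _ _ h5
    have h7 : (⟨a', -θ'⟩ : E89) * ⟨a, -θ⟩ = algebraMap F89 E89 3 := by
      refine mul_right_cancel₀ hu' ?_
      rw [mul_assoc, h2, mul_left_comm, h6, ← mul_assoc, rt_mul_rt]
    have h8 := congrArg QuadraticAlgebra.re h7
    have h9 := congrArg QuadraticAlgebra.im h7
    simp at h8 h9
    linear_combination a * h8 + 3 * θ * h9
  have hθN : θ = -(15 * u.norm) := by
    obtain ⟨u', a', -, -, h1, h2⟩ := main 1
    rw [h1] at h2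
    have h3 : θ * (6 * θ + u.norm) = 0 := by
      have : (3 : F89) ≠ 0 := by decide
      refine mul_left_cancel₀ this ?_
      linear_combination h2
    have h4 := (mul_eq_zero.1 h3).resolve_left hθ
    have e : (89 : F89) = 0 := by decide
    linear_combination 15 * h4 - θ * e
  have hδ := sub_ne_zero_of_ne (a := a) hθ
  have hfin : ∀ u' a', (⟨a, -θ⟩ : E89) * u' = rt * u → a' * (a ^ 2 - 3 * θ ^ 2) = 3 * a →
      m.pnt u' a' = m.pnt (sFst u a) (sSnd u a) := by
    intro u' a' h1 h2
    have hD : (⟨a, -θ⟩ : E89) ≠ 0 := fun h => by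
      rw [h, zero_mul] at h1
      exact mul_ne_zero hrt hu h1.symm
    rw [hθN] at h2 hδ
    congr 1
    · rw [sFst, ← h1, hθN, neg_neg, mul_comm, ← mul_assoc, inv_mul_cancel₀, one_mul]
      rwa [hθN, neg_neg] at hD
    · rw [sSnd, eq_div_iff]
      · rw [← h2]; ring
      · convert hδ using 1; ring
  obtain ⟨u', a', h1, h2, h3, -⟩ := main a
  rw [h1]
  exact hfin u' a' h2 h3

end NModel

end

section

variable {G Ω H Ω' : Type*} [Group G] [MulAction G Ω] [Group H] [MulAction H Ω']

/-- The points in coordinates. -/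
noncomputable def Model.coords (m : Model G Ω) : Option (E89 × F89) ≃ Ω :=
  Equiv.ofBijective (fun x => x.elim m.pt fun y => m.pnt y.1 y.2) <| by
    constructor
    · rintro (_ | ⟨u, a⟩) (_ | ⟨v, b⟩) h
      · rfl
      · exact absurd h.symm (m.ne v b)
      · exact absurd h (m.ne u a)
      · obtain ⟨rfl, rfl⟩ := m.inj _ _ _ _ h
        rfl
    · intro x
      by_cases hx : x = m.pt
      · exact ⟨none, hx.symm⟩
      · obtain ⟨u, a, h⟩ := m.surj x hx
        exact ⟨some (u, a), h⟩

/-- The permutation representation in coordinates. -/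
noncomputable def Model.permRep (m : Model G Ω) : G →* Equiv.Perm (Option (E89 × F89)) :=
  m.coords.symm.permCongrHom.toMonoidHom.comp (MulAction.toPermHom G Ω)

namespace Model

variable {m : Model G Ω} {n : Model H Ω'}

lemma permRep_injective (m : Model G Ω) : Function.Injective m.permRep := by
  refine m.coords.symm.permCongrHom.injective.comp
    ((injective_iff_map_eq_one _).2 fun g hg => m.faithful g fun x => ?_)
  exact congrArg (fun f => f x) hg

lemma permRep_eq_iff {g : G} {x y : Option (E89 × F89)} :
    m.permRep g x = y ↔ g • m.coords x = m.coords y :=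
  m.coords.symm_apply_eq

lemma permRep_none {g : G} : m.permRep g none = none ↔ g • m.pt = m.pt := permRep_eq_iff

lemma permRep_none_some {g : G} {u : E89} {a : F89} :
    m.permRep g none = some (u, a) ↔ g • m.pt = m.pnt u a := permRep_eq_iff

lemma permRep_some_none {g : G} {u : E89} {a : F89} :
    m.permRep g (some (u, a)) = none ↔ g • m.pnt u a = m.pt := permRep_eq_iff

lemma permRep_some {g : G} {u v : E89} {a b : F89} :
    m.permRep g (some (u, a)) = some (v, b) ↔ g • m.pnt u a = m.pnt v b := permRep_eq_iff

lemma permRep_T (u : E89) (a : F89) : m.permRep (m.T u a) = n.permRep (n.T u a) := by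
  ext1 x
  rcases x with _ | ⟨v, b⟩
  · rw [permRep_none.2 (m.T_pt u a), permRep_none.2 (n.T_pt u a)]
  · rw [permRep_some.2 (m.T_pnt u a v b), permRep_some.2 (n.T_pnt u a v b)]

lemma Acts.permRep_eq {k : G} {l : H} {κ : E89} (hk : m.Acts k κ) (hl : n.Acts l κ) :
    m.permRep k = n.permRep l := by
  ext1 x
  rcases x with _ | ⟨v, b⟩
  · rw [permRep_none.2 hk.1, permRep_none.2 hl.1]
  · rw [permRep_some.2 (hk.2 v b), permRep_some.2 (hl.2 v b)]

end Model

namespace NModel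

lemma permRep_s (m : NModel G Ω) (n : NModel H Ω') : m.permRep m.s = n.permRep n.s := by
  ext1 x
  rcases x with _ | ⟨u, a⟩
  · rw [Model.permRep_none_some.2 m.s_pt, Model.permRep_none_some.2 n.s_pt]
  · by_cases h : u ≠ 0 ∨ a ≠ 0
    · rw [Model.permRep_some.2 (m.s_smul h), Model.permRep_some.2 (n.s_smul h)]
    · push Not at h
      obtain ⟨rfl, rfl⟩ := h
      rw [Model.permRep_some_none.2 m.s_o, Model.permRep_some_none.2 n.s_o]

lemma range_permRep_le (m : NModel G Ω) (n : NModel H Ω') : m.permRep.range ≤ n.permRep.range := by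
  have h1 : ∀ g : G, g • m.pt = m.pt → m.permRep g ∈ n.permRep.range := by
    intro g hg
    obtain ⟨u, a, h⟩ := m.surj (g • m.pnt 0 0) fun h =>
      m.ne 0 0 (smul_left_cancel g (h.trans hg.symm))
    obtain ⟨κ, hκ, hk⟩ := m.exists_acts ((m.T u a)⁻¹ * g)
      (by rw [mul_smul, hg, inv_smul_eq_iff, m.T_pt])
      (by rw [mul_smul, inv_smul_eq_iff, m.T_o, h])
    obtain ⟨l, hl⟩ := n.exists_acts_of_pow κ hκ
    refine ⟨n.T u a * l, ?_⟩
    rw [map_mul, ← hk.permRep_eq hl, ← Model.permRep_T (m := m.toModel), ← map_mul,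
      mul_inv_cancel_left]
  rintro _ ⟨g, rfl⟩
  by_cases hg : g • m.pt = m.pt
  · exact h1 g hg
  obtain ⟨u, a, h⟩ := m.surj _ hg
  have h2 := h1 ((m.T u a * m.s)⁻¹ * g)
    (by rw [mul_smul, inv_smul_eq_iff, mul_smul, m.s_pt, m.T_o, h])
  rw [map_mul, map_inv, map_mul, Model.permRep_T (n := n.toModel), permRep_s m n, ← map_mul,
    ← map_inv] at h2
  exact (Subgroup.mul_mem_cancel_left _ (MonoidHom.mem_range.2 ⟨_, rfl⟩)).1 h2

theorem nonempty_mulEquiv (m : NModel G Ω) (n : NModel H Ω') : Nonempty (G ≃* H) :=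
  ⟨(MonoidHom.ofInjective m.permRep_injective).trans <|
    (MulEquiv.subgroupCongr (le_antisymm (m.range_permRep_le n) (n.range_permRep_le m))).trans
      (MonoidHom.ofInjective n.permRep_injective).symm⟩

end NModel

end

theorem LocalData.exists_nModel {G : Type*} [Group G] [Finite G] (L : LocalData G) :
    ∃ P : Subgroup G, Nonempty (NModel G (G ⧸ Subgroup.normalizer (P : Set G))) := by
  obtain ⟨P, F, -⟩ := L.exists_frame
  obtain ⟨x, hx, y, hy, hxy⟩ := F.not_comm L
  obtain ⟨M, -⟩ := F.exists_model ⟨⟨x, hx⟩, ⟨y, hy⟩, fun h => hxy (congrArg Subtype.val h)⟩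
  obtain ⟨S, -⟩ := M.exists_sModel
  obtain ⟨c, hc, -⟩ := S.exists_c
  obtain ⟨N, -⟩ := (⟨S, c, hc⟩ : CModel G _).exists_nModel
  exact ⟨P, ⟨N⟩⟩

theorem nonempty_mulEquiv_of_card {G H : Type*} [Group G] [Finite G] [Group H] [Finite H]
    (hG : Nat.card G = ordU) (hG7 : gkDegree G 7 = 1) (hG373 : gkDegree G 373 = 1)
    (hH : Nat.card H = ordU) (hH7 : gkDegree H 7 = 1) (hH373 : gkDegree H 373 = 1) :
    Nonempty (G ≃* H) := by
  obtain ⟨P, ⟨m⟩⟩ := (localData hG hG7 hG373).exists_nModel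
  obtain ⟨Q, ⟨n⟩⟩ := (localData hH hH7 hH373).exists_nModel
  exact m.nonempty_mulEquiv n

end U389

/-- Any two finite groups of order `2^5 * 3^4 * 5^2 * 7 * 11 * 89^3 * 373` whose prime graphs have
vertex degrees deg 2 = 4, deg 3 = 4, deg 5 = 4, deg 7 = 1, deg 11 = 3, deg 89 = 3, deg 373 = 1 are isomorphic (the
order and degree pattern of the simple unitary group `U_3(89)`). -/
theorem od_characterization_U_3_89
    (G H : Type*) [Group G] [Finite G] [Group H] [Finite H]
    (hG : Nat.card G = 2^5 * 3^4 * 5^2 * 7 * 11 * 89^3 * 373)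
    (hH : Nat.card H = 2^5 * 3^4 * 5^2 * 7 * 11 * 89^3 * 373)
    (hG2 : gkDegree G 2 = 4)
    (hG3 : gkDegree G 3 = 4)
    (hG5 : gkDegree G 5 = 4)
    (hG7 : gkDegree G 7 = 1)
    (hG11 : gkDegree G 11 = 3)
    (hG89 : gkDegree G 89 = 3)
    (hG373 : gkDegree G 373 = 1)
    (hH2 : gkDegree H 2 = 4)
    (hH3 : gkDegree H 3 = 4)
    (hH5 : gkDegree H 5 = 4)
    (hH7 : gkDegree H 7 = 1)
    (hH11 : gkDegree H 11 = 3)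
    (hH89 : gkDegree H 89 = 3)
    (hH373 : gkDegree H 373 = 1) :
    Nonempty (G ≃* H) := by
  exact U389.nonempty_mulEquiv_of_card hG hG7 hG373 hH hH7 hH373
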